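/- arXiv:math/0303165 — 3 statements merged into one kernel-verified Lean document; each statement's English description precedes it below -/
import Mathlib

section
/- Let q = pᵏ be a prime power with q ∉ {2,3} and F_q the finite field with q elements. Then there exist t, b, c ∈ F_q such that, with X = x(t) and Y = y(b,c) regarded as elements of SL(2,F_q), the matrix equation X⁻¹YX⁻¹Y⁻¹X² = YX⁻²Y⁻¹XY⁻¹ holds. -/
universe u

namespace Step
open Polynomial
set_option linter.unusedSimpArgs false
variable {K : Type*} [Field K]

theorem pow_dvd_hasse (f : K[X]) (n : ℕ) : ∀ i, f ^ (n - i) ∣ hasseDeriv i (f ^ n) := by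
  induction n with
  | zero => intro i; simp
  | succ n ih =>
    intro i
    rw [pow_succ', hasseDeriv_mul]
    apply Finset.dvd_sum
    rintro ⟨a, b⟩ hab
    rw [Finset.HasAntidiagonal.mem_antidiagonal] at hab
    simp only at hab ⊢
    rcases Nat.eq_zero_or_pos a with rfl | ha
    · rw [hasseDeriv_zero']
      have h1 := mul_dvd_mul (dvd_refl f) (ih b)
      rw [← pow_succ'] at h1
      exact (pow_dvd_pow f (by omega)).trans h1
    · exact ((pow_dvd_pow f (by omega)).trans (ih b)).mul_left _

noncomputable def G (f : K[X]) (n i : ℕ) : K[X] := hasseDeriv i (f ^ n) / f ^ (n - i)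

theorem G_spec (f : K[X]) (hf : f ≠ 0) (n i : ℕ) : hasseDeriv i (f ^ n) = f ^ (n - i) * G f n i :=
  (EuclideanDomain.mul_div_cancel' (pow_ne_zero _ hf) (pow_dvd_hasse f n i)).symm

theorem G_deg (f : K[X]) (hf : f ≠ 0) (n i : ℕ) (hi : i ≤ n) :
    (G f n i).natDegree ≤ i * f.natDegree := by
  by_cases h0 : G f n i = 0
  · simp [h0]
  have h1 := natDegree_hasseDeriv_le (f ^ n) i
  rw [G_spec f hf, natDegree_mul (pow_ne_zero _ hf) h0, natDegree_pow, natDegree_pow] at h1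
  obtain ⟨k, rfl⟩ := Nat.exists_eq_add_of_le hi
  rw [Nat.add_sub_cancel_left] at h1
  rw [add_mul] at h1
  omega

/-- the reduced Hasse derivative -/
noncomputable def D (f : K[X]) (n l : ℕ) : K[X] →ₗ[K] K[X] :=
  ∑ x ∈ Finset.HasAntidiagonal.antidiagonal l, (LinearMap.mulLeft K (f ^ (l - x.1) * G f n x.1)) ∘ₗ (hasseDeriv x.2)

theorem D_spec (f : K[X]) (hf : f ≠ 0) (n l : ℕ) (hl : l ≤ n) (r : K[X]) :
    hasseDeriv l (f ^ n * r) = f ^ (n - l) * D f n l r := by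
  rw [hasseDeriv_mul, D, LinearMap.sum_apply, Finset.mul_sum]
  apply Finset.sum_congr rfl
  rintro ⟨a, b⟩ hab
  rw [Finset.HasAntidiagonal.mem_antidiagonal] at hab
  simp only at hab
  simp only [LinearMap.comp_apply, LinearMap.mulLeft_apply]
  rw [G_spec f hf]
  have : n - a = (n - l) + (l - a) := by omega
  rw [this, pow_add]; ring

theorem D_deg (f : K[X]) (hf : f ≠ 0) (n l : ℕ) (hl : l ≤ n) (r : K[X]) :
    (D f n l r).natDegree ≤ r.natDegree + l * f.natDegree := by
  rw [D, LinearMap.sum_apply]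
  apply natDegree_sum_le_of_forall_le
  rintro ⟨a, b⟩ hab
  rw [Finset.HasAntidiagonal.mem_antidiagonal] at hab
  simp only at hab
  simp only [LinearMap.comp_apply, LinearMap.mulLeft_apply]
  refine natDegree_mul_le.trans ?_
  have h1 := natDegree_hasseDeriv_le r b
  have h2 : (f ^ (l - a) * G f n a).natDegree ≤ (l - a) * f.natDegree + a * f.natDegree :=
    natDegree_mul_le.trans (add_le_add (natDegree_pow_le) (G_deg f hf n a (by omega)))
  rw [← add_mul, Nat.sub_add_cancel (by omega)] at h2
  omega

theorem dvd_of_hasse (H : K[X]) (x : K) (M : ℕ) (h : ∀ l < M, (hasseDeriv l H).eval x = 0) :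
    (X - C x) ^ M ∣ H := by
  rw [X_sub_C_pow_dvd_iff, X_pow_dvd_iff]
  intro l hl
  rw [← h l hl, ← taylor_coeff]; rfl

theorem small_sq (f r s : K[X]) (hns : ∀ (k : K) (S : K[X]), f ≠ C k * S ^ 2) (k : K) (hk : k ≠ 0)
    (h : r ^ 2 * f = C k * s ^ 2) : r = 0 ∧ s = 0 := by
  have hr : r = 0 := by
    by_contra hr
    have h1 : r ^ 2 ∣ s ^ 2 := by
      have : r ^ 2 ∣ C k * s ^ 2 := ⟨f, h.symm⟩
      rwa [IsUnit.dvd_mul_left] at this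
      exact isUnit_C.2 hk.isUnit
    rw [UniqueFactorizationMonoid.pow_dvd_pow_iff_dvd (by norm_num)] at h1
    obtain ⟨S, rfl⟩ := h1
    apply hns k S
    apply mul_left_cancel₀ (pow_ne_zero 2 hr)
    rw [h]; ring
  subst hr
  refine ⟨rfl, ?_⟩
  have : C k * s ^ 2 = 0 := by rw [← h]; ring
  simpa [hk] using this

theorem nonvanish [Fintype K] (f : K[X]) (hns : ∀ (k : K) (S : K[X]), f ≠ C k * S ^ 2)
    (h0 : f.coeff 0 ≠ 0) (q h a : ℕ) (hq : q = Fintype.card K) (hqh : q = 2 * h + 1)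
    (ha : 2 * a + f.natDegree ≤ q) (J : ℕ) : ∀ (r s : ℕ → K[X]), 
    (∀ j < J, (r j).degree < a) → (∀ j < J, (s j).degree < a) →
    ∑ j ∈ Finset.range J, (r j + s j * f ^ h) * X ^ (j * q) = 0 → ∀ j < J, r j = 0 ∧ s j = 0 := by
  induction J with
  | zero => intro r s _ _ _ j hj; omega
  | succ J ih =>
    intro r s hr hs hsum
    rw [Finset.sum_range_succ'] at hsum
    have e1 : ∑ j ∈ Finset.range J, (r (j+1) + s (j+1) * f ^ h) * X ^ ((j+1) * q) = 
      X ^ q * ∑ j ∈ Finset.range J, (r (j+1) + s (j+1) * f ^ h) * X ^ (j * q) := by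
      rw [Finset.mul_sum]
      apply Finset.sum_congr rfl
      intro j _
      ring
    rw [e1] at hsum
    simp only [zero_mul, pow_zero, mul_one] at hsum
    have d1 : X ^ q ∣ r 0 + s 0 * f ^ h := by
      have : r 0 + s 0 * f ^ h = X ^ q * (-∑ j ∈ Finset.range J, (r (j+1) + s (j+1) * f ^ h) * X ^ (j * q)) := by
        linear_combination hsum
      exact ⟨_, this⟩
    have d2 : X ^ q ∣ f ^ q - C (f.coeff 0) := by
      rw [hq, ← FiniteField.expand_card f]
      have : (X : K[X]) ∣ f - C (f.coeff 0) := by simp [X_dvd_iff]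
      have := map_dvd (expand K (Fintype.card K)) this
      rw [map_sub, expand_C, expand_X] at this
      exact this
    have d3 : X ^ q ∣ r 0 ^ 2 * f - C (f.coeff 0) * s 0 ^ 2 := by
      have : r 0 ^ 2 * f - C (f.coeff 0) * s 0 ^ 2 = 
        (r 0 + s 0 * f ^ h) * ((r 0 - s 0 * f ^ h) * f) + (f ^ q - C (f.coeff 0)) * s 0 ^ 2 := by
        rw [hqh, pow_succ, two_mul, pow_add]; ring
      rw [this]
      exact dvd_add (d1.mul_right _) (d2.mul_right _)
    have hz : r 0 ^ 2 * f - C (f.coeff 0) * s 0 ^ 2 = 0 := by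
      by_contra hne
      have hd := degree_le_of_dvd d3 hne
      rw [degree_X_pow] at hd
      have hr0 := hr 0 (by omega)
      have hs0 := hs 0 (by omega)
      have hq0 : 0 < q := by omega
      have ha0 : ∀ g : K[X], g.degree < a → g = 0 ∨ g.natDegree < a := by
        intro g hg
        by_cases hg0 : g = 0
        · exact Or.inl hg0
        · exact Or.inr ((natDegree_lt_iff_degree_lt hg0).2 hg)
      have b1 : (r 0 ^ 2 * f).degree < q := by
        rcases ha0 _ hr0 with h | h
        · rw [h]; simp
        · refine lt_of_le_of_lt degree_le_natDegree ?_
          norm_cast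
          refine lt_of_le_of_lt natDegree_mul_le ?_
          have := natDegree_pow_le (p := r 0) (n := 2)
          omega
      have b2 : (C (f.coeff 0) * s 0 ^ 2).degree < q := by
        rcases ha0 _ hs0 with h | h
        · rw [h]; simp
        · refine lt_of_le_of_lt degree_le_natDegree ?_
          norm_cast
          refine lt_of_le_of_lt (natDegree_C_mul_le _ _) ?_
          have := natDegree_pow_le (p := s 0) (n := 2)
          omega
      exact absurd (lt_of_le_of_lt (degree_sub_le _ _) (max_lt b1 b2)) (not_lt.2 hd)
    obtain ⟨z1, z2⟩ := small_sq f (r 0) (s 0) hns _ h0 (sub_eq_zero.1 hz)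
    rw [z1, z2] at hsum
    simp only [zero_mul, add_zero, mul_eq_zero, pow_eq_zero_iff', X_ne_zero, false_and, false_or] at hsum
    have := ih (fun j => r (j+1)) (fun j => s (j+1)) (fun j hj => hr _ (by omega)) (fun j hj => hs _ (by omega)) hsum
    intro j hj
    cases j with
    | zero => exact ⟨z1, z2⟩
    | succ j => exact this j (by omega)

theorem stepanov [Fintype K] (f : K[X]) (hns : ∀ (k : K) (S : K[X]), f ≠ C k * S ^ 2)
    (h0 : f.coeff 0 ≠ 0) (q h a m J M : ℕ) (hq : q = Fintype.card K) (hqh : q = 2 * h + 1)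
    (hm : f.natDegree = m) (ha : 2 * a + m ≤ q) (hMq : M ≤ q) (ha0 : 0 < a) (hJ : 0 < J)
    (hcount : ∑ l : Fin M, (a + l * m + J) < 2 * (J * a)) (ε : K) (S : Finset K)
    (hS : ∀ x ∈ S, (f.eval x) ^ h = ε) :
    M * S.card ≤ M * m + a + h * m + (J - 1) * q := by
  classical
  have hf : f ≠ 0 := by rintro rfl; simp at h0
  let V := (Fin J → degreeLT K a) × (Fin J → degreeLT K a)
  let P : (l : ℕ) → V →ₗ[K] K[X] := fun l =>
    { toFun := fun v => ∑ j : Fin J, X ^ (j : ℕ) * (D f M l (v.1 j : K[X]) + ε • D f (M + h) l (v.2 j : K[X]))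
      map_add' := by
        intro v w
        rw [← Finset.sum_add_distrib]
        apply Finset.sum_congr rfl
        intro j _
        have e1 : (((v + w).1 j : degreeLT K a) : K[X]) = (v.1 j : K[X]) + (w.1 j : K[X]) := rfl
        have e2 : (((v + w).2 j : degreeLT K a) : K[X]) = (v.2 j : K[X]) + (w.2 j : K[X]) := rfl
        rw [e1, e2, map_add, map_add, smul_add]
        ring
      map_smul' := by
        intro c v
        rw [RingHom.id_apply, Finset.smul_sum]
        apply Finset.sum_congr rfl
        intro j _
        have e1 : (((c • v).1 j : degreeLT K a) : K[X]) = c • (v.1 j : K[X]) := rfl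
        have e2 : (((c • v).2 j : degreeLT K a) : K[X]) = c • (v.2 j : K[X]) := rfl
        rw [e1, e2, map_smul, map_smul]
        simp only [smul_eq_C_mul]
        ring }
  let Φ : V →ₗ[K] ((Σ l : Fin M, Fin (a + l * m + J)) → K) :=
    LinearMap.pi (fun x => (lcoeff K (x.2 : ℕ)) ∘ₗ P (x.1 : ℕ))
  have hker : LinearMap.ker Φ ≠ ⊥ := by
    apply LinearMap.ker_ne_bot_of_finrank_lt
    rw [Module.finrank_fintype_fun_eq_card, Fintype.card_sigma]
    simp only [Fintype.card_fin]
    refine lt_of_lt_of_eq hcount ?_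
    have e : Module.finrank K (degreeLT K a) = a := by
      rw [(degreeLTEquiv K a).finrank_eq]; simp
    rw [Module.finrank_prod, Module.finrank_pi_fintype]
    simp [e]; ring
  obtain ⟨v, hv, hv0⟩ := (Submodule.ne_bot_iff _).1 hker
  have hdegr : ∀ g : degreeLT K a, (g : K[X]).natDegree < a := by
    intro g
    have := mem_degreeLT.1 g.2
    by_cases hg0 : (g : K[X]) = 0
    · rw [hg0]; simpa using ha0
    · exact ((natDegree_lt_iff_degree_lt hg0).2 this)
  have hP : ∀ l < M, P l v = 0 := by
    intro l hl
    ext i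
    rw [coeff_zero]
    by_cases hi : i < a + l * m + J
    · have := congrFun (LinearMap.mem_ker.1 hv) ⟨⟨l, hl⟩, ⟨i, hi⟩⟩
      simpa [Φ] using this
    · apply coeff_eq_zero_of_natDegree_lt
      refine lt_of_le_of_lt (b := a - 1 + l * m + (J - 1)) ?_ (by omega)
      simp only [P, LinearMap.coe_mk, AddHom.coe_mk]
      apply natDegree_sum_le_of_forall_le
      intro j _
      refine natDegree_mul_le.trans ?_
      rw [natDegree_X_pow]
      have h1 := D_deg f hf M l hl.le (v.1 j)
      have h2 := D_deg f hf (M+h) l (by omega) (v.2 j)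
      have h3 := natDegree_add_le (D f M l (v.1 j : K[X])) (ε • D f (M + h) l (v.2 j : K[X]))
      have h4 := natDegree_smul_le ε (D f (M + h) l (v.2 j : K[X]))
      have h5 := hdegr (v.1 j)
      have h6 := hdegr (v.2 j)
      have h7 := j.2
      rw [hm] at h1 h2
      omega
  -- the auxiliary polynomial
  let r : ℕ → K[X] := fun j => if hj : j < J then (v.1 ⟨j, hj⟩ : K[X]) else 0
  let s : ℕ → K[X] := fun j => if hj : j < J then (v.2 ⟨j, hj⟩ : K[X]) else 0
  let R0 := ∑ j ∈ Finset.range J, (r j + s j * f ^ h) * X ^ (j * q)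
  have hR0 : R0 ≠ 0 := by
    intro hz
    have := nonvanish f hns h0 q h a hq hqh (by omega) J r s ?_ ?_ hz
    · apply hv0
      ext j : 2
      · have := (this j j.2).1
        simp only [r, j.2, dif_pos] at this
        exact Subtype.ext this
      · have := (this j j.2).2
        simp only [s, j.2, dif_pos] at this
        exact Subtype.ext this
    · intro j hj
      simp only [r, hj, dif_pos]
      exact mem_degreeLT.1 (v.1 ⟨j, hj⟩).2
    · intro j hj
      simp only [s, hj, dif_pos]
      exact mem_degreeLT.1 (v.2 ⟨j, hj⟩).2
  have hR : f ^ M * R0 ≠ 0 := mul_ne_zero (pow_ne_zero _ hf) hR0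
  have hdeg : (f ^ M * R0).natDegree ≤ M * m + a + h * m + (J - 1) * q := by
    refine natDegree_mul_le.trans ?_
    have h1 : (f ^ M).natDegree ≤ M * m := by rw [natDegree_pow, hm]
    have h2 : R0.natDegree ≤ a + h * m + (J - 1) * q := by
      apply natDegree_sum_le_of_forall_le
      intro j hj
      rw [Finset.mem_range] at hj
      refine natDegree_mul_le.trans ?_
      rw [natDegree_X_pow]
      have h3 : (r j + s j * f ^ h).natDegree ≤ a + h * m := by
        refine (natDegree_add_le _ _).trans (max_le ?_ ?_)
        · simp only [r, hj, dif_pos]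
          have := hdegr (v.1 ⟨j, hj⟩)
          omega
        · refine natDegree_mul_le.trans ?_
          rw [natDegree_pow, hm]
          simp only [s, hj, dif_pos]
          have := hdegr (v.2 ⟨j, hj⟩)
          omega
      have : j * q ≤ (J - 1) * q := Nat.mul_le_mul_right _ (by omega)
      omega
    omega
  have hdvd : ∀ x ∈ S, (X - C x) ^ M ∣ f ^ M * R0 := by
    intro x hx
    let H := ∑ j : Fin J, C (x ^ (j : ℕ)) * (f ^ M * (v.1 j : K[X]) + f ^ (M + h) * (v.2 j : K[X]))
    have hH : (X - C x) ^ M ∣ H := by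
      apply dvd_of_hasse
      intro l hl
      have : hasseDeriv l H = f ^ (M - l) * ∑ j : Fin J, C (x ^ (j : ℕ)) * (D f M l (v.1 j : K[X]) + f ^ h * D f (M + h) l (v.2 j : K[X])) := by
        simp only [H]
        rw [map_sum, Finset.mul_sum]
        apply Finset.sum_congr rfl
        intro j _
        rw [← smul_eq_C_mul, map_smul, map_add, D_spec f hf M l hl.le, D_spec f hf (M + h) l (by omega), smul_eq_C_mul]
        have : M + h - l = (M - l) + h := by omega
        rw [this, pow_add]; ring
      rw [this, eval_mul]
      have h2 := congrArg (eval x) (hP l hl)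
      have h3 : eval x (∑ j : Fin J, C (x ^ (j : ℕ)) * (D f M l (v.1 j : K[X]) + f ^ h * D f (M + h) l (v.2 j : K[X]))) = eval x (P l v) := by
        simp only [P, LinearMap.coe_mk, AddHom.coe_mk, eval_finsetSum, eval_mul, eval_add, eval_pow, eval_smul, eval_X, eval_C, smul_eq_mul, hS x hx]
      rw [h3, h2]; simp
    have hsub : (X - C x) ^ M ∣ f ^ M * R0 - H := by
      have e1 : f ^ M * R0 - H = ∑ j : Fin J, (f ^ M * (v.1 j : K[X]) + f ^ (M + h) * (v.2 j : K[X])) * (X ^ ((j : ℕ) * q) - C (x ^ (j : ℕ))) := by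
        simp only [R0, H]
        rw [Finset.sum_range, Finset.mul_sum, ← Finset.sum_sub_distrib]
        apply Finset.sum_congr rfl
        intro j _
        simp only [r, s, j.2, dif_pos]
        rw [pow_add]; ring
      rw [e1]
      apply Finset.dvd_sum
      intro j _
      apply Dvd.dvd.mul_left
      have e2 : (X ^ ((j : ℕ) * q) - C (x ^ (j : ℕ)) : K[X]) = (X ^ (j : ℕ) - C (x ^ (j : ℕ))) ^ q := by
        rw [hq, ← FiniteField.expand_card]
        simp [pow_mul']
      rw [e2, C_pow]
      exact (pow_dvd_pow _ hMq).trans (pow_dvd_pow_of_dvd (sub_dvd_pow_sub_pow _ _ _) q)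
    have := dvd_add hsub hH
    simpa using this
  have hle : M • S.val ≤ (f ^ M * R0).roots := by
    rw [Multiset.le_iff_count]
    intro x
    rw [Multiset.count_nsmul, count_roots]
    by_cases hx : x ∈ S
    · rw [Multiset.count_eq_one_of_mem S.nodup hx]
      simpa using (le_rootMultiplicity_iff hR).2 (hdvd x hx)
    · rw [Multiset.count_eq_zero_of_notMem hx]; simp
  have := Multiset.card_le_card hle
  rw [Multiset.card_nsmul] at this
  refine le_trans ?_ (this.trans ((card_roots' _).trans hdeg))
  simp

/-- polynomial from a list of coefficients (lowest first) -/
noncomputable def ofL : List K → K[X]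
  | [] => 0
  | a :: l => C a + X * ofL l

theorem ofL_coeff (l : List K) : ∀ n, (ofL l).coeff n = l.getD n 0 := by
  induction l with
  | nil => intro n; simp [ofL]
  | cons a l ih =>
    intro n
    cases n with
    | zero => simp [ofL]
    | succ n => simp [ofL, ih, coeff_C]

theorem ofL_natDegree (l : List K) : (ofL l).natDegree ≤ l.length - 1 := by
  rw [natDegree_le_iff_coeff_eq_zero]
  intro n hn
  rw [ofL_coeff, List.getD_eq_default]
  omega

theorem ofL_natDegree_eq (l : List K) (n : ℕ) (h1 : l.length = n + 1) (h2 : l.getD n 0 ≠ 0) :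
    (ofL l).natDegree = n := by
  apply le_antisymm
  · have := ofL_natDegree l
    omega
  · apply le_natDegree_of_ne_zero
    rwa [ofL_coeff]

noncomputable def dP (K : Type*) [Field K] : K[X] := ofL [-4, 0, 16, 0, -8, 0, 1]
noncomputable def nP (K : Type*) [Field K] : K[X] := ofL [1, 8, 24, 24, -10, -26, 16, 12, -7, -2, 1]
noncomputable def eP (K : Type*) [Field K] : K[X] :=
  ofL [-4, -32, -80, 32, 416, 424, -415, -648, 388, 432, -254, -154, 88, 28, -15, -2, 1]

theorem dP_eval (t : K) : (dP K).eval t = (t^3 - 4*t)^2 - 4 := by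
  simp [dP, ofL]; ring
theorem nP_eval (t : K) : (nP K).eval t = t^10 - 2*t^9 - 7*t^8 + 12*t^7 + 16*t^6 - 26*t^5 - 10*t^4 + 24*t^3 + 24*t^2+8*t+1 := by
  simp [nP, ofL]; ring
theorem eP_eval (t : K) : (eP K).eval t = (dP K).eval t * (nP K).eval t := by
  rw [dP_eval, nP_eval]
  simp [eP, ofL]; ring

theorem normalize_sq (f : K[X]) (h0 : f.coeff 0 ≠ 0) (k : K) (S : K[X]) (h : f = C k * S ^ 2)
    (n : ℕ) (hn : f.natDegree ≤ 2 * n + 1) :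
    ∃ s : ℕ → K, s 0 = 1 ∧ (∀ i, n < i → s i = 0) ∧
      ∀ i, f.coeff i = f.coeff 0 * ∑ j ∈ Finset.range (i + 1), s j * s (i - j) := by
  have hc : f.coeff 0 = k * S.coeff 0 ^ 2 := by
    rw [h, coeff_C_mul, pow_two, mul_coeff_zero]; ring
  have hk : k ≠ 0 := by rintro rfl; simp [hc] at h0
  have hs : S.coeff 0 ≠ 0 := by intro h'; simp [hc, h'] at h0
  refine ⟨fun i => S.coeff i / S.coeff 0, div_self hs, ?_, ?_⟩
  · intro i hi
    have : S.natDegree ≤ n := by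
      have := congrArg natDegree h
      rw [natDegree_C_mul hk, natDegree_pow] at this
      omega
    simp [coeff_eq_zero_of_natDegree_lt (lt_of_le_of_lt this hi)]
  · intro i
    rw [hc]
    conv_lhs => rw [h, coeff_C_mul, pow_two, coeff_mul, Finset.Nat.sum_antidiagonal_eq_sum_range_succ_mk]
    rw [Finset.mul_sum, Finset.mul_sum]
    apply Finset.sum_congr rfl
    intro j _
    field_simp

theorem dP_nsq (h2 : (2 : K) ≠ 0) (k : K) (S : K[X]) : dP K ≠ C k * S ^ 2 := by
  intro h
  have h4 : (-4 : K) ≠ 0 := by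
    intro h; exact pow_ne_zero 2 h2 (by linear_combination -h)
  obtain ⟨s, s0, sz, hs⟩ := normalize_sq (dP K) (by simpa [dP, ofL_coeff] using h4) k S h 3 ((ofL_natDegree _).trans (by simp))
  have e1 := hs 1
  have e2 := hs 2
  have e3 := hs 3
  have e4 := hs 4
  simp only [dP, ofL_coeff, List.getD_cons_zero, List.getD_cons_succ, Finset.sum_range_succ, Finset.sum_range_zero, Nat.sub_zero, Nat.reduceSub, Nat.sub_self, Nat.reduceAdd, s0] at e1 e2 e3 e4
  have z4 := sz 4 (by norm_num)
  have c8 : ∀ x y : K, (-4) * (2 * x) = (-4) * (2 * y) → x = y := fun x y h =>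
    mul_left_cancel₀ h2 (mul_left_cancel₀ h4 h)
  have x1 : s 1 = 0 := by apply c8; linear_combination -e1
  rw [x1] at e2 e3 e4
  have x2 : s 2 = -2 := by apply c8; linear_combination -e2
  rw [x2, z4] at e4
  have : (2 : K) ^ 3 = 0 := by linear_combination e4
  exact pow_ne_zero 3 h2 this

theorem nP_nsq (h2 : (2 : K) ≠ 0) (k : K) (S : K[X]) : nP K ≠ C k * S ^ 2 := by
  intro h
  obtain ⟨s, s0, sz, hs⟩ := normalize_sq (nP K) (by simp [nP, ofL_coeff]) k S h 5 ((ofL_natDegree _).trans (by simp))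
  have z6 := sz 6 (by norm_num)
  have z7 := sz 7 (by norm_num)
  have z8 := sz 8 (by norm_num)
  have c2 : ∀ x y : K, 2 * x = 2 * y → x = y := fun x y h => mul_left_cancel₀ h2 h
  have ex := fun i => hs i
  simp only [nP, ofL_coeff] at ex
  have x1 : s 1 = 4 := by
    have e := ex 1
    simp only [List.getD_cons_zero, List.getD_cons_succ, Finset.sum_range_succ, Finset.sum_range_zero, Nat.sub_zero, Nat.reduceSub, Nat.sub_self, Nat.reduceAdd, s0] at e
    apply c2; linear_combination -e
  have x2 : s 2 = 4 := by
    have e := ex 2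
    simp only [List.getD_cons_zero, List.getD_cons_succ, Finset.sum_range_succ, Finset.sum_range_zero, Nat.sub_zero, Nat.reduceSub, Nat.sub_self, Nat.reduceAdd, s0, x1] at e
    apply c2; linear_combination -e
  have x3 : s 3 = -4 := by
    have e := ex 3
    simp only [List.getD_cons_zero, List.getD_cons_succ, Finset.sum_range_succ, Finset.sum_range_zero, Nat.sub_zero, Nat.reduceSub, Nat.sub_self, Nat.reduceAdd, s0, x1, x2] at e
    apply c2; linear_combination -e
  have x4 : s 4 = 3 := by
    have e := ex 4
    simp only [List.getD_cons_zero, List.getD_cons_succ, Finset.sum_range_succ, Finset.sum_range_zero, Nat.sub_zero, Nat.reduceSub, Nat.sub_self, Nat.reduceAdd, s0, x1, x2, x3] at e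
    apply c2; linear_combination -e
  have x5 : s 5 = -9 := by
    have e := ex 5
    simp only [List.getD_cons_zero, List.getD_cons_succ, Finset.sum_range_succ, Finset.sum_range_zero, Nat.sub_zero, Nat.reduceSub, Nat.sub_self, Nat.reduceAdd, s0, x1, x2, x3, x4] at e
    apply c2; linear_combination -e
  have e6 := ex 6
  have e8 := ex 8
  simp only [List.getD_cons_zero, List.getD_cons_succ, Finset.sum_range_succ, Finset.sum_range_zero, Nat.sub_zero, Nat.reduceSub, Nat.sub_self, Nat.reduceAdd, s0, x1, x2, x3, x4, x5, z6, z7, z8] at e6 e8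
  have : (2 : K)^3 = 0 := by linear_combination 2 * e6 + e8
  exact pow_ne_zero 3 h2 this

theorem eP_nsq (h2 : (2 : K) ≠ 0) (k : K) (S : K[X]) : eP K ≠ C k * S ^ 2 := by
  intro h
  have h4 : (-4 : K) ≠ 0 := by
    intro h; exact pow_ne_zero 2 h2 (by linear_combination -h)
  have h8 : (8 : K) ≠ 0 := by
    intro h; exact pow_ne_zero 3 h2 (by linear_combination h)
  obtain ⟨s, s0, sz, hs⟩ := normalize_sq (eP K) (by simpa [eP, ofL_coeff] using h4) k S h 8 ((ofL_natDegree _).trans (by simp))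
  have z9 := sz 9 (by norm_num)
  have z10 := sz 10 (by norm_num)
  have c8 : ∀ x y : K, (-8) * x = (-8) * y → x = y := fun x y h => mul_left_cancel₀ (neg_ne_zero.2 h8) h
  have ex := fun i => hs i
  simp only [eP, ofL_coeff] at ex
  have x1 : s 1 = 4 := by
    have e := ex 1
    simp only [List.getD_cons_zero, List.getD_cons_succ, Finset.sum_range_succ, Finset.sum_range_zero, Nat.sub_zero, Nat.reduceSub, Nat.sub_self, Nat.reduceAdd, s0] at e
    apply c8; linear_combination -e
  have x2 : s 2 = 2 := by
    have e := ex 2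
    simp only [List.getD_cons_zero, List.getD_cons_succ, Finset.sum_range_succ, Finset.sum_range_zero, Nat.sub_zero, Nat.reduceSub, Nat.sub_self, Nat.reduceAdd, s0, x1] at e
    apply c8; linear_combination -e
  have x3 : s 3 = -12 := by
    have e := ex 3
    simp only [List.getD_cons_zero, List.getD_cons_succ, Finset.sum_range_succ, Finset.sum_range_zero, Nat.sub_zero, Nat.reduceSub, Nat.sub_self, Nat.reduceAdd, s0, x1, x2] at e
    apply c8; linear_combination -e
  have x4 : s 4 = -6 := by
    have e := ex 4
    simp only [List.getD_cons_zero, List.getD_cons_succ, Finset.sum_range_succ, Finset.sum_range_zero, Nat.sub_zero, Nat.reduceSub, Nat.sub_self, Nat.reduceAdd, s0, x1, x2, x3] at e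
    apply c8; linear_combination -e
  have x5 : s 5 = -5 := by
    have e := ex 5
    simp only [List.getD_cons_zero, List.getD_cons_succ, Finset.sum_range_succ, Finset.sum_range_zero, Nat.sub_zero, Nat.reduceSub, Nat.sub_self, Nat.reduceAdd, s0, x1, x2, x3, x4] at e
    apply c8; linear_combination -e
  have x6 : 8 * s 6 = 95 := by
    have e := ex 6
    simp only [List.getD_cons_zero, List.getD_cons_succ, Finset.sum_range_succ, Finset.sum_range_zero, Nat.sub_zero, Nat.reduceSub, Nat.sub_self, Nat.reduceAdd, s0, x1, x2, x3, x4, x5] at e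
    linear_combination e
  have x7 : 8 * s 7 = -57 * 4 := by
    have e := ex 7
    simp only [List.getD_cons_zero, List.getD_cons_succ, Finset.sum_range_succ, Finset.sum_range_zero, Nat.sub_zero, Nat.reduceSub, Nat.sub_self, Nat.reduceAdd, s0, x1, x2, x3, x4, x5] at e
    linear_combination e - 4 * x6
  have x8 : 8 * s 8 = -145 * 2 := by
    have e := ex 8
    simp only [List.getD_cons_zero, List.getD_cons_succ, Finset.sum_range_succ, Finset.sum_range_zero, Nat.sub_zero, Nat.reduceSub, Nat.sub_self, Nat.reduceAdd, s0, x1, x2, x3, x4, x5] at e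
    linear_combination e - 4 * x7 - 2 * x6
  have e9 := ex 9
  have e10 := ex 10
  simp only [List.getD_cons_zero, List.getD_cons_succ, Finset.sum_range_succ, Finset.sum_range_zero, Nat.sub_zero, Nat.reduceSub, Nat.sub_self, Nat.reduceAdd, s0, x1, x2, x3, x4, x5, z9, z10] at e9 e10
  have y9 : (521 : K) * 4 = 0 := by linear_combination -e9 + 4 * x8 + 2 * x7 - 12 * x6
  have y10 : (358 : K) * 4 = 0 := by linear_combination e10 - 2 * x8 + 12 * x7 + 6 * x6
  have : (2 : K) ^ 2 = 0 := by linear_combination 123 * y9 - 179 * y10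
  exact pow_ne_zero 2 h2 this

def Sol (K : Type*) [Field K] : Prop := ∃ t b c : K, t * b * c = t^2 - 2*t - 1 ∧
    t^2 * (b - c + t - 2)^2 + 1 = t^2 * (b - c + t - 2) * (t^2 - 4)

theorem sol_of_delta (h2 : (2 : K) ≠ 0) (t u v : K) (ht : t ≠ 0) (hu : u ^ 2 + 1 = u * (t^3 - 4*t))
    (hv : (u - t^2 + 2*t)^2 + 4 * t * (t^2 - 2*t - 1) = v ^ 2) : Sol K := by
  refine ⟨t, (v + (u - t^2 + 2*t)) / (2 * t), (v - (u - t^2 + 2*t)) / (2 * t), ?_, ?_⟩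
  · field_simp
    linear_combination -hv
  · have e : (v + (u - t^2 + 2*t)) / (2 * t) - (v - (u - t^2 + 2*t)) / (2 * t) + t - 2 = u / t := by
      field_simp; ring
    rw [e]
    field_simp
    linear_combination hu

theorem sol_of_t [Fintype K] (h2 : (2 : K) ≠ 0) (h : ℕ) (hq : Fintype.card K = 2 * h + 1) (t : K)
    (ht : t ≠ 0) (hd : ((dP K).eval t) ^ h = 1) (hn : ((nP K).eval t) ^ h = -1) : Sol K := by
  have hF : ringChar K ≠ 2 := by
    intro h'
    apply h2
    have := ringChar.Nat.cast_ringChar (R := K)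
    rw [h'] at this
    exact_mod_cast this
  have hh : Fintype.card K / 2 = h := by omega
  have h0 : h ≠ 0 := by
    rintro rfl
    have : 1 < Fintype.card K := Fintype.one_lt_card
    omega
  have sqr : ∀ x : K, x ^ h = 1 → ∃ y, x = y ^ 2 := by
    intro x hx
    have hx0 : x ≠ 0 := by rintro rfl; simp [h0] at hx
    have := (FiniteField.isSquare_iff hF hx0).2 (by rw [hh]; exact hx)
    obtain ⟨y, hy⟩ := this
    exact ⟨y, by rw [hy, pow_two]⟩
  have dich : ∀ x : K, x ≠ 0 → x ^ h = 1 ∨ x ^ h = -1 := by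
    intro x hx
    have := FiniteField.pow_dichotomy hF hx
    rwa [hh] at this
  obtain ⟨w, hw⟩ := sqr _ hd
  rw [dP_eval] at hw
  set u := (t^3 - 4*t + w) / 2 with hu
  set u' := (t^3 - 4*t - w) / 2 with hu'
  have us : u + u' = t^3 - 4*t := by rw [hu, hu']; field_simp; ring
  have up : u * u' = 1 := by
    rw [hu, hu']; field_simp; linear_combination hw
  have hprod : ((u - t^2 + 2*t)^2 + 4 * t * (t^2 - 2*t - 1)) * ((u' - t^2 + 2*t)^2 + 4 * t * (t^2 - 2*t - 1)) =
     (nP K).eval t := by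
    rw [nP_eval]
    have : u' = t^3 - 4*t - u := by linear_combination us
    rw [this] at up ⊢
    grind
  have hprod' := congrArg (fun x => x ^ h) hprod
  simp only [mul_pow, hn] at hprod'
  have hne : (-1 : K) ≠ 0 := by simp
  have e1 : u ^ 2 + 1 = u * (t^3 - 4*t) := by rw [← us, ← up]; ring
  have e2 : u' ^ 2 + 1 = u' * (t^3 - 4*t) := by rw [← us, ← up]; ring
  set δ := (u - t^2 + 2*t)^2 + 4 * t * (t^2 - 2*t - 1) with hδ
  set δ' := (u' - t^2 + 2*t)^2 + 4 * t * (t^2 - 2*t - 1) with hδ'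
  have hd0 : δ ≠ 0 := by intro h'; simp [h', h0] at hprod'
  have hd0' : δ' ≠ 0 := by intro h'; simp [h', h0] at hprod'
  rcases dich δ hd0 with hx | hx
  · obtain ⟨v, hv⟩ := sqr _ hx
    exact sol_of_delta h2 t u v ht e1 hv
  · rw [hx] at hprod'
    have : δ' ^ h = 1 := by linear_combination -hprod'
    obtain ⟨v, hv⟩ := sqr _ this
    exact sol_of_delta h2 t u' v ht e2 hv

theorem odd_big [Fintype K] (h2 : (2 : K) ≠ 0) (h : ℕ) (hq : Fintype.card K = 2 * h + 1)
    (hbig : 5000 ≤ Fintype.card K) : Sol K := by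
  classical
  by_contra hno
  have hF : ringChar K ≠ 2 := by
    intro h'
    apply h2
    have := ringChar.Nat.cast_ringChar (R := K)
    rw [h'] at this
    exact_mod_cast this
  have hh : Fintype.card K / 2 = h := by omega
  have h4 : (-4 : K) ≠ 0 := by
    intro h; exact pow_ne_zero 2 h2 (by linear_combination -h)
  have dich : ∀ x : K, x ≠ 0 → x ^ h = 1 ∨ x ^ h = -1 := by
    intro x hx
    have := FiniteField.pow_dichotomy hF hx
    rwa [hh] at this
  have hnd : (dP K).natDegree = 6 := ofL_natDegree_eq _ _ (by simp) (by simp)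
  have hnn : (nP K).natDegree = 10 := ofL_natDegree_eq _ _ (by simp) (by simp)
  have hne : (eP K).natDegree = 16 := ofL_natDegree_eq _ _ (by simp) (by simp)
  let Z := ((X * eP K : K[X]).roots).toFinset
  let A1 := Finset.univ.filter (fun x : K => ((dP K).eval x) ^ h = -1)
  let A2 := Finset.univ.filter (fun x : K => ((nP K).eval x) ^ h = 1)
  let A3 := Finset.univ.filter (fun x : K => ((eP K).eval x) ^ h = 1)
  have b1 := stepanov (dP K) (dP_nsq h2) (by simpa [dP, ofL_coeff] using h4) _ h 2431 6 32 59 rfl hq hnd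
    (by omega) (by omega) (by norm_num) (by norm_num) (by decide) (-1) A1 (by intro x hx; exact (Finset.mem_filter.1 hx).2)
  have b2 := stepanov (nP K) (nP_nsq h2) (by simp [nP, ofL_coeff]) _ h 2468 10 34 60 rfl hq hnn
    (by omega) (by omega) (by norm_num) (by norm_num) (by decide) 1 A2 (by intro x hx; exact (Finset.mem_filter.1 hx).2)
  have b3 := stepanov (eP K) (eP_nsq h2) (by simpa [eP, ofL_coeff] using h4) _ h 2483 16 39 64 rfl hq hne
    (by omega) (by omega) (by norm_num) (by norm_num) (by decide) 1 A3 (by intro x hx; exact (Finset.mem_filter.1 hx).2)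
  have hZne : (X * eP K : K[X]) ≠ 0 := by
    apply mul_ne_zero X_ne_zero
    intro h'; rw [h'] at hne; simp at hne
  have hZ : Z.card ≤ 17 := by
    refine (Multiset.toFinset_card_le _).trans ((card_roots' _).trans ?_)
    refine natDegree_mul_le.trans ?_
    rw [hne, natDegree_X]
  have hcov : ∀ x : K, 2 ≤ 2 * (if x ∈ Z then 1 else 0) + ((if x ∈ A1 then 1 else 0) + (if x ∈ A2 then 1 else 0) + (if x ∈ A3 then 1 else 0)) := by
    intro x
    by_cases hx : x ∈ Z
    · simp [hx]
    have hx' : x ≠ 0 ∧ (eP K).eval x ≠ 0 := by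
      simp only [Z, Multiset.mem_toFinset, mem_roots hZne, IsRoot.def, eval_mul, eval_X, mul_eq_zero] at hx
      exact not_or.1 hx
    have he := eP_eval x
    have hd0 : (dP K).eval x ≠ 0 := by intro h'; apply hx'.2; rw [he, h', zero_mul]
    have hn0 : (nP K).eval x ≠ 0 := by intro h'; apply hx'.2; rw [he, h', mul_zero]
    simp only [A1, A2, A3, Finset.mem_filter, Finset.mem_univ, true_and, he, mul_pow]
    rcases dich _ hd0 with h1 | h1 <;> rcases dich _ hn0 with h3 | h3
    · simp only [h1, h3, one_mul, mul_one, neg_mul_neg, if_true, reduceIte]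
      split_ifs <;> omega
    · exact absurd (sol_of_t h2 h hq x hx'.1 h1 h3) hno
    · simp only [h1, h3, one_mul, mul_one, neg_mul_neg, if_true, reduceIte]
      split_ifs <;> omega
    · simp only [h1, h3, one_mul, mul_one, neg_mul_neg, if_true, reduceIte]
      split_ifs <;> omega
  have hsum := Finset.sum_le_sum (s := Finset.univ) (fun (x : K) _ => hcov x)
  simp only [Finset.sum_add_distrib, ← Finset.mul_sum, Finset.sum_ite_mem, Finset.univ_inter, Finset.sum_const, smul_eq_mul, mul_one, Finset.card_univ] at hsum
  omega

/-- homogenized partial trace -/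
def hL {A : Type*} [CommRing A] (n D : A) (c : ℕ) : A :=
  ∑ i ∈ Finset.range c, n ^ (2 ^ i) * D ^ (2 ^ (c - 1) - 2 ^ i)

/-- partial trace -/
def pT (c : ℕ) (x : K) : K := ∑ i ∈ Finset.range c, x ^ (2 ^ i)

theorem hL_sq {A : Type*} [CommRing A] [CharP A 2] (n D : A) (c : ℕ) :
    hL n D (c + 1) ^ 2 + n * D ^ (2 ^ (c + 1) - 1) = D ^ (2 ^ c) * hL n D (c + 1) + n ^ (2 ^ (c + 1)) := by
  have e1 : hL n D (c + 1) ^ 2 = ∑ i ∈ Finset.range (c + 1), n ^ (2 ^ (i + 1)) * D ^ (2 ^ (c + 1) - 2 ^ (i + 1)) := by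
    rw [hL, sum_pow_char]
    apply Finset.sum_congr rfl
    intro i _
    rw [mul_pow, ← pow_mul, ← pow_mul, ← pow_succ, Nat.sub_mul, ← pow_succ, ← pow_succ, Nat.add_sub_cancel]
  have e2 : D ^ (2 ^ c) * hL n D (c + 1) = ∑ i ∈ Finset.range (c + 1), n ^ (2 ^ i) * D ^ (2 ^ (c + 1) - 2 ^ i) := by
    rw [hL, Finset.mul_sum]
    apply Finset.sum_congr rfl
    intro i hi
    rw [Finset.mem_range] at hi
    have : 2 ^ i ≤ 2 ^ c := Nat.pow_le_pow_right (by norm_num) (by omega)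
    have e : 2 ^ (c + 1) - 2 ^ i = 2 ^ c + (2 ^ c - 2 ^ i) := by rw [pow_succ]; omega
    rw [e, pow_add, Nat.add_sub_cancel]; ring
  rw [e1, e2]
  have := Finset.sum_range_succ' (fun i => n ^ (2 ^ i) * D ^ (2 ^ (c + 1) - 2 ^ i)) (c + 1)
  have h2 := Finset.sum_range_succ (fun i => n ^ (2 ^ i) * D ^ (2 ^ (c + 1) - 2 ^ i)) (c + 1)
  rw [h2] at this
  simp only [pow_zero, pow_one, Nat.sub_self, mul_one] at this
  exact this.symm

theorem hL_eq (n D : K) (hD : D ≠ 0) (c : ℕ) : hL n D c = D ^ (2 ^ (c - 1)) * pT c (n / D) := by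
  rw [hL, pT, Finset.mul_sum]
  apply Finset.sum_congr rfl
  intro i hi
  rw [Finset.mem_range] at hi
  have : 2 ^ i ≤ 2 ^ (c - 1) := Nat.pow_le_pow_right (by norm_num) (by omega)
  rw [div_pow, pow_sub₀ _ hD this]
  field_simp

theorem hL_eval (n D : K[X]) (c : ℕ) (x : K) : (hL n D c).eval x = hL (n.eval x) (D.eval x) c := by
  simp [hL, eval_finsetSum]

theorem hL_deg (n D : K[X]) (m c : ℕ) (hn : n.natDegree ≤ m) (hD : D.natDegree ≤ m) :
    (hL n D c).natDegree ≤ m * 2 ^ (c - 1) := by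
  apply natDegree_sum_le_of_forall_le
  intro i hi
  rw [Finset.mem_range] at hi
  have h1 : 2 ^ i ≤ 2 ^ (c - 1) := Nat.pow_le_pow_right (by norm_num) (by omega)
  refine natDegree_mul_le.trans ?_
  have h2 : (n ^ (2 ^ i)).natDegree ≤ 2 ^ i * m := natDegree_pow_le.trans (Nat.mul_le_mul_left _ hn)
  have h3 : (D ^ (2 ^ (c - 1) - 2 ^ i)).natDegree ≤ (2 ^ (c - 1) - 2 ^ i) * m :=
    natDegree_pow_le.trans (Nat.mul_le_mul_left _ hD)
  calc _ ≤ 2 ^ i * m + (2 ^ (c - 1) - 2 ^ i) * m := add_le_add h2 h3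
    _ = m * 2 ^ (c - 1) := by rw [← add_mul, Nat.add_sub_cancel' h1, mul_comm]

theorem pT_split (c k : ℕ) (x : K) : pT (c + k) x = pT c x + pT k (x ^ (2 ^ c)) := by
  rw [pT, Finset.sum_range_add, pT, pT]
  congr 1
  apply Finset.sum_congr rfl
  intro i _
  rw [← pow_mul, pow_add]

theorem as_step [CharP K 2] (n D : K[X]) (m a c : ℕ) (hn : n.natDegree ≤ m) (hD : D.natDegree ≤ m)
    (hn0 : X ∣ n) (hD0 : D.coeff 0 ≠ 0)
    (hind : ∀ r s : K[X], D * r ^ 2 + D * r * s + n * s ^ 2 = 0 → r = 0 ∧ s = 0)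
    (ha : 2 * a + m ≤ 2 ^ (c + 1)) (r s : K[X]) (hr : r.degree < a) (hs : s.degree < a)
    (hdvd : X ^ (2 ^ (c + 1)) ∣ D ^ (2 ^ c) * r + hL n D (c + 1) * s) : r = 0 ∧ s = 0 := by
  apply hind
  by_contra hne
  have hcop : IsCoprime (X ^ (2 ^ (c + 1)) : K[X]) (D ^ (2 ^ (c + 1))) := by
    apply IsCoprime.pow
    rw [Irreducible.coprime_iff_not_dvd irreducible_X, X_dvd_iff]
    exact hD0
  have hQ : D ^ (2 ^ (c + 1)) = D ^ (2 ^ c) * D ^ (2 ^ c) := by rw [← pow_add, pow_succ, mul_two]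
  have hQ1 : D ^ (2 ^ (c + 1)) = D ^ (2 ^ (c + 1) - 1) * D := by
    rw [← pow_succ, Nat.sub_add_cancel Nat.one_le_two_pow]
  have two : (2 : K[X]) = 0 := CharTwo.two_eq_zero
  have d1 : X ^ (2 ^ (c + 1)) ∣ D ^ (2 ^ (c + 1)) * (D * r ^ 2 + D * r * s + n * s ^ 2) := by
    have hsq := hL_sq n D c
    have : D ^ (2 ^ (c + 1)) * (D * r ^ 2 + D * r * s + n * s ^ 2) =
        (D ^ (2 ^ c) * r + hL n D (c + 1) * s) * (D * (D ^ (2 ^ c) * r + hL n D (c + 1) * s) + D * (D ^ (2 ^ c)) * s)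
         + n ^ (2 ^ (c + 1)) * (D * s ^ 2) := by
      generalize hL n D (c + 1) = w at *
      generalize D ^ (2 ^ c) = e at *
      generalize D ^ (2 ^ (c + 1) - 1) = f at *
      generalize n ^ (2 ^ (c + 1)) = g at *
      rw [hQ] at hQ1 ⊢
      linear_combination n * s ^ 2 * hQ1 + (- D * s ^ 2) * hsq + (D*f*n*s^2 - D*e*r*s*w - D*e*s^2*w - D*s^2*g)*two
    rw [this]
    exact dvd_add (hdvd.mul_right _) ((pow_dvd_pow_of_dvd hn0 _).mul_right _)
  have d2 := hcop.dvd_of_dvd_mul_left d1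
  have hd := natDegree_le_of_dvd d2 hne
  rw [natDegree_X_pow] at hd
  have ha0 : ∀ g : K[X], g.degree < a → g = 0 ∨ g.natDegree < a := by
    intro g hg
    by_cases hg0 : g = 0
    · exact Or.inl hg0
    · exact Or.inr ((natDegree_lt_iff_degree_lt hg0).2 hg)
  have : (D * r ^ 2 + D * r * s + n * s ^ 2).natDegree + 1 ≤ 2 * a + m := by
    have h2 := natDegree_pow_le (p := r) (n := 2)
    have h3 := natDegree_pow_le (p := s) (n := 2)
    have b1 := natDegree_mul_le (p := D) (q := r ^ 2)
    have b2 := natDegree_mul_le (p := D * r) (q := s)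
    have b2' := natDegree_mul_le (p := D) (q := r)
    have b3 := natDegree_mul_le (p := n) (q := s ^ 2)
    have b4 := natDegree_add_le (D * r ^ 2 + D * r * s) (n * s ^ 2)
    have b5 := natDegree_add_le (D * r ^ 2) (D * r * s)
    rcases ha0 _ hr with h | h <;> rcases ha0 _ hs with h' | h'
    · exfalso; apply hne; rw [h, h']; ring
    · have : r.natDegree = 0 := by rw [h, natDegree_zero]
      omega
    · have : s.natDegree = 0 := by rw [h', natDegree_zero]
      omega
    · omega
  omega

theorem as_nonvanish [CharP K 2] (n D : K[X]) (m a c : ℕ) (hn : n.natDegree ≤ m) (hD : D.natDegree ≤ m)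
    (hn0 : X ∣ n) (hD0 : D.coeff 0 ≠ 0)
    (hind : ∀ r s : K[X], D * r ^ 2 + D * r * s + n * s ^ 2 = 0 → r = 0 ∧ s = 0)
    (ha : 2 * a + m ≤ 2 ^ (c + 1)) (J : ℕ) : ∀ (r s : ℕ → K[X]),
    (∀ j < J, (r j).degree < a) → (∀ j < J, (s j).degree < a) →
    ∑ j ∈ Finset.range J, (D ^ (2 ^ c) * r j + hL n D (c + 1) * s j) * X ^ (j * 2 ^ (c + 1)) = 0 →
      ∀ j < J, r j = 0 ∧ s j = 0 := by
  induction J with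
  | zero => intro r s _ _ _ j hj; omega
  | succ J ih =>
    intro r s hr hs hsum
    rw [Finset.sum_range_succ'] at hsum
    have e1 : ∑ j ∈ Finset.range J, (D ^ (2 ^ c) * r (j+1) + hL n D (c + 1) * s (j+1)) * X ^ ((j+1) * 2 ^ (c + 1)) =
      X ^ (2 ^ (c + 1)) * ∑ j ∈ Finset.range J, (D ^ (2 ^ c) * r (j+1) + hL n D (c + 1) * s (j+1)) * X ^ (j * 2 ^ (c + 1)) := by
      rw [Finset.mul_sum]
      apply Finset.sum_congr rfl
      intro j _
      rw [Nat.add_mul, Nat.one_mul, pow_add]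
      ring
    rw [e1] at hsum
    simp only [zero_mul, pow_zero, mul_one] at hsum
    have d1 : X ^ (2 ^ (c + 1)) ∣ D ^ (2 ^ c) * r 0 + hL n D (c + 1) * s 0 := by
      refine ⟨-∑ j ∈ Finset.range J, (D ^ (2 ^ c) * r (j+1) + hL n D (c + 1) * s (j+1)) * X ^ (j * 2 ^ (c + 1)), ?_⟩
      linear_combination hsum
    obtain ⟨z1, z2⟩ := as_step n D m a c hn hD hn0 hD0 hind ha (r 0) (s 0) (hr 0 (by omega)) (hs 0 (by omega)) d1
    rw [z1, z2] at hsum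
    simp only [mul_zero, add_zero, mul_eq_zero, pow_eq_zero_iff', X_ne_zero, false_and, false_or] at hsum
    have := ih (fun j => r (j+1)) (fun j => s (j+1)) (fun j hj => hr _ (by omega)) (fun j hj => hs _ (by omega)) hsum
    intro j hj
    cases j with
    | zero => exact ⟨z1, z2⟩
    | succ j => exact this j (by omega)

theorem frob_pow (n : K[X]) (h : ∀ x, n.eval (x ^ 2) = n.eval x ^ 2) (i : ℕ) (x : K) :
    n.eval (x ^ (2 ^ i)) = n.eval x ^ (2 ^ i) := by
  induction i with
  | zero => simp
  | succ i ih => rw [pow_succ, pow_mul, h, ih, ← pow_mul]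

theorem as_stepanov [Fintype K] [CharP K 2] (n D : K[X]) (m a c k J : ℕ) (hn : n.natDegree ≤ m) (hD : D.natDegree ≤ m)
    (hn0 : X ∣ n) (hD0 : D.coeff 0 ≠ 0)
    (hind : ∀ r s : K[X], D * r ^ 2 + D * r * s + n * s ^ 2 = 0 → r = 0 ∧ s = 0)
    (hnF : ∀ x, n.eval (x ^ 2) = n.eval x ^ 2) (hDF : ∀ x, D.eval (x ^ 2) = D.eval x ^ 2)
    (ha : 2 * a + m ≤ 2 ^ (c + 1)) (hq : Fintype.card K = 2 ^ (c + 1 + (k + 1)))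
    (ha0 : 0 < a) (hJ : 0 < J) (hcount : a * 2 ^ (k + 1) + m * 2 ^ k + J < 2 * (J * a)) (ε : K) (S : Finset K)
    (hS : ∀ x ∈ S, D.eval x ≠ 0 ∧ pT (c + 1 + (k + 1)) (n.eval x / D.eval x) = ε) :
    S.card ≤ a + m * 2 ^ c + (J - 1) * 2 ^ (c + 1) := by
  classical
  let V := (Fin J → degreeLT K a) × (Fin J → degreeLT K a)
  let M := 2 ^ (k + 1)
  let P : V →ₗ[K] K[X] :=
    { toFun := fun v => ∑ j : Fin J, X ^ (j : ℕ) * (D ^ (2 ^ k) * expand K M (v.1 j : K[X]) + 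
        (C ε * D ^ (2 ^ k) + hL n D (k + 1)) * expand K M (v.2 j : K[X]))
      map_add' := by
        intro v w
        rw [← Finset.sum_add_distrib]
        apply Finset.sum_congr rfl
        intro j _
        have e1 : (((v + w).1 j : degreeLT K a) : K[X]) = (v.1 j : K[X]) + (w.1 j : K[X]) := rfl
        have e2 : (((v + w).2 j : degreeLT K a) : K[X]) = (v.2 j : K[X]) + (w.2 j : K[X]) := rfl
        rw [e1, e2, map_add, map_add]
        ring
      map_smul' := by
        intro c v
        rw [RingHom.id_apply, Finset.smul_sum]
        apply Finset.sum_congr rfl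
        intro j _
        have e1 : (((c • v).1 j : degreeLT K a) : K[X]) = c • (v.1 j : K[X]) := rfl
        have e2 : (((c • v).2 j : degreeLT K a) : K[X]) = c • (v.2 j : K[X]) := rfl
        rw [e1, e2, map_smul, map_smul]
        simp only [smul_eq_C_mul]
        ring }
  let N := a * 2 ^ (k + 1) + m * 2 ^ k + J
  let Φ : V →ₗ[K] (Fin N → K) :=
    LinearMap.pi (fun x => (lcoeff K (x : ℕ)) ∘ₗ P)
  have hker : LinearMap.ker Φ ≠ ⊥ := by
    apply LinearMap.ker_ne_bot_of_finrank_lt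
    rw [Module.finrank_fintype_fun_eq_card]
    simp only [Fintype.card_fin]
    refine lt_of_lt_of_eq hcount ?_
    have e : Module.finrank K (degreeLT K a) = a := by
      rw [(degreeLTEquiv K a).finrank_eq]; simp
    rw [Module.finrank_prod, Module.finrank_pi_fintype]
    simp [e]; ring
  obtain ⟨v, hv, hv0⟩ := (Submodule.ne_bot_iff _).1 hker
  have hdegr : ∀ g : degreeLT K a, (g : K[X]).natDegree < a := by
    intro g
    have := mem_degreeLT.1 g.2
    by_cases hg0 : (g : K[X]) = 0
    · rw [hg0]; simpa using ha0
    · exact ((natDegree_lt_iff_degree_lt hg0).2 this)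
  have hDk : ∀ k, (D ^ (2 ^ k)).natDegree ≤ m * 2 ^ k := by
    intro k
    rw [mul_comm]
    exact natDegree_pow_le.trans (Nat.mul_le_mul_left _ hD)
  have hP : P v = 0 := by
    ext i
    rw [coeff_zero]
    by_cases hi : i < N
    · have := congrFun (LinearMap.mem_ker.1 hv) ⟨i, hi⟩
      simpa [Φ] using this
    · apply coeff_eq_zero_of_natDegree_lt
      refine lt_of_le_of_lt (b := a * 2 ^ (k + 1) + m * 2 ^ k + (J - 1)) ?_ (by omega)
      simp only [P, LinearMap.coe_mk, AddHom.coe_mk]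
      apply natDegree_sum_le_of_forall_le
      intro j _
      refine natDegree_mul_le.trans ?_
      rw [natDegree_X_pow]
      have h7 := j.2
      have hE : ∀ g : degreeLT K a, (expand K M (g : K[X])).natDegree ≤ a * 2 ^ (k + 1) := by
        intro g
        rw [natDegree_expand]
        exact Nat.mul_le_mul_right _ (hdegr g).le
      have hw : (C ε * D ^ (2 ^ k) + hL n D (k + 1)).natDegree ≤ m * 2 ^ k := by
        refine (natDegree_add_le _ _).trans (max_le ?_ ?_)
        · exact (natDegree_C_mul_le _ _).trans (hDk k)
        · exact hL_deg n D m (k + 1) hn hD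
      have h8 : (D ^ (2 ^ k) * expand K M (v.1 j : K[X]) + 
        (C ε * D ^ (2 ^ k) + hL n D (k + 1)) * expand K M (v.2 j : K[X])).natDegree ≤ a * 2 ^ (k + 1) + m * 2 ^ k := by
        refine (natDegree_add_le _ _).trans (max_le ?_ ?_)
        · refine natDegree_mul_le.trans ?_
          have := hE (v.1 j)
          have := hDk k
          omega
        · refine natDegree_mul_le.trans ?_
          have := hE (v.2 j)
          omega
      omega
  let r : ℕ → K[X] := fun j => if hj : j < J then (v.1 ⟨j, hj⟩ : K[X]) else 0
  let s : ℕ → K[X] := fun j => if hj : j < J then (v.2 ⟨j, hj⟩ : K[X]) else 0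
  let R0 := ∑ j ∈ Finset.range J, (D ^ (2 ^ c) * r j + hL n D (c + 1) * s j) * X ^ (j * 2 ^ (c + 1))
  have hR0 : R0 ≠ 0 := by
    intro hz
    have := as_nonvanish n D m a c hn hD hn0 hD0 hind ha J r s ?_ ?_ hz
    · apply hv0
      ext j : 2
      · have := (this j j.2).1
        simp only [r, j.2, dif_pos] at this
        exact Subtype.ext this
      · have := (this j j.2).2
        simp only [s, j.2, dif_pos] at this
        exact Subtype.ext this
    · intro j hj
      simp only [r, hj, dif_pos]
      exact mem_degreeLT.1 (v.1 ⟨j, hj⟩).2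
    · intro j hj
      simp only [s, hj, dif_pos]
      exact mem_degreeLT.1 (v.2 ⟨j, hj⟩).2
  have hdeg : R0.natDegree ≤ a + m * 2 ^ c + (J - 1) * 2 ^ (c + 1) := by
    apply natDegree_sum_le_of_forall_le
    intro j hj
    rw [Finset.mem_range] at hj
    refine natDegree_mul_le.trans ?_
    rw [natDegree_X_pow]
    have h3 : (D ^ (2 ^ c) * r j + hL n D (c + 1) * s j).natDegree ≤ a + m * 2 ^ c := by
      refine (natDegree_add_le _ _).trans (max_le ?_ ?_)
      · refine natDegree_mul_le.trans ?_
        simp only [r, hj, dif_pos]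
        have := hdegr (v.1 ⟨j, hj⟩)
        have := hDk c
        omega
      · refine natDegree_mul_le.trans ?_
        simp only [s, hj, dif_pos]
        have := hdegr (v.2 ⟨j, hj⟩)
        have : (hL n D (c + 1)).natDegree ≤ m * 2 ^ c := hL_deg n D m (c + 1) hn hD
        omega
    have : j * 2 ^ (c + 1) ≤ (J - 1) * 2 ^ (c + 1) := Nat.mul_le_mul_right _ (by omega)
    omega
  have hroot : ∀ x ∈ S, R0.eval x = 0 := by
    intro x hx
    obtain ⟨hDx, hTx⟩ := hS x hx
    set y := x ^ (2 ^ (c + 1)) with hy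
    have hyx : y ^ M = x := by
      rw [hy, ← pow_mul, ← pow_add, ← hq]
      exact FiniteField.pow_card x
    have hDy : D.eval y = D.eval x ^ (2 ^ (c + 1)) := frob_pow D hDF _ x
    have hny : n.eval y = n.eval x ^ (2 ^ (c + 1)) := frob_pow n hnF _ x
    have hDy0 : D.eval y ≠ 0 := by rw [hDy]; exact pow_ne_zero _ hDx
    rw [pT_split, div_pow, ← hDy, ← hny] at hTx
    have w1 := hL_eq (n.eval x) (D.eval x) hDx (c + 1)
    have w2 := hL_eq (n.eval y) (D.eval y) hDy0 (k + 1)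
    rw [Nat.add_sub_cancel] at w1 w2
    have key : (D.eval y) ^ (2 ^ k) * hL (n.eval x) (D.eval x) (c + 1) =
        (D.eval x) ^ (2 ^ c) * (ε * (D.eval y) ^ (2 ^ k) + hL (n.eval y) (D.eval y) (k + 1)) := by
      have two : (2 : K) = 0 := CharTwo.two_eq_zero
      rw [w1, w2, ← hTx]
      linear_combination (-(D.eval y) ^ (2 ^ k) * (D.eval x) ^ (2 ^ c) * pT (k + 1) (n.eval y / D.eval y)) * two
    have h2 := congrArg (eval y) hP
    simp only [P, LinearMap.coe_mk, AddHom.coe_mk, eval_finsetSum, eval_mul, eval_add, eval_pow, eval_X, eval_C, expand_eval, hyx, hL_eval, eval_zero] at h2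
    have h3 : (D.eval y) ^ (2 ^ k) * R0.eval x = (D.eval x) ^ (2 ^ c) * 0 := by
      rw [← h2]
      simp only [R0]
      rw [Finset.sum_range, eval_finsetSum, Finset.mul_sum, Finset.mul_sum]
      apply Finset.sum_congr rfl
      intro j _
      simp only [r, s, j.2, dif_pos, eval_mul, eval_add, eval_pow, eval_X, hL_eval]
      rw [pow_mul', ← hy]
      linear_combination (y ^ (j : ℕ) * eval x (v.2 j : K[X])) * key
    rw [mul_zero] at h3
    exact (mul_eq_zero.1 h3).resolve_left (pow_ne_zero _ hDy0)
  refine le_trans ?_ hdeg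
  have hsub : S.val ≤ R0.roots := by
    rw [Multiset.le_iff_subset S.nodup]
    intro x hx
    rw [mem_roots hR0]
    exact hroot x hx
  exact (Multiset.card_le_card hsub).trans (card_roots' _)

theorem ind_deg (n D : K[X]) (hD : D ≠ 0) (hn : n.natDegree = D.natDegree + 3) (r s : K[X])
    (h : D * r ^ 2 + D * r * s + n * s ^ 2 = 0) : r = 0 ∧ s = 0 := by
  have hn0 : n ≠ 0 := by rintro rfl; simp at hn
  by_cases hs : s = 0
  · subst hs
    simpa [hD] using h
  by_cases hr : r = 0
  · subst hr
    simp [hn0, hs] at h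
  exfalso
  have e1 : D * r ^ 2 = -(D * r * s + n * s ^ 2) := by linear_combination h
  have e2 : n * s ^ 2 = -(D * r * s + D * r ^ 2) := by linear_combination h
  have d1 := natDegree_add_le (D * r * s) (n * s ^ 2)
  have d2 := natDegree_add_le (D * r * s) (D * r ^ 2)
  rw [← natDegree_neg, ← e1] at d1
  rw [← natDegree_neg, ← e2] at d2
  have f1 : (D * r ^ 2).natDegree = D.natDegree + 2 * r.natDegree := by
    rw [natDegree_mul hD (pow_ne_zero _ hr), natDegree_pow]
  have f2 : (n * s ^ 2).natDegree = n.natDegree + 2 * s.natDegree := by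
    rw [natDegree_mul hn0 (pow_ne_zero _ hs), natDegree_pow]
  have f3 : (D * r * s).natDegree = D.natDegree + r.natDegree + s.natDegree := by
    rw [natDegree_mul (mul_ne_zero hD hr) hs, natDegree_mul hD hr]
  omega

noncomputable def pP (K : Type*) [Field K] : K[X] := X ^ 5 + X + 1

theorem pP_deg : (pP K).natDegree = 5 := by
  unfold pP; compute_degree!

theorem pP_ne : pP K ≠ 0 := by
  intro h; have := pP_deg (K := K); simp [h] at this

theorem ind_P [CharP K 2] : ∀ (N : ℕ) (r s : K[X]), s.natDegree ≤ N →
    pP K * r ^ 2 + pP K * r * s + (X ^ 4 + X ^ 2) * s ^ 2 = 0 → r = 0 ∧ s = 0 := by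
  have two : (2 : K[X]) = 0 := CharTwo.two_eq_zero
  have hsep : (pP K).Separable := by
    refine ⟨1, X, ?_⟩
    have h4 : (C (4 : K)) = 4 := map_ofNat C 4
    simp [pP]
    linear_combination (3 * X ^ 5 + X) * two + X ^ 5 * h4
  have hrad := hsep.squarefree.isRadical
  have hcop : IsCoprime (pP K) (X ^ 4 + X ^ 2) := by
    have e : (X ^ 4 + X ^ 2 : K[X]) = X ^ 2 * (X + 1) ^ 2 := by linear_combination -X ^ 3 * two
    rw [e]
    apply IsCoprime.mul_right
    · apply IsCoprime.pow_right
      exact ⟨1, X ^ 4 + 1, by simp only [pP]; linear_combination (X ^ 5 + X) * two⟩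
    · apply IsCoprime.pow_right
      exact ⟨1, X * (X + 1) ^ 3, by simp only [pP]; linear_combination (X ^ 5 + 2 * X ^ 4 + 3 * X ^ 3 + 2 * X ^ 2 + X) * two⟩
  intro N
  induction N using Nat.strong_induction_on with
  | _ N ih =>
  intro r s hN h
  have d1 : pP K ∣ s ^ 2 := by
    apply hcop.dvd_of_dvd_mul_left
    exact ⟨-(r ^ 2 + r * s), by linear_combination h⟩
  obtain ⟨s1, rfl⟩ := hrad 2 s d1
  have h1 : r ^ 2 + pP K * r * s1 + pP K * (X ^ 4 + X ^ 2) * s1 ^ 2 = 0 := by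
    apply mul_left_cancel₀ (pP_ne (K := K))
    linear_combination h
  have d2 : pP K ∣ r ^ 2 := ⟨-(r * s1 + (X ^ 4 + X ^ 2) * s1 ^ 2), by linear_combination h1⟩
  obtain ⟨r1, rfl⟩ := hrad 2 r d2
  have h2 : pP K * r1 ^ 2 + pP K * r1 * s1 + (X ^ 4 + X ^ 2) * s1 ^ 2 = 0 := by
    apply mul_left_cancel₀ (pP_ne (K := K))
    linear_combination h1
  by_cases hs1 : s1 = 0
  · subst hs1
    have := pP_ne (K := K)
    simp_all
  rw [natDegree_mul pP_ne hs1, pP_deg] at hN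
  obtain ⟨a1, a2⟩ := ih (s1.natDegree) (by omega) r1 s1 le_rfl h2
  simp [a1, a2]

theorem pT_add [CharP K 2] (l : ℕ) (x y : K) : pT l (x + y) = pT l x + pT l y := by
  simp only [pT, ← Finset.sum_add_distrib, add_pow_char_pow]

theorem pT_sq' [CharP K 2] (l : ℕ) (x : K) : pT l x ^ 2 = pT l (x ^ 2) := by
  rw [pT, sum_pow_char]
  simp only [pT, ← pow_mul, mul_comm]

theorem pT_sq [Fintype K] [CharP K 2] (l : ℕ) (hq : Fintype.card K = 2 ^ l) (x : K) : pT l (x ^ 2) = pT l x := by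
  have h1 := Finset.sum_range_succ' (fun i => x ^ (2 ^ i)) l
  have h2 := Finset.sum_range_succ (fun i => x ^ (2 ^ i)) l
  rw [h1] at h2
  have h3 : x ^ (2 ^ l) = x := by rw [← hq]; exact FiniteField.pow_card x
  simp only [h3, pow_zero, pow_one, add_left_inj] at h2
  rw [pT, pT, ← h2]
  apply Finset.sum_congr rfl
  intro i _
  rw [← pow_mul, pow_succ']

theorem pT_01 [Fintype K] [CharP K 2] (l : ℕ) (hq : Fintype.card K = 2 ^ l) (x : K) : pT l x = 0 ∨ pT l x = 1 := by
  have h := pT_sq' l x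
  rw [pT_sq l hq] at h
  have : pT l x * (pT l x - 1) = 0 := by linear_combination h
  rcases mul_eq_zero.1 this with h | h
  · exact Or.inl h
  · exact Or.inr (sub_eq_zero.1 h)

theorem hilb [Fintype K] [CharP K 2] (l : ℕ) (hq : Fintype.card K = 2 ^ (l + 1)) (x : K) (hx : pT (l + 1) x = 0) :
    ∃ v, v ^ 2 + v = x := by
  classical
  have two : (2 : K) = 0 := CharTwo.two_eq_zero
  let φ : K → K := fun v => v ^ 2 + v
  let Z : Finset K := (hL X (1 : K[X]) (l + 1)).roots.toFinset
  have hne : hL X (1 : K[X]) (l + 1) ≠ 0 := by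
    intro h
    have := hL_sq (X : K[X]) 1 l
    rw [h] at this
    simp only [one_pow, mul_one, mul_zero, zero_add, ne_eq, OfNat.ofNat_ne_zero, not_false_eq_true, zero_pow] at this
    have h1 := congrArg natDegree this
    rw [natDegree_X, natDegree_X_pow, pow_succ] at h1
    omega
  have hZ : ∀ y, y ∈ Z ↔ pT (l + 1) y = 0 := by
    intro y
    simp only [Z, Multiset.mem_toFinset]
    rw [mem_roots hne, IsRoot.def, hL_eval, eval_one, hL_eq _ _ one_ne_zero]
    simp
  have hZc : Z.card ≤ 2 ^ l := by
    refine (Multiset.toFinset_card_le _).trans ((card_roots' _).trans ?_)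
    have := hL_deg X (1 : K[X]) 1 (l + 1) (by simp) (by simp)
    simpa using this
  have hsub : Finset.univ.image φ ⊆ Z := by
    intro y hy
    obtain ⟨v, -, rfl⟩ := Finset.mem_image.1 hy
    rw [hZ, pT_add, pT_sq _ hq]
    linear_combination pT (l + 1) v * two
  have hc := Finset.card_le_mul_card_image (f := φ) Finset.univ 2 (by
    intro y hy
    obtain ⟨v, -, rfl⟩ := Finset.mem_image.1 hy
    have : Finset.univ.filter (fun x => φ x = φ v) ⊆ {v, v + 1} := by
      intro x hx
      rw [Finset.mem_filter] at hx
      have h1 : (x - v) * (x - (v + 1)) = 0 := by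
        have := hx.2
        simp only [φ] at this
        linear_combination this + (v ^ 2 - x + v - x * v) * two
      rcases mul_eq_zero.1 h1 with h | h
      · simp [sub_eq_zero.1 h]
      · simp [sub_eq_zero.1 h]
    exact (Finset.card_le_card this).trans Finset.card_le_two)
  rw [Finset.card_univ, hq, pow_succ] at hc
  have heq := Finset.eq_of_subset_of_card_le hsub (by omega)
  have : x ∈ Finset.univ.image φ := by rw [heq, hZ]; exact hx
  obtain ⟨v, -, hv⟩ := Finset.mem_image.1 this
  exact ⟨v, hv⟩

theorem sol_of_z [CharP K 2] (t u z β : K) (ht : t ≠ 0) (hz : z ≠ 0) (hzu : z = u + t ^ 2)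
    (hu : u ^ 2 + 1 = u * t ^ 3) (hβ : β ^ 2 + β = t * (t ^ 2 + 1) / z ^ 2) : Sol K := by
  have two : (2 : K) = 0 := CharTwo.two_eq_zero
  refine ⟨t, z / t * β, z / t * β + z / t, ?_, ?_⟩
  · field_simp at hβ ⊢
    linear_combination hβ + (t ^ 2 + t) * two
  · have e : z / t * β - (z / t * β + z / t) + t - 2 = u / t := by
      rw [hzu]; field_simp; linear_combination (-u - t) * two
    rw [e]
    field_simp
    linear_combination hu + 2 * u * t * two

theorem sol_char2 [Fintype K] [CharP K 2] (l : ℕ) (hq : Fintype.card K = 2 ^ (l + 1)) (s : K) (hs : s ≠ 0)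
    (hP : s ^ 5 + s + 1 ≠ 0) (h1 : pT (l + 1) (s ^ 3) = 0)
    (h2 : pT (l + 1) ((s ^ 4 + s ^ 2) / (s ^ 5 + s + 1)) = 1) : Sol K := by
  have two : (2 : K) = 0 := CharTwo.two_eq_zero
  obtain ⟨v, hv⟩ := hilb l hq _ h1
  obtain ⟨t, ht⟩ : ∃ t, t = s⁻¹ := ⟨_, rfl⟩
  have hts : t * s = 1 := by rw [ht]; exact inv_mul_cancel₀ hs
  have ht0 : t ≠ 0 := by rw [ht]; exact inv_ne_zero hs
  have hsq : v ^ 4 + v ^ 2 = s ^ 6 := by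
    have : (v ^ 2 + v) ^ 2 = (s ^ 3) ^ 2 := by rw [hv]
    linear_combination this - v ^ 3 * two
  have hts6 : t ^ 6 * s ^ 6 = 1 := by rw [← mul_pow, hts, one_pow]
  have hu : ∀ e : K, e ^ 2 + e = 0 → (t ^ 3 * (v ^ 2 + e)) ^ 2 + 1 = (t ^ 3 * (v ^ 2 + e)) * t ^ 3 := by
    intro e he
    linear_combination t ^ 6 * he + t ^ 6 * hsq + hts6 + (t ^ 6 * v ^ 2 * e - t ^ 6 * v ^ 2 - t ^ 6 * e + 1) * two
  have hu0 := hu 0 (by ring)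
  have hu1 := hu 1 (by linear_combination two)
  set u := t ^ 3 * (v ^ 2 + 0) with hud
  set u' := t ^ 3 * (v ^ 2 + 1) with hud'
  have hsum : u' = u + t ^ 3 := by rw [hud, hud']; ring
  obtain ⟨z, hz⟩ : ∃ z, z = u + t ^ 2 := ⟨_, rfl⟩
  obtain ⟨z', hz'⟩ : ∃ z, z = u' + t ^ 2 := ⟨_, rfl⟩
  have hzs : z' = z + t ^ 3 := by rw [hz, hz', hsum]; ring
  have hprod : z * z' = t ^ 5 * (s ^ 5 + s + 1) := by
    have e5 : t ^ 5 * s ^ 5 = 1 := by rw [← mul_pow, hts, one_pow]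
    rw [hz', hz, hsum]
    linear_combination hu0 - e5 - t ^ 4 * hts + (u * t ^ 2 + u * t ^ 3) * two - two
  have hpne : z * z' ≠ 0 := by rw [hprod]; exact mul_ne_zero (pow_ne_zero _ ht0) hP
  have hz0 : z ≠ 0 := left_ne_zero_of_mul hpne
  have hz0' : z' ≠ 0 := right_ne_zero_of_mul hpne
  have hδ : t * (t ^ 2 + 1) / z ^ 2 + t * (t ^ 2 + 1) / z' ^ 2 =
      ((s ^ 4 + s ^ 3 + s ^ 2 + s) / (s ^ 5 + s + 1)) ^ 2 + (s ^ 3 + s) / (s ^ 5 + s + 1) := by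
    have e1 : t * (t ^ 2 + 1) / z ^ 2 + t * (t ^ 2 + 1) / z' ^ 2 = t * (t ^ 2 + 1) * t ^ 6 / (z * z') ^ 2 := by
      field_simp
      rw [hzs]
      linear_combination (z ^ 2 + z * t ^ 3) * (t ^ 2 + 1) * two
    have e2 : t * (t ^ 2 + 1) * t ^ 6 / (z * z') ^ 2 = (s ^ 3 + s) / (s ^ 5 + s + 1) ^ 2 := by
      rw [hprod, ht]
      field_simp
      ring
    rw [e1, e2]
    obtain ⟨p, hp⟩ : ∃ p, p = s ^ 5 + s + 1 := ⟨_, rfl⟩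
    rw [← hp] at hP ⊢
    field_simp
    rw [hp]
    grind
  have hT : pT (l + 1) (t * (t ^ 2 + 1) / z ^ 2) + pT (l + 1) (t * (t ^ 2 + 1) / z' ^ 2) = 1 := by
    rw [← pT_add, hδ, pT_add, pT_sq _ hq, ← pT_add, ← add_div]
    have e : s ^ 4 + s ^ 3 + s ^ 2 + s + (s ^ 3 + s) = s ^ 4 + s ^ 2 := by
      linear_combination (s ^ 3 + s) * two
    rw [e, h2]
  rcases pT_01 _ hq (t * (t ^ 2 + 1) / z ^ 2) with h | h
  · obtain ⟨β, hβ⟩ := hilb l hq _ h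
    exact sol_of_z t u z β ht0 hz0 hz hu0 hβ
  · rw [h] at hT
    obtain ⟨β, hβ⟩ := hilb l hq (t * (t ^ 2 + 1) / z' ^ 2) (by linear_combination hT)
    exact sol_of_z t u' z' β ht0 hz0' hz' hu1 hβ

theorem char2_big [Fintype K] [CharP K 2] (c : ℕ) (hc : 7 ≤ c) (hq : Fintype.card K = 2 ^ (c + 1 + (4 + 1))) :
    Sol K := by
  classical
  by_contra hno
  have two : (2 : K) = 0 := CharTwo.two_eq_zero
  have h128 : 128 ≤ 2 ^ c := by
    calc 128 = 2 ^ 7 := by norm_num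
      _ ≤ 2 ^ c := Nat.pow_le_pow_right (by norm_num) hc
  have hQ : 2 ^ (c + 1) = 2 * 2 ^ c := by rw [pow_succ]; ring
  have hq' : Fintype.card K = 64 * 2 ^ c := by rw [hq]; ring
  have hPe : ∀ x : K, (pP K).eval x = x ^ 5 + x + 1 := by intro x; simp [pP]
  have hPF : ∀ x : K, (pP K).eval (x ^ 2) = (pP K).eval x ^ 2 := by
    intro x
    rw [hPe, hPe]
    linear_combination -(x ^ 5 + x ^ 6 + x) * two
  let T : K → K := pT (c + 1 + (4 + 1))
  let A1 : Finset K := Finset.univ.filter (fun x => T (x ^ 3) = 1)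
  let A2 : Finset K := Finset.univ.filter (fun x => x ^ 5 + x + 1 ≠ 0 ∧ T ((x ^ 4 + x ^ 2) / (x ^ 5 + x + 1)) = 0)
  let A3 : Finset K := Finset.univ.filter (fun x => x ^ 5 + x + 1 ≠ 0 ∧ T ((x ^ 8 + x ^ 3 + x ^ 2) / (x ^ 5 + x + 1)) = 0)
  have b1 := as_stepanov (K := K) (X ^ 3) 1 3 33 c 4 17 (by simp) (by simp) (dvd_pow_self _ (by norm_num)) (by simp)
    (ind_deg _ _ one_ne_zero (by simp)) (by intro x; simp; ring) (by simp) (by omega) hq (by norm_num) (by norm_num)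
    (by norm_num) 1 A1 (by intro x hx; simpa [A1, T] using hx)
  have b2 := as_stepanov (K := K) (X ^ 4 + X ^ 2) (pP K) 5 49 c 4 17 (by compute_degree!) (by rw [pP_deg])
    ⟨X ^ 3 + X, by ring⟩ (by simp [pP])
    (fun r s h => ind_P _ r s le_rfl h) (by intro x; simp; linear_combination -x ^ 6 * two) hPF (by omega) hq (by norm_num) (by norm_num)
    (by norm_num) 0 A2 (by intro x hx; rw [hPe]; simpa [A2, T] using hx)
  have b3 := as_stepanov (K := K) (X ^ 8 + X ^ 3 + X ^ 2) (pP K) 8 73 c 4 17 (by compute_degree) (by rw [pP_deg]; norm_num)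
    ⟨X ^ 7 + X ^ 2 + X, by ring⟩ (by simp [pP])
    (ind_deg _ _ pP_ne (by rw [pP_deg]; compute_degree!)) (by intro x; simp; linear_combination -(x ^ 11 + x ^ 10 + x ^ 5) * two) hPF (by omega) hq (by norm_num) (by norm_num)
    (by norm_num) 0 A3 (by intro x hx; rw [hPe]; simpa [A3, T] using hx)
  let Z : Finset K := (X * pP K).roots.toFinset
  have hZne : X * pP K ≠ 0 := mul_ne_zero X_ne_zero pP_ne
  have hZ : Z.card ≤ 6 := by
    refine (Multiset.toFinset_card_le _).trans ((card_roots' _).trans ?_)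
    rw [natDegree_mul X_ne_zero pP_ne, natDegree_X, pP_deg]
  have hcov : ∀ x : K, 2 ≤ 2 * (if x ∈ Z then 1 else 0) + ((if x ∈ A1 then 1 else 0) + (if x ∈ A2 then 1 else 0) + (if x ∈ A3 then 1 else 0)) := by
    intro x
    by_cases hx : x ∈ Z
    · simp [hx]
    have hx' : x ≠ 0 ∧ x ^ 5 + x + 1 ≠ 0 := by
      simp only [Z, Multiset.mem_toFinset, mem_roots hZne, IsRoot.def, eval_mul, eval_X, mul_eq_zero, hPe] at hx
      exact not_or.1 hx
    have hsum : T ((x ^ 8 + x ^ 3 + x ^ 2) / (x ^ 5 + x + 1)) = T (x ^ 3) + T ((x ^ 4 + x ^ 2) / (x ^ 5 + x + 1)) := by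
      simp only [T]
      rw [← pT_add]
      congr 1
      have hne := hx'.2
      obtain ⟨p, hp⟩ : ∃ p, p = x ^ 5 + x + 1 := ⟨_, rfl⟩
      rw [← hp] at hne ⊢
      field_simp
      rw [hp]
      linear_combination -x ^ 4 * two
    have m1 : x ∈ A1 ↔ T (x ^ 3) = 1 := by simp [A1]
    have m2 : x ∈ A2 ↔ T ((x ^ 4 + x ^ 2) / (x ^ 5 + x + 1)) = 0 := by simp [A2, hx'.2]
    have m3 : x ∈ A3 ↔ T (x ^ 3) + T ((x ^ 4 + x ^ 2) / (x ^ 5 + x + 1)) = 0 := by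
      rw [← hsum]; simp [A3, hx'.2]
    rcases pT_01 _ hq (x ^ 3) with h1 | h1 <;> rcases pT_01 _ hq ((x ^ 4 + x ^ 2) / (x ^ 5 + x + 1)) with h2 | h2
    · rw [if_pos (m2.2 h2), if_pos (m3.2 (by simp only [T]; rw [h1, h2, add_zero]))]; omega
    · exact absurd (sol_char2 _ hq x hx'.1 hx'.2 h1 h2) hno
    · rw [if_pos (m1.2 h1), if_pos (m2.2 h2)]; omega
    · rw [if_pos (m1.2 h1), if_pos (m3.2 (by simp only [T]; rw [h1, h2]; linear_combination two))]; omega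
  have hsum := Finset.sum_le_sum (s := Finset.univ) (fun (x : K) _ => hcov x)
  simp only [Finset.sum_add_distrib, ← Finset.mul_sum, Finset.sum_ite_mem, Finset.univ_inter, Finset.sum_const, smul_eq_mul, mul_one, Finset.card_univ] at hsum
  omega

theorem root_exists {K : Type u} [Field K] [Fintype K] (f : K[X]) (d : ℕ) (hd : d ≠ 0) (hf : f.natDegree = d) (Q n : ℕ)
    (hq : Fintype.card K = Q ^ n)
    (H : ∀ (A : Type u) [CommRing A] [Algebra K A] (x : A), aeval x f = 0 → x ^ Q = x) :
    ∃ x : K, f.eval x = 0 := by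
  have h1 := H (AdjoinRoot f) (AdjoinRoot.root f) (by rw [AdjoinRoot.aeval_eq, AdjoinRoot.mk_self])
  have h2 : ∀ n, (AdjoinRoot.root f) ^ (Q ^ n) = AdjoinRoot.root f := by
    intro n
    induction n with
    | zero => simp
    | succ n ih => rw [pow_succ, pow_mul, ih, h1]
  have h3 : f ∣ X ^ (Fintype.card K) - X := by
    rw [← AdjoinRoot.mk_eq_zero, map_sub, map_pow, AdjoinRoot.mk_X, hq, h2, sub_self]
  have hne : (X ^ (Fintype.card K) - X : K[X]) ≠ 0 := FiniteField.X_pow_card_sub_X_ne_zero K Fintype.one_lt_card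
  have hsp : (X ^ (Fintype.card K) - X : K[X]).Splits := by
    rw [splits_iff_card_roots, FiniteField.roots_X_pow_card_sub_X, ← Finset.card_def, Finset.card_univ,
      FiniteField.X_pow_card_sub_X_natDegree_eq K Fintype.one_lt_card]
  exact (hsp.of_dvd hne h3).exists_eval_eq_zero (degree_ne_of_natDegree_ne (by rw [hf]; exact hd))

theorem ext_2_2_chain {A : Type*} [CommRing A] (hp : (2 : A) = 0) (x : A) (hx : 1 + 1 * x + 1 * x ^ 2 = 0) :
    x ^ (2 ^ 2) = x := by
  have e0 : x ^ (2 ^ 0) = x := by simp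
  have e1 : x ^ (2 ^ 1) = 1 + 1 * x := by
    rw [pow_succ, pow_mul, e0]
    linear_combination (1) * hx + ((-1) + (-1) * x) * hp
  have e2 : x ^ (2 ^ 2) = x := by
    rw [pow_succ, pow_mul, e1]
    linear_combination (1) * hx + (0) * hp
  exact e2

theorem ext_2_2_sol (hp : (2 : K) = 0) (x : K) (hx : 1 + 1 * x + 1 * x ^ 2 = 0) : Sol K := by
  refine ⟨x, 1, 1, ?_, ?_⟩
  · linear_combination (1) * hx + (1 * x + (-1) * x ^ 2) * hp
  · linear_combination (1 + 1 * x + 1 * x ^ 3) * hx + ((-1) * x + (-3) * x ^ 2 + (-1) * x ^ 3 + 1 * x ^ 4 + (-1) * x ^ 5) * hp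

theorem ext_2_2 [Fintype K] (hp : (2 : K) = 0) (n : ℕ) (hq : Fintype.card K = (2 ^ 2) ^ n) : Sol K := by
  obtain ⟨x, hx⟩ := root_exists (K := K) (1 + 1 * X + 1 * X ^ 2) 2 (by norm_num) (by compute_degree!) (2 ^ 2) n hq (by
    intro A _ _ x hx
    apply ext_2_2_chain
    · have := congrArg (algebraMap K A) hp
      simpa only [map_ofNat, map_zero] using this
    · simpa [map_ofNat] using hx)
  apply ext_2_2_sol hp x
  simpa using hx

theorem ext_2_3_chain {A : Type*} [CommRing A] (hp : (2 : A) = 0) (x : A) (hx : 1 + 1 * x + 1 * x ^ 3 = 0) :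
    x ^ (2 ^ 3) = x := by
  have e0 : x ^ (2 ^ 0) = x := by simp
  have e1 : x ^ (2 ^ 1) = 1 * x ^ 2 := by
    rw [pow_succ, pow_mul, e0]
    linear_combination (0) * hx + (0) * hp
  have e2 : x ^ (2 ^ 2) = 1 * x + 1 * x ^ 2 := by
    rw [pow_succ, pow_mul, e1]
    linear_combination (1 * x) * hx + ((-1) * x + (-1) * x ^ 2) * hp
  have e3 : x ^ (2 ^ 3) = x := by
    rw [pow_succ, pow_mul, e2]
    linear_combination (1 * x) * hx + ((-1) * x + 1 * x ^ 3) * hp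
  exact e3

theorem ext_2_3_sol (hp : (2 : K) = 0) (x : K) (hx : 1 + 1 * x + 1 * x ^ 3 = 0) : Sol K := by
  refine ⟨x, 1 * x, 1 * x + 1 * x ^ 2, ?_, ?_⟩
  · linear_combination (1 + 1 * x) * hx + ((-1) * x ^ 2) * hp
  · linear_combination (1 + 1 * x + 1 * x ^ 2) * hx + ((-1) * x + (-3) * x ^ 2 + (-1) * x ^ 3 + 1 * x ^ 4 + (-2) * x ^ 5 + 1 * x ^ 6) * hp

theorem ext_2_3 [Fintype K] (hp : (2 : K) = 0) (n : ℕ) (hq : Fintype.card K = (2 ^ 3) ^ n) : Sol K := by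
  obtain ⟨x, hx⟩ := root_exists (K := K) (1 + 1 * X + 1 * X ^ 3) 3 (by norm_num) (by compute_degree!) (2 ^ 3) n hq (by
    intro A _ _ x hx
    apply ext_2_3_chain
    · have := congrArg (algebraMap K A) hp
      simpa only [map_ofNat, map_zero] using this
    · simpa [map_ofNat] using hx)
  apply ext_2_3_sol hp x
  simpa using hx

theorem ext_2_5_chain {A : Type*} [CommRing A] (hp : (2 : A) = 0) (x : A) (hx : 1 + 1 * x ^ 2 + 1 * x ^ 5 = 0) :
    x ^ (2 ^ 5) = x := by
  have e0 : x ^ (2 ^ 0) = x := by simp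
  have e1 : x ^ (2 ^ 1) = 1 * x ^ 2 := by
    rw [pow_succ, pow_mul, e0]
    linear_combination (0) * hx + (0) * hp
  have e2 : x ^ (2 ^ 2) = 1 * x ^ 4 := by
    rw [pow_succ, pow_mul, e1]
    linear_combination (0) * hx + (0) * hp
  have e3 : x ^ (2 ^ 3) = 1 + 1 * x ^ 2 + 1 * x ^ 3 := by
    rw [pow_succ, pow_mul, e2]
    linear_combination (1 + 1 * x ^ 3) * hx + ((-1) + (-1) * x ^ 2 + (-1) * x ^ 3 + (-1) * x ^ 5) * hp
  have e4 : x ^ (2 ^ 4) = 1 + 1 * x + 1 * x ^ 3 + 1 * x ^ 4 := by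
    rw [pow_succ, pow_mul, e3]
    linear_combination (1 * x) * hx + ((-1) * x + 1 * x ^ 2 + 1 * x ^ 5) * hp
  have e5 : x ^ (2 ^ 5) = x := by
    rw [pow_succ, pow_mul, e4]
    linear_combination (1 + 1 * x + 1 * x ^ 3) * hx + (2 * x ^ 4 + 1 * x ^ 7) * hp
  exact e5

theorem ext_2_5_sol (hp : (2 : K) = 0) (x : K) (hx : 1 + 1 * x ^ 2 + 1 * x ^ 5 = 0) : Sol K := by
  refine ⟨x, 1 * x ^ 3 + 1 * x ^ 4, 1 + 1 * x ^ 2 + 1 * x ^ 3 + 1 * x ^ 4, ?_, ?_⟩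
  · linear_combination (1 + 1 * x ^ 4) * hx + (1 * x + (-1) * x ^ 2 + 1 * x ^ 7 + 1 * x ^ 8) * hp
  · linear_combination (1) * hx + ((-2) * x ^ 2 + (-1) * x ^ 3 + 3 * x ^ 4 + (-2) * x ^ 5 + 1 * x ^ 6) * hp

theorem ext_2_5 [Fintype K] (hp : (2 : K) = 0) (n : ℕ) (hq : Fintype.card K = (2 ^ 5) ^ n) : Sol K := by
  obtain ⟨x, hx⟩ := root_exists (K := K) (1 + 1 * X ^ 2 + 1 * X ^ 5) 5 (by norm_num) (by compute_degree!) (2 ^ 5) n hq (by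
    intro A _ _ x hx
    apply ext_2_5_chain
    · have := congrArg (algebraMap K A) hp
      simpa only [map_ofNat, map_zero] using this
    · simpa [map_ofNat] using hx)
  apply ext_2_5_sol hp x
  simpa using hx

theorem ext_2_7_chain {A : Type*} [CommRing A] (hp : (2 : A) = 0) (x : A) (hx : 1 + 1 * x ^ 6 + 1 * x ^ 7 = 0) :
    x ^ (2 ^ 7) = x := by
  have e0 : x ^ (2 ^ 0) = x := by simp
  have e1 : x ^ (2 ^ 1) = 1 * x ^ 2 := by
    rw [pow_succ, pow_mul, e0]
    linear_combination (0) * hx + (0) * hp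
  have e2 : x ^ (2 ^ 2) = 1 * x ^ 4 := by
    rw [pow_succ, pow_mul, e1]
    linear_combination (0) * hx + (0) * hp
  have e3 : x ^ (2 ^ 3) = 1 + 1 * x + 1 * x ^ 6 := by
    rw [pow_succ, pow_mul, e2]
    linear_combination (1 + 1 * x) * hx + ((-1) + (-1) * x + (-1) * x ^ 6 + (-1) * x ^ 7) * hp
  have e4 : x ^ (2 ^ 4) = 1 * x + 1 * x ^ 3 + 1 * x ^ 4 + 1 * x ^ 5 + 1 * x ^ 6 := by
    rw [pow_succ, pow_mul, e3]
    linear_combination (1 + 1 * x + 1 * x ^ 2 + 1 * x ^ 3 + 1 * x ^ 4 + 1 * x ^ 5) * hx + ((-1) * x ^ 3 + (-1) * x ^ 4 + (-1) * x ^ 5 + (-1) * x ^ 8 + (-1) * x ^ 9 + (-1) * x ^ 10 + (-1) * x ^ 11) * hp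
  have e5 : x ^ (2 ^ 5) = 1 + 1 * x + 1 * x ^ 2 + 1 * x ^ 4 + 1 * x ^ 5 := by
    rw [pow_succ, pow_mul, e4]
    linear_combination (1 + 1 * x + 1 * x ^ 4 + 1 * x ^ 5) * hx + ((-1) + (-1) * x + 1 * x ^ 6 + 1 * x ^ 7 + 1 * x ^ 8 + 2 * x ^ 9 + 1 * x ^ 10) * hp
  have e6 : x ^ (2 ^ 6) = 1 + 1 * x ^ 3 + 1 * x ^ 4 := by
    rw [pow_succ, pow_mul, e5]
    linear_combination (1 * x ^ 2 + 1 * x ^ 3) * hx + (1 * x + 1 * x ^ 2 + 1 * x ^ 4 + 2 * x ^ 5 + 2 * x ^ 6 + 1 * x ^ 7) * hp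
  have e7 : x ^ (2 ^ 7) = x := by
    rw [pow_succ, pow_mul, e6]
    linear_combination (1 + 1 * x) * hx + ((-1) * x + 1 * x ^ 3 + 1 * x ^ 4) * hp
  exact e7

theorem ext_2_7_sol (hp : (2 : K) = 0) (x : K) (hx : 1 + 1 * x ^ 6 + 1 * x ^ 7 = 0) : Sol K := by
  refine ⟨x, 1 + 1 * x ^ 3, 1 + 1 * x ^ 2 + 1 * x ^ 3 + 1 * x ^ 6, ?_, ?_⟩
  · linear_combination (1 + 1 * x + 1 * x ^ 2 + 1 * x ^ 3) * hx + (1 * x + (-1) * x ^ 2 + 1 * x ^ 4 + (-1) * x ^ 8 + (-1) * x ^ 9) * hp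
  · linear_combination (1 + 1 * x ^ 4 + 1 * x ^ 5 + 1 * x ^ 6 + 1 * x ^ 7) * hx + ((-2) * x ^ 2 + 1 * x ^ 4 + (-2) * x ^ 5 + (-1) * x ^ 7 + (-1) * x ^ 9 + 1 * x ^ 10 + (-1) * x ^ 11 + (-1) * x ^ 12 + (-1) * x ^ 13) * hp

theorem ext_2_7 [Fintype K] (hp : (2 : K) = 0) (n : ℕ) (hq : Fintype.card K = (2 ^ 7) ^ n) : Sol K := by
  obtain ⟨x, hx⟩ := root_exists (K := K) (1 + 1 * X ^ 6 + 1 * X ^ 7) 7 (by norm_num) (by compute_degree!) (2 ^ 7) n hq (by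
    intro A _ _ x hx
    apply ext_2_7_chain
    · have := congrArg (algebraMap K A) hp
      simpa only [map_ofNat, map_zero] using this
    · simpa [map_ofNat] using hx)
  apply ext_2_7_sol hp x
  simpa using hx

theorem ext_2_11_chain {A : Type*} [CommRing A] (hp : (2 : A) = 0) (x : A) (hx : 1 + 1 * x ^ 7 + 1 * x ^ 9 + 1 * x ^ 10 + 1 * x ^ 11 = 0) :
    x ^ (2 ^ 11) = x := by
  have e0 : x ^ (2 ^ 0) = x := by simp
  have e1 : x ^ (2 ^ 1) = 1 * x ^ 2 := by
    rw [pow_succ, pow_mul, e0]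
    linear_combination (0) * hx + (0) * hp
  have e2 : x ^ (2 ^ 2) = 1 * x ^ 4 := by
    rw [pow_succ, pow_mul, e1]
    linear_combination (0) * hx + (0) * hp
  have e3 : x ^ (2 ^ 3) = 1 * x ^ 8 := by
    rw [pow_succ, pow_mul, e2]
    linear_combination (0) * hx + (0) * hp
  have e4 : x ^ (2 ^ 4) = 1 * x ^ 2 + 1 * x ^ 4 + 1 * x ^ 5 + 1 * x ^ 9 := by
    rw [pow_succ, pow_mul, e3]
    linear_combination (1 * x ^ 2 + 1 * x ^ 4 + 1 * x ^ 5) * hx + ((-1) * x ^ 2 + (-1) * x ^ 4 + (-1) * x ^ 5 + (-1) * x ^ 9 + (-1) * x ^ 11 + (-1) * x ^ 12 + (-1) * x ^ 13 + (-1) * x ^ 14 + (-1) * x ^ 15) * hp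
  have e5 : x ^ (2 ^ 5) = 1 + 1 * x ^ 6 + 1 * x ^ 8 + 1 * x ^ 9 := by
    rw [pow_succ, pow_mul, e4]
    linear_combination (1 + 1 * x ^ 4 + 1 * x ^ 6 + 1 * x ^ 7) * hx + ((-1) + (-1) * x ^ 15 + (-1) * x ^ 16 + (-1) * x ^ 17) * hp
  have e6 : x ^ (2 ^ 6) = 1 + 1 * x + 1 * x ^ 2 + 1 * x ^ 5 + 1 * x ^ 6 + 1 * x ^ 7 + 1 * x ^ 8 + 1 * x ^ 9 + 1 * x ^ 10 := by
    rw [pow_succ, pow_mul, e5]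
    linear_combination (1 * x + 1 * x ^ 2 + 1 * x ^ 5 + 1 * x ^ 6 + 1 * x ^ 7) * hx + ((-1) * x + (-1) * x ^ 2 + (-1) * x ^ 5 + (-1) * x ^ 7 + (-1) * x ^ 10 + (-1) * x ^ 11 + (-1) * x ^ 12 + (-1) * x ^ 13 + (-1) * x ^ 16) * hp
  have e7 : x ^ (2 ^ 7) = 1 * x ^ 3 + 1 * x ^ 4 + 1 * x ^ 5 + 1 * x ^ 8 + 1 * x ^ 9 + 1 * x ^ 10 := by
    rw [pow_succ, pow_mul, e6]
    linear_combination (1 + 1 * x ^ 2 + 1 * x ^ 3 + 1 * x ^ 5 + 1 * x ^ 7 + 1 * x ^ 8 + 1 * x ^ 9) * hx + (1 * x + 1 * x ^ 2 + 2 * x ^ 6 + 2 * x ^ 7 + 2 * x ^ 8 + 1 * x ^ 9 + 2 * x ^ 10 + 2 * x ^ 11 + 1 * x ^ 12 + 1 * x ^ 13 + 1 * x ^ 14 + 2 * x ^ 15 + 1 * x ^ 16 + 1 * x ^ 17) * hp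
  have e8 : x ^ (2 ^ 8) = 1 + 1 * x + 1 * x ^ 5 + 1 * x ^ 6 + 1 * x ^ 8 + 1 * x ^ 10 := by
    rw [pow_succ, pow_mul, e7]
    linear_combination (1 + 1 * x + 1 * x ^ 5 + 1 * x ^ 7 + 1 * x ^ 8 + 1 * x ^ 9) * hx + ((-1) + (-1) * x + (-1) * x ^ 5 + (-1) * x ^ 10 + 1 * x ^ 12 + 3 * x ^ 13 + 1 * x ^ 14 + (-1) * x ^ 16) * hp
  have e9 : x ^ (2 ^ 9) = 1 * x ^ 2 + 1 * x ^ 4 + 1 * x ^ 5 + 1 * x ^ 6 + 1 * x ^ 7 + 1 * x ^ 8 := by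
    rw [pow_succ, pow_mul, e8]
    linear_combination (1 + 1 * x ^ 4 + 1 * x ^ 5 + 1 * x ^ 6 + 1 * x ^ 8 + 1 * x ^ 9) * hx + (1 * x + (-1) * x ^ 4 + 1 * x ^ 6 + 1 * x ^ 10 + 1 * x ^ 11 + (-1) * x ^ 15 + (-1) * x ^ 17 + (-1) * x ^ 19) * hp
  have e10 : x ^ (2 ^ 10) = 1 * x + 1 * x ^ 3 + 1 * x ^ 5 + 1 * x ^ 10 := by
    rw [pow_succ, pow_mul, e9]
    linear_combination (1 * x + 1 * x ^ 3 + 1 * x ^ 4 + 1 * x ^ 5) * hx + ((-1) * x + (-1) * x ^ 3 + (-1) * x ^ 5 + 1 * x ^ 6 + 1 * x ^ 7 + 1 * x ^ 8 + 2 * x ^ 9 + 1 * x ^ 10 + 1 * x ^ 11 + 1 * x ^ 12 + 1 * x ^ 13) * hp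
  have e11 : x ^ (2 ^ 11) = x := by
    rw [pow_succ, pow_mul, e10]
    linear_combination (1 * x + 1 * x ^ 2 + 1 * x ^ 6 + 1 * x ^ 8 + 1 * x ^ 9) * hx + ((-1) * x + 1 * x ^ 4 + 1 * x ^ 6 + (-1) * x ^ 9 + (-1) * x ^ 12 + (-1) * x ^ 16 + (-1) * x ^ 17 + (-1) * x ^ 18 + (-1) * x ^ 19) * hp
  exact e11

theorem ext_2_11_sol (hp : (2 : K) = 0) (x : K) (hx : 1 + 1 * x ^ 7 + 1 * x ^ 9 + 1 * x ^ 10 + 1 * x ^ 11 = 0) : Sol K := by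
  refine ⟨x, 1 + 1 * x ^ 4 + 1 * x ^ 5 + 1 * x ^ 6 + 1 * x ^ 8 + 1 * x ^ 10, 1 + 1 * x ^ 2 + 1 * x ^ 4 + 1 * x ^ 5 + 1 * x ^ 6 + 1 * x ^ 7 + 1 * x ^ 9, ?_, ?_⟩
  · linear_combination (1 + 1 * x + 1 * x ^ 2 + 1 * x ^ 3 + 1 * x ^ 8 + 1 * x ^ 9) * hx + (1 * x + (-1) * x ^ 2 + 1 * x ^ 5 + 1 * x ^ 6 + 1 * x ^ 7 + 1 * x ^ 11 + 1 * x ^ 13 + 1 * x ^ 14 + 1 * x ^ 15 + 1 * x ^ 16 + (-1) * x ^ 19) * hp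
  · linear_combination (1 + 1 * x ^ 4 + 1 * x ^ 5 + 1 * x ^ 7 + 1 * x ^ 9 + 1 * x ^ 10 + 1 * x ^ 11) * hx + ((-2) * x ^ 2 + 1 * x ^ 4 + (-2) * x ^ 5 + 1 * x ^ 6 + (-1) * x ^ 7 + (-1) * x ^ 9 + (-2) * x ^ 10 + 1 * x ^ 11 + (-3) * x ^ 12 + 2 * x ^ 13 + (-3) * x ^ 14 + (-1) * x ^ 15 + (-1) * x ^ 16 + (-2) * x ^ 17 + (-3) * x ^ 19 + (-2) * x ^ 21) * hp

theorem ext_2_11 [Fintype K] (hp : (2 : K) = 0) (n : ℕ) (hq : Fintype.card K = (2 ^ 11) ^ n) : Sol K := by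
  obtain ⟨x, hx⟩ := root_exists (K := K) (1 + 1 * X ^ 7 + 1 * X ^ 9 + 1 * X ^ 10 + 1 * X ^ 11) 11 (by norm_num) (by compute_degree!) (2 ^ 11) n hq (by
    intro A _ _ x hx
    apply ext_2_11_chain
    · have := congrArg (algebraMap K A) hp
      simpa only [map_ofNat, map_zero] using this
    · simpa [map_ofNat] using hx)
  apply ext_2_11_sol hp x
  simpa using hx

theorem ext_3_2_chain {A : Type*} [CommRing A] (hp : (3 : A) = 0) (x : A) (hx : 2 + 1 * x + 1 * x ^ 2 = 0) :
    x ^ (3 ^ 2) = x := by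
  have e0 : x ^ (3 ^ 0) = x := by simp
  have e1 : x ^ (3 ^ 1) = 2 + 2 * x := by
    rw [pow_succ, pow_mul, e0]
    linear_combination (2 + 1 * x) * hx + ((-2) + (-2) * x + (-1) * x ^ 2) * hp
  have e2 : x ^ (3 ^ 2) = x := by
    rw [pow_succ, pow_mul, e1]
    linear_combination (1 + 2 * x) * hx + (2 + 6 * x + 7 * x ^ 2 + 2 * x ^ 3) * hp
  exact e2

theorem ext_3_2_sol (hp : (3 : K) = 0) (x : K) (hx : 2 + 1 * x + 1 * x ^ 2 = 0) : Sol K := by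
  refine ⟨x, 1 * x, 0, ?_, ?_⟩
  · linear_combination (2) * hx + ((-1) + (-1) * x ^ 2) * hp
  · linear_combination (2 + 2 * x + 2 * x ^ 2 + 1 * x ^ 3) * hx + ((-1) + (-2) * x + (-4) * x ^ 2 + (-2) * x ^ 3 + 1 * x ^ 4 + (-1) * x ^ 5) * hp

theorem ext_3_2 [Fintype K] (hp : (3 : K) = 0) (n : ℕ) (hq : Fintype.card K = (3 ^ 2) ^ n) : Sol K := by
  obtain ⟨x, hx⟩ := root_exists (K := K) (2 + 1 * X + 1 * X ^ 2) 2 (by norm_num) (by compute_degree!) (3 ^ 2) n hq (by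
    intro A _ _ x hx
    apply ext_3_2_chain
    · have := congrArg (algebraMap K A) hp
      simpa only [map_ofNat, map_zero] using this
    · simpa [map_ofNat] using hx)
  apply ext_3_2_sol hp x
  simpa using hx

theorem ext_3_3_chain {A : Type*} [CommRing A] (hp : (3 : A) = 0) (x : A) (hx : 1 + 2 * x ^ 2 + 1 * x ^ 3 = 0) :
    x ^ (3 ^ 3) = x := by
  have e0 : x ^ (3 ^ 0) = x := by simp
  have e1 : x ^ (3 ^ 1) = 2 + 1 * x ^ 2 := by
    rw [pow_succ, pow_mul, e0]
    linear_combination (1) * hx + ((-1) + (-1) * x ^ 2) * hp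
  have e2 : x ^ (3 ^ 2) = 2 + 2 * x + 2 * x ^ 2 := by
    rw [pow_succ, pow_mul, e1]
    linear_combination (1 * x + 1 * x ^ 2 + 1 * x ^ 3) * hx + (2 + (-1) * x + 3 * x ^ 2 + (-1) * x ^ 3 + 1 * x ^ 4 + (-1) * x ^ 5) * hp
  have e3 : x ^ (3 ^ 3) = x := by
    rw [pow_succ, pow_mul, e2]
    linear_combination (2 + 2 * x + 2 * x ^ 2 + 2 * x ^ 3) * hx + (2 + 7 * x + 14 * x ^ 2 + 16 * x ^ 3 + 14 * x ^ 4 + 6 * x ^ 5 + 2 * x ^ 6) * hp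
  exact e3

theorem ext_3_3_sol (hp : (3 : K) = 0) (x : K) (hx : 1 + 2 * x ^ 2 + 1 * x ^ 3 = 0) : Sol K := by
  refine ⟨x, 1 + 1 * x + 1 * x ^ 2, 2 + 1 * x, ?_, ?_⟩
  · linear_combination (1 + 1 * x) * hx + (1 * x) * hp
  · linear_combination (1 + 1 * x ^ 2) * hx + ((-2) * x ^ 2 + (-1) * x ^ 3) * hp

theorem ext_3_3 [Fintype K] (hp : (3 : K) = 0) (n : ℕ) (hq : Fintype.card K = (3 ^ 3) ^ n) : Sol K := by
  obtain ⟨x, hx⟩ := root_exists (K := K) (1 + 2 * X ^ 2 + 1 * X ^ 3) 3 (by norm_num) (by compute_degree!) (3 ^ 3) n hq (by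
    intro A _ _ x hx
    apply ext_3_3_chain
    · have := congrArg (algebraMap K A) hp
      simpa only [map_ofNat, map_zero] using this
    · simpa [map_ofNat] using hx)
  apply ext_3_3_sol hp x
  simpa using hx

theorem ext_3_5_chain {A : Type*} [CommRing A] (hp : (3 : A) = 0) (x : A) (hx : 1 + 2 * x ^ 3 + 1 * x ^ 4 + 1 * x ^ 5 = 0) :
    x ^ (3 ^ 5) = x := by
  have e0 : x ^ (3 ^ 0) = x := by simp
  have e1 : x ^ (3 ^ 1) = 1 * x ^ 3 := by
    rw [pow_succ, pow_mul, e0]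
    linear_combination (0) * hx + (0) * hp
  have e2 : x ^ (3 ^ 2) = 1 + 1 * x ^ 2 := by
    rw [pow_succ, pow_mul, e1]
    linear_combination (2 + 2 * x ^ 2 + 2 * x ^ 3 + 1 * x ^ 4) * hx + ((-1) + (-1) * x ^ 2 + (-2) * x ^ 3 + (-1) * x ^ 4 + (-2) * x ^ 5 + (-2) * x ^ 6 + (-2) * x ^ 7 + (-1) * x ^ 8) * hp
  have e3 : x ^ (3 ^ 3) = 2 + 2 * x + 2 * x ^ 3 + 2 * x ^ 4 := by
    rw [pow_succ, pow_mul, e2]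
    linear_combination (2 + 1 * x) * hx + ((-1) + (-1) * x + 1 * x ^ 2 + (-2) * x ^ 3 + (-1) * x ^ 4 + (-1) * x ^ 5) * hp
  have e4 : x ^ (3 ^ 4) = 2 + 2 * x ^ 2 + 1 * x ^ 4 := by
    rw [pow_succ, pow_mul, e3]
    linear_combination (1 * x ^ 2 + 2 * x ^ 3 + 2 * x ^ 4 + 1 * x ^ 5 + 1 * x ^ 6 + 2 * x ^ 7) * hx + (2 + 8 * x + 7 * x ^ 2 + 10 * x ^ 3 + 23 * x ^ 4 + 23 * x ^ 5 + 14 * x ^ 6 + 21 * x ^ 7 + 22 * x ^ 8 + 9 * x ^ 9 + 6 * x ^ 10 + 7 * x ^ 11 + 2 * x ^ 12) * hp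
  have e5 : x ^ (3 ^ 5) = x := by
    rw [pow_succ, pow_mul, e4]
    linear_combination (2 + 2 * x + 2 * x ^ 3 + 2 * x ^ 5 + 2 * x ^ 6 + 1 * x ^ 7) * hx + (2 + (-1) * x + 8 * x ^ 2 + (-2) * x ^ 3 + 10 * x ^ 4 + (-2) * x ^ 5 + 8 * x ^ 6 + (-1) * x ^ 7 + 4 * x ^ 8 + (-2) * x ^ 9 + (-1) * x ^ 11) * hp
  exact e5

theorem ext_3_5_sol (hp : (3 : K) = 0) (x : K) (hx : 1 + 2 * x ^ 3 + 1 * x ^ 4 + 1 * x ^ 5 = 0) : Sol K := by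
  refine ⟨x, 2 * x + 1 * x ^ 2 + 2 * x ^ 3 + 2 * x ^ 4, 2 + 2 * x + 2 * x ^ 3 + 2 * x ^ 4, ?_, ?_⟩
  · linear_combination (1 + 2 * x + 1 * x ^ 3 + 1 * x ^ 4) * hx + (1 * x ^ 2 + 1 * x ^ 3 + 3 * x ^ 5 + 2 * x ^ 6 + 1 * x ^ 7 + 2 * x ^ 8 + 1 * x ^ 9) * hp
  · linear_combination (1) * hx + ((-2) * x ^ 3) * hp

theorem ext_3_5 [Fintype K] (hp : (3 : K) = 0) (n : ℕ) (hq : Fintype.card K = (3 ^ 5) ^ n) : Sol K := by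
  obtain ⟨x, hx⟩ := root_exists (K := K) (1 + 2 * X ^ 3 + 1 * X ^ 4 + 1 * X ^ 5) 5 (by norm_num) (by compute_degree!) (3 ^ 5) n hq (by
    intro A _ _ x hx
    apply ext_3_5_chain
    · have := congrArg (algebraMap K A) hp
      simpa only [map_ofNat, map_zero] using this
    · simpa [map_ofNat] using hx)
  apply ext_3_5_sol hp x
  simpa using hx

theorem ext_3_7_chain {A : Type*} [CommRing A] (hp : (3 : A) = 0) (x : A) (hx : 1 + 1 * x ^ 4 + 1 * x ^ 6 + 1 * x ^ 7 = 0) :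
    x ^ (3 ^ 7) = x := by
  have e0 : x ^ (3 ^ 0) = x := by simp
  have e1 : x ^ (3 ^ 1) = 1 * x ^ 3 := by
    rw [pow_succ, pow_mul, e0]
    linear_combination (0) * hx + (0) * hp
  have e2 : x ^ (3 ^ 2) = 2 + 1 * x + 2 * x ^ 2 + 2 * x ^ 4 + 1 * x ^ 5 + 1 * x ^ 6 := by
    rw [pow_succ, pow_mul, e1]
    linear_combination (1 + 2 * x + 1 * x ^ 2) * hx + ((-1) + (-1) * x + (-1) * x ^ 2 + (-1) * x ^ 4 + (-1) * x ^ 5 + (-1) * x ^ 6 + (-1) * x ^ 7 + (-1) * x ^ 8) * hp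
  have e3 : x ^ (3 ^ 3) = 2 + 2 * x ^ 2 + 1 * x ^ 6 := by
    rw [pow_succ, pow_mul, e2]
    linear_combination (1 * x ^ 2 + 1 * x ^ 3 + 2 * x ^ 7 + 2 * x ^ 8 + 1 * x ^ 9 + 2 * x ^ 10 + 1 * x ^ 11) * hx + (2 + 4 * x + 9 * x ^ 2 + 8 * x ^ 3 + 18 * x ^ 4 + 16 * x ^ 5 + 28 * x ^ 6 + 20 * x ^ 7 + 28 * x ^ 8 + 19 * x ^ 9 + 25 * x ^ 10 + 16 * x ^ 11 + 16 * x ^ 12 + 8 * x ^ 13 + 6 * x ^ 14 + 3 * x ^ 15 + 2 * x ^ 16) * hp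
  have e4 : x ^ (3 ^ 4) = 2 * x + 1 * x ^ 2 + 2 * x ^ 4 + 2 * x ^ 5 + 2 * x ^ 6 := by
    rw [pow_succ, pow_mul, e3]
    linear_combination (2 + 1 * x + 2 * x ^ 2 + 2 * x ^ 4 + 2 * x ^ 6 + 1 * x ^ 8 + 1 * x ^ 9 + 2 * x ^ 10 + 1 * x ^ 11) * hx + (2 + (-1) * x + 7 * x ^ 2 + 6 * x ^ 4 + (-1) * x ^ 5 + 4 * x ^ 6 + (-1) * x ^ 7 + 6 * x ^ 8 + (-1) * x ^ 9 + 2 * x ^ 10 + (-1) * x ^ 11 + 1 * x ^ 12 + (-1) * x ^ 13 + 1 * x ^ 14 + (-1) * x ^ 15 + (-1) * x ^ 16 + (-1) * x ^ 17) * hp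
  have e5 : x ^ (3 ^ 5) = 1 + 2 * x ^ 3 + 2 * x ^ 4 + 2 * x ^ 5 + 2 * x ^ 6 := by
    rw [pow_succ, pow_mul, e4]
    linear_combination (2 + 2 * x ^ 4 + 1 * x ^ 5 + 1 * x ^ 7 + 1 * x ^ 8 + 2 * x ^ 9 + 1 * x ^ 10 + 2 * x ^ 11) * hx + ((-1) + 2 * x ^ 3 + 2 * x ^ 4 + 1 * x ^ 5 + 7 * x ^ 6 + 15 * x ^ 7 + 17 * x ^ 8 + 17 * x ^ 9 + 21 * x ^ 10 + 30 * x ^ 11 + 30 * x ^ 12 + 23 * x ^ 13 + 19 * x ^ 14 + 17 * x ^ 15 + 15 * x ^ 16 + 7 * x ^ 17 + 2 * x ^ 18) * hp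
  have e6 : x ^ (3 ^ 6) = 2 * x + 1 * x ^ 2 + 1 * x ^ 5 := by
    rw [pow_succ, pow_mul, e5]
    linear_combination (1 + 1 * x + 2 * x ^ 2 + 2 * x ^ 4 + 1 * x ^ 5 + 1 * x ^ 7 + 1 * x ^ 8 + 2 * x ^ 9 + 1 * x ^ 10 + 2 * x ^ 11) * hx + ((-1) * x + (-1) * x ^ 2 + 2 * x ^ 3 + 1 * x ^ 4 + 1 * x ^ 5 + 5 * x ^ 6 + 7 * x ^ 7 + 10 * x ^ 8 + 17 * x ^ 9 + 19 * x ^ 10 + 22 * x ^ 11 + 30 * x ^ 12 + 31 * x ^ 13 + 31 * x ^ 14 + 25 * x ^ 15 + 15 * x ^ 16 + 7 * x ^ 17 + 2 * x ^ 18) * hp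
  have e7 : x ^ (3 ^ 7) = x := by
    rw [pow_succ, pow_mul, e6]
    linear_combination (2 * x + 2 * x ^ 3 + 1 * x ^ 5 + 1 * x ^ 6 + 2 * x ^ 7 + 1 * x ^ 8) * hx + ((-1) * x + 2 * x ^ 3 + 4 * x ^ 4 + 1 * x ^ 5 + 2 * x ^ 7 + 3 * x ^ 8 + (-1) * x ^ 10 + 1 * x ^ 11 + (-1) * x ^ 13 + (-1) * x ^ 14) * hp
  exact e7

theorem ext_3_7_sol (hp : (3 : K) = 0) (x : K) (hx : 1 + 1 * x ^ 4 + 1 * x ^ 6 + 1 * x ^ 7 = 0) : Sol K := by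
  refine ⟨x, 2 * x + 1 * x ^ 2 + 2 * x ^ 4, 1 + 2 * x + 2 * x ^ 4 + 2 * x ^ 6, ?_, ?_⟩
  · linear_combination (1 + 2 * x + 1 * x ^ 2 + 2 * x ^ 3 + 1 * x ^ 4) * hx + (1 * x ^ 3 + 2 * x ^ 6 + (-1) * x ^ 7 + 1 * x ^ 9 + (-1) * x ^ 10 + 1 * x ^ 11) * hp
  · linear_combination (1 + 1 * x ^ 3 + 1 * x ^ 4 + 1 * x ^ 5 + 2 * x ^ 6 + 1 * x ^ 7) * hx + ((-1) * x ^ 2 + (-1) * x ^ 3 + (-1) * x ^ 6 + (-1) * x ^ 7 + 1 * x ^ 8 + (-2) * x ^ 9 + (-2) * x ^ 10 + (-1) * x ^ 11 + (-1) * x ^ 12 + (-1) * x ^ 13 + 1 * x ^ 14) * hp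

theorem ext_3_7 [Fintype K] (hp : (3 : K) = 0) (n : ℕ) (hq : Fintype.card K = (3 ^ 7) ^ n) : Sol K := by
  obtain ⟨x, hx⟩ := root_exists (K := K) (1 + 1 * X ^ 4 + 1 * X ^ 6 + 1 * X ^ 7) 7 (by norm_num) (by compute_degree!) (3 ^ 7) n hq (by
    intro A _ _ x hx
    apply ext_3_7_chain
    · have := congrArg (algebraMap K A) hp
      simpa only [map_ofNat, map_zero] using this
    · simpa [map_ofNat] using hx)
  apply ext_3_7_sol hp x
  simpa using hx

/-- witness check modulo p -/
def okW (e : ℕ × ℕ × ℕ × ℕ) : Bool :=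
  match e with
  | (p, t, b, c) =>
    Nat.ble c p && Nat.ble 2 p && Nat.beq ((t * b * c + 2 * t + 1) % p) (t ^ 2 % p) &&
      Nat.beq ((t ^ 2 * (b + t + (p - c) + (p - 2)) ^ 2 + 1 + 4 * t ^ 2 * (b + t + (p - c) + (p - 2))) % p)
        (t ^ 4 * (b + t + (p - c) + (p - 2)) % p)

theorem sol_of_okW (p t b c : ℕ) [CharP K p] (h : okW (p, t, b, c) = true) : Sol K := by
  simp only [okW, Bool.and_eq_true, Nat.ble_eq, Nat.beq_eq] at h
  obtain ⟨⟨⟨hc, h2⟩, h3⟩, h4⟩ := h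
  rw [← CharP.cast_eq_iff_mod_eq K p] at h3 h4
  push_cast [Nat.cast_sub hc, Nat.cast_sub h2] at h3 h4
  have hp : (p : K) = 0 := CharP.cast_eq_zero K p
  rw [hp] at h4
  refine ⟨t, b, c, ?_, ?_⟩
  · linear_combination h3
  · linear_combination h4

/-- quick compositeness check, complete below 5041 -/
def compW (p : ℕ) : Bool :=
  (Nat.ble 4 p && !(Nat.beq (Nat.gcd p 6) 1)) || (Nat.ble 8 p && !(Nat.beq (Nat.gcd p 210) 1)) ||
    (Nat.ble 68 p && !(Nat.beq (Nat.gcd p 7858321551080267055879090) 1))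

theorem compW_spec (p : ℕ) (h : compW p = true) : ¬ p.Prime := by
  intro hp
  simp only [compW, Bool.or_eq_true, Bool.and_eq_true, Nat.ble_eq, Bool.not_eq_true', ← Bool.not_eq_true, Nat.beq_eq] at h
  have key2 : ∀ (l : List ℕ) (m : ℕ), (∀ x ∈ l, x ≤ m ∧ x.Prime) → ¬ Nat.gcd p l.prod = 1 → p ≤ m := by
    intro l m hl hg
    have hd : p ∣ l.prod := by
      by_contra hd
      exact hg ((Nat.Prime.coprime_iff_not_dvd hp).2 hd)
    obtain ⟨a, ha, hpa⟩ := (Nat.Prime.prime hp).dvd_prod_iff.1 hd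
    have := hl a ha
    rw [(Nat.prime_dvd_prime_iff_eq hp this.2).1 hpa]
    exact this.1
  rcases h with (⟨h1, h2⟩ | ⟨h1, h2⟩) | ⟨h1, h2⟩
  · have := key2 [2, 3] 3 (by norm_num) (by norm_num; exact h2)
    omega
  · have := key2 [2, 3, 5, 7] 7 (by norm_num) (by norm_num; exact h2)
    omega
  · have := key2 [2, 3, 5, 7, 11, 13, 17, 19, 23, 29, 31, 37, 41, 43, 47, 53, 59, 61, 67] 67 (by norm_num) (by norm_num; exact h2)
    omega

def gapW (p : ℕ) : ℕ → Bool
  | 0 => true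
  | d + 1 => (Nat.beq d 0 || compW (p + d)) && gapW p d

theorem gapW_spec (p : ℕ) (d : ℕ) (h : gapW p d = true) (i : ℕ) (hi : i < d) (h0 : i ≠ 0) : ¬ (p + i).Prime := by
  induction d with
  | zero => omega
  | succ d ih =>
    simp only [gapW, Bool.and_eq_true, Bool.or_eq_true, Nat.beq_eq] at h
    by_cases hid : i = d
    · subst hid
      exact compW_spec _ (h.1.resolve_left h0)
    · exact ih h.2 (by omega)

def walkW : ℕ × ℕ × ℕ × ℕ → List (ℕ × ℕ × ℕ × ℕ) → Bool
  | e, [] => okW e && Nat.ble 5000 e.1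
  | e, e' :: l => okW e && (gapW e.1 (e'.1 - e.1) && walkW e' l)

theorem walkW_spec (l : List (ℕ × ℕ × ℕ × ℕ)) : ∀ (e : ℕ × ℕ × ℕ × ℕ), walkW e l = true →
    ∀ p, e.1 ≤ p → p < 5000 → p.Prime → ∃ t b c, okW (p, t, b, c) = true := by
  induction l with
  | nil =>
    intro e h p h1 h2 hp
    simp only [walkW, Bool.and_eq_true, Nat.ble_eq] at h
    omega
  | cons e' l ih =>
    intro e h p h1 h2 hp
    simp only [walkW, Bool.and_eq_true] at h
    obtain ⟨ho, hg, hw⟩ := h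
    by_cases hlt : e'.1 ≤ p
    · exact ih e' hw p hlt h2 hp
    · by_cases he : p = e.1
      · subst he
        exact ⟨e.2.1, e.2.2.1, e.2.2.2, ho⟩
      · have := gapW_spec _ _ hg (p - e.1) (by omega) (by omega)
        rw [Nat.add_sub_cancel' h1] at this
        exact absurd hp this

def tableW : List (ℕ × ℕ × ℕ × ℕ) := [
  (7, 3, 5, 2), (11, 1, 1, 9), (13, 2, 4, 8), (17, 2, 4, 2), (19, 1, 4, 9), (23, 4, 2, 21),
  (29, 1, 3, 9), (31, 3, 19, 12), (37, 2, 6, 3), (41, 1, 17, 24), (43, 3, 1, 15), (47, 6, 21, 11),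
  (53, 2, 15, 30), (59, 1, 29, 4), (61, 2, 11, 36), (67, 5, 43, 1), (71, 1, 25, 34), (73, 2, 23, 46),
  (79, 1, 52, 3), (83, 4, 3, 49), (89, 1, 28, 19), (97, 2, 22, 11), (101, 1, 37, 60), (103, 3, 71, 15),
  (107, 4, 1, 82), (109, 1, 48, 59), (113, 2, 15, 64), (127, 3, 62, 56), (131, 1, 29, 18), (137, 2, 37, 87),
  (139, 1, 19, 95), (149, 1, 10, 119), (151, 1, 49, 77), (157, 2, 28, 14), (163, 3, 15, 58),
  (167, 3, 5, 156), (173, 2, 80, 40), (179, 1, 38, 113), (181, 1, 67, 54), (191, 1, 106, 18),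
  (193, 2, 56, 112), (197, 2, 14, 7), (199, 1, 19, 157), (211, 1, 42, 10), (223, 5, 46, 2), (227, 3, 70, 80),
  (229, 1, 22, 104), (233, 2, 72, 144), (239, 1, 110, 126), (241, 1, 85, 34), (251, 4, 168, 34),
  (257, 2, 16, 8), (263, 3, 30, 76), (269, 1, 22, 220), (271, 1, 97, 81), (277, 2, 60, 30), (281, 1, 23, 61),
  (283, 4, 159, 85), (293, 2, 138, 69), (307, 5, 165, 83), (311, 1, 108, 167), (313, 2, 25, 169),
  (317, 2, 114, 57), (331, 1, 262, 48), (337, 2, 148, 74), (347, 7, 179, 82), (349, 2, 136, 68),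
  (353, 2, 42, 21), (359, 1, 28, 282), (367, 4, 264, 8), (373, 2, 104, 52), (379, 5, 75, 186),
  (383, 4, 99, 30), (389, 2, 115, 252), (397, 2, 63, 230), (401, 2, 20, 10), (409, 1, 241, 112),
  (419, 4, 21, 35), (421, 1, 342, 32), (431, 4, 28, 27), (433, 2, 127, 254), (439, 1, 376, 7),
  (443, 3, 115, 226), (449, 2, 67, 258), (457, 2, 109, 283), (461, 2, 48, 24), (463, 6, 147, 10),
  (467, 3, 76, 127), (479, 1, 333, 105), (487, 3, 293, 82), (491, 3, 350, 130), (499, 1, 257, 33),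
  (503, 6, 49, 255), (509, 1, 84, 206), (521, 1, 12, 434), (523, 4, 22, 113), (541, 1, 67, 436),
  (547, 5, 7, 438), (557, 2, 118, 59), (563, 3, 257, 157), (569, 1, 13, 350), (571, 1, 40, 314),
  (577, 2, 24, 12), (587, 8, 57, 385), (593, 2, 77, 335), (599, 1, 277, 253), (601, 1, 101, 238),
  (607, 8, 53, 285), (613, 2, 35, 324), (617, 2, 194, 97), (619, 4, 233, 2), (631, 4, 397, 211),
  (641, 1, 327, 49), (643, 3, 225, 201), (647, 3, 35, 456), (653, 2, 149, 401), (659, 1, 131, 332),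
  (661, 1, 122, 65), (673, 2, 58, 29), (677, 2, 26, 13), (683, 7, 57, 351), (691, 1, 65, 287),
  (701, 1, 345, 319), (709, 1, 262, 92), (719, 1, 92, 422), (727, 3, 110, 141), (733, 2, 190, 380),
  (739, 6, 137, 303), (743, 3, 260, 482), (751, 1, 222, 433), (757, 2, 87, 422), (761, 1, 117, 26),
  (769, 2, 62, 31), (773, 2, 228, 456), (787, 8, 239, 538), (797, 2, 215, 506), (809, 1, 85, 552),
  (811, 3, 176, 384), (821, 2, 263, 526), (823, 5, 447, 218), (827, 3, 594, 168), (829, 2, 246, 123),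
  (839, 1, 5, 503), (853, 2, 260, 520), (857, 2, 207, 532), (859, 1, 126, 709), (863, 5, 628, 94),
  (877, 2, 151, 514), (881, 1, 487, 161), (883, 3, 47, 119), (887, 6, 759, 112), (907, 4, 319, 440),
  (911, 1, 191, 124), (919, 1, 527, 211), (929, 1, 201, 171), (937, 2, 196, 98), (941, 1, 235, 8),
  (947, 3, 102, 359), (953, 2, 442, 221), (967, 6, 380, 573), (971, 1, 809, 12), (977, 2, 252, 126),
  (983, 3, 41, 16), (991, 1, 477, 509), (997, 2, 161, 579), (1009, 2, 270, 540), (1013, 2, 45, 529),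
  (1019, 1, 83, 577), (1021, 1, 498, 41), (1031, 1, 457, 564), (1033, 2, 339, 678), (1039, 1, 114, 401),
  (1049, 1, 777, 54), (1051, 1, 113, 186), (1061, 2, 103, 582), (1063, 3, 6, 945), (1069, 1, 433, 158),
  (1087, 8, 60, 179), (1091, 1, 366, 155), (1093, 2, 530, 265), (1097, 2, 341, 719), (1103, 9, 266, 59),
  (1109, 1, 718, 312), (1117, 2, 214, 107), (1123, 4, 36, 273), (1129, 1, 120, 922), (1151, 1, 40, 633),
  (1153, 2, 140, 70), (1163, 3, 507, 13), (1171, 3, 716, 169), (1181, 2, 243, 712), (1187, 4, 186, 911),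
  (1193, 2, 186, 93), (1201, 1, 404, 327), (1213, 2, 359, 718), (1217, 2, 78, 39), (1223, 3, 391, 587),
  (1229, 2, 316, 632), (1231, 9, 52, 58), (1237, 2, 546, 273), (1249, 1, 690, 286), (1259, 1, 413, 378),
  (1277, 2, 113, 695), (1279, 4, 925, 196), (1283, 3, 240, 474), (1289, 2, 405, 810), (1291, 1, 771, 144),
  (1297, 2, 36, 18), (1301, 1, 1060, 27), (1303, 7, 259, 695), (1307, 4, 553, 699), (1319, 1, 662, 263),
  (1321, 2, 257, 789), (1327, 3, 47, 320), (1361, 2, 614, 307), (1367, 3, 88, 756), (1373, 2, 668, 334),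
  (1381, 1, 44, 816), (1399, 1, 616, 377), (1409, 1, 30, 1315), (1423, 5, 151, 720), (1427, 3, 899, 409),
  (1429, 1, 327, 874), (1433, 2, 542, 271), (1439, 1, 51, 790), (1447, 4, 1417, 12), (1451, 3, 374, 344),
  (1453, 2, 478, 956), (1459, 1, 20, 1313), (1471, 4, 523, 289), (1481, 1, 368, 330), (1483, 3, 178, 511),
  (1487, 5, 161, 375), (1489, 1, 960, 152), (1493, 2, 432, 216), (1499, 8, 513, 942), (1511, 1, 9, 1175),
  (1523, 5, 542, 698), (1531, 1, 717, 805), (1543, 5, 174, 1316), (1549, 1, 133, 1153), (1553, 2, 339, 946),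
  (1559, 1, 288, 249), (1567, 3, 318, 795), (1571, 1, 1076, 73), (1579, 1, 24, 921), (1583, 3, 697, 617),
  (1597, 2, 610, 305), (1601, 2, 40, 20), (1607, 5, 829, 290), (1609, 1, 231, 1205), (1613, 2, 127, 870),
  (1619, 1, 916, 152), (1621, 1, 716, 892), (1627, 9, 781, 353), (1637, 2, 316, 158), (1657, 2, 437, 874),
  (1663, 4, 300, 431), (1667, 3, 701, 130), (1669, 1, 450, 586), (1693, 2, 92, 46), (1697, 2, 414, 207),
  (1699, 3, 208, 550), (1709, 1, 426, 1027), (1721, 2, 473, 1097), (1723, 3, 599, 326), (1733, 2, 410, 205),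
  (1741, 1, 835, 515), (1747, 4, 759, 904), (1753, 2, 520, 1040), (1759, 3, 154, 929), (1777, 2, 501, 1002),
  (1783, 7, 374, 741), (1787, 7, 1151, 521), (1789, 1, 285, 521), (1801, 1, 222, 649), (1811, 1, 476, 662),
  (1823, 3, 309, 647), (1831, 1, 1254, 476), (1847, 6, 18, 804), (1861, 2, 61, 961), (1867, 3, 615, 1188),
  (1871, 1, 426, 1098), (1873, 2, 568, 1136), (1877, 2, 137, 1007), (1879, 1, 565, 143),
  (1889, 1, 183, 1249), (1901, 1, 782, 880), (1907, 4, 425, 1345), (1913, 2, 712, 356), (1931, 1, 372, 1360),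
  (1933, 2, 598, 299), (1949, 1, 812, 24), (1951, 1, 656, 803), (1973, 2, 259, 1116), (1979, 1, 864, 820),
  (1987, 6, 276, 138), (1993, 2, 834, 417), (1997, 2, 412, 206), (1999, 1, 439, 1489), (2003, 6, 878, 27),
  (2011, 1, 961, 226), (2017, 2, 229, 1123), (2027, 3, 129, 749), (2029, 1, 86, 1274), (2039, 1, 1509, 277),
  (2053, 2, 244, 122), (2063, 8, 992, 607), (2069, 1, 333, 379), (2081, 2, 102, 51), (2083, 3, 1185, 150),
  (2087, 4, 497, 801), (2089, 1, 14, 1492), (2099, 1, 295, 1729), (2111, 1, 356, 1435), (2113, 2, 65, 1089),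
  (2129, 1, 149, 1486), (2131, 5, 180, 251), (2137, 2, 296, 148), (2141, 1, 1134, 472), (2143, 5, 136, 1456),
  (2153, 2, 232, 116), (2161, 1, 423, 470), (2179, 1, 17, 1538), (2203, 3, 2016, 161), (2207, 5, 38, 93),
  (2213, 2, 565, 1130), (2221, 1, 1181, 252), (2237, 2, 608, 1216), (2239, 5, 1011, 520),
  (2243, 5, 402, 1107), (2251, 1, 787, 532), (2267, 3, 1097, 766), (2269, 1, 455, 1511), (2273, 2, 290, 145),
  (2281, 1, 395, 820), (2287, 3, 640, 1184), (2293, 2, 600, 300), (2297, 2, 365, 1331), (2309, 1, 1475, 670),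
  (2311, 1, 140, 33), (2333, 2, 108, 54), (2339, 6, 1783, 312), (2341, 2, 153, 1247), (2347, 6, 129, 185),
  (2351, 1, 326, 375), (2357, 2, 633, 1495), (2371, 1, 787, 949), (2377, 2, 1134, 567), (2381, 1, 2033, 260),
  (2383, 6, 903, 11), (2389, 1, 1500, 825), (2393, 2, 711, 1422), (2399, 1, 340, 127), (2411, 4, 1811, 439),
  (2417, 2, 592, 296), (2423, 7, 647, 405), (2437, 2, 398, 199), (2441, 1, 496, 876), (2447, 3, 302, 605),
  (2459, 1, 1081, 207), (2467, 3, 1520, 343), (2473, 2, 567, 1520), (2477, 2, 781, 1562),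
  (2503, 6, 1354, 871), (2521, 1, 336, 15), (2531, 1, 1046, 934), (2539, 1, 318, 2028), (2543, 7, 244, 2278),
  (2549, 1, 1264, 1214), (2551, 3, 951, 1436), (2557, 2, 611, 1584), (2579, 3, 835, 697),
  (2591, 5, 43, 1398), (2593, 2, 918, 459), (2609, 1, 315, 1847), (2617, 2, 667, 1642), (2621, 1, 1458, 924),
  (2633, 2, 1224, 612), (2647, 3, 998, 1457), (2657, 2, 163, 1410), (2659, 1, 581, 1016),
  (2663, 3, 613, 976), (2671, 1, 1063, 495), (2677, 2, 550, 275), (2683, 3, 736, 1237), (2687, 4, 1534, 469),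
  (2689, 1, 231, 1490), (2693, 2, 859, 1776), (2699, 1, 643, 2019), (2707, 3, 887, 1530), (2711, 1, 759, 25),
  (2713, 2, 887, 1800), (2719, 1, 849, 1486), (2729, 1, 1301, 967), (2731, 1, 1005, 250),
  (2741, 1, 1480, 1189), (2749, 1, 1173, 764), (2753, 2, 794, 397), (2767, 4, 987, 731), (2777, 2, 190, 95),
  (2789, 2, 167, 1478), (2791, 1, 117, 2624), (2797, 2, 603, 1700), (2801, 1, 94, 2503), (2803, 5, 985, 391),
  (2819, 7, 285, 2210), (2833, 2, 738, 1476), (2837, 2, 416, 208), (2843, 3, 1893, 812),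
  (2851, 1, 2197, 279), (2857, 2, 896, 448), (2861, 2, 1202, 601), (2879, 1, 1819, 440), (2887, 6, 960, 617),
  (2897, 2, 1120, 560), (2903, 3, 1999, 152), (2909, 1, 7, 1662), (2917, 2, 54, 27), (2927, 3, 1007, 1121),
  (2939, 1, 335, 2088), (2953, 2, 1226, 613), (2957, 2, 1222, 611), (2963, 4, 1585, 136),
  (2969, 1, 617, 563), (2971, 1, 206, 1298), (2999, 1, 2244, 286), (3001, 2, 824, 1648), (3011, 1, 971, 676),
  (3019, 1, 744, 1615), (3023, 3, 49, 473), (3037, 2, 281, 1659), (3041, 1, 1358, 524), (3049, 1, 1807, 599),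
  (3061, 1, 630, 447), (3067, 5, 2501, 13), (3079, 1, 1322, 1267), (3083, 3, 757, 1420), (3089, 1, 1343, 46),
  (3109, 1, 1943, 16), (3119, 1, 2557, 111), (3121, 2, 79, 1600), (3137, 2, 56, 28), (3163, 3, 1456, 42),
  (3167, 3, 1032, 223), (3169, 1, 799, 1995), (3181, 1, 1131, 90), (3187, 12, 1633, 128),
  (3191, 1, 570, 627), (3203, 7, 1665, 645), (3209, 1, 1022, 1526), (3217, 2, 1436, 718),
  (3221, 2, 234, 117), (3229, 1, 386, 2794), (3251, 1, 1556, 1684), (3253, 2, 1598, 799),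
  (3257, 2, 291, 1774), (3259, 5, 315, 1405), (3271, 3, 1453, 1401), (3299, 1, 786, 596),
  (3301, 2, 1212, 606), (3307, 5, 1747, 764), (3313, 2, 407, 1860), (3319, 3, 744, 229),
  (3323, 4, 1327, 981), (3329, 1, 1750, 1499), (3331, 1, 1773, 1069), (3343, 3, 1639, 480),
  (3347, 10, 1240, 2063), (3359, 1, 2398, 748), (3361, 2, 900, 450), (3371, 1, 636, 53),
  (3373, 2, 1105, 2239), (3389, 1, 548, 235), (3391, 1, 2745, 21), (3407, 5, 1637, 251),
  (3413, 2, 971, 1942), (3433, 2, 891, 1782), (3449, 2, 1122, 561), (3457, 2, 708, 354),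
  (3461, 1, 291, 2902), (3463, 5, 964, 1424), (3467, 3, 1003, 2059), (3469, 2, 1003, 2236),
  (3491, 1, 1336, 2127), (3499, 1, 454, 1973), (3511, 1, 1471, 1339), (3517, 2, 596, 298),
  (3527, 9, 2624, 848), (3529, 1, 1668, 512), (3533, 2, 548, 274), (3539, 1, 1289, 1230),
  (3541, 1, 1585, 105), (3547, 3, 114, 726), (3557, 2, 943, 2250), (3559, 1, 489, 2460),
  (3571, 1, 240, 2708), (3581, 1, 691, 1819), (3583, 6, 958, 1463), (3593, 2, 1153, 2373),
  (3607, 3, 308, 2756), (3613, 2, 85, 1849), (3617, 2, 1234, 617), (3623, 3, 97, 3125),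
  (3631, 1, 1715, 1391), (3637, 2, 1027, 2332), (3643, 7, 2273, 1325), (3659, 5, 954, 2312),
  (3671, 1, 1314, 447), (3673, 2, 994, 497), (3677, 2, 1184, 2368), (3691, 4, 58, 2466),
  (3697, 2, 1131, 2414), (3701, 1, 133, 2894), (3709, 1, 385, 2341), (3719, 1, 2673, 64),
  (3727, 3, 1662, 1640), (3733, 2, 851, 2292), (3739, 11, 1086, 313), (3761, 1, 372, 1193),
  (3767, 6, 666, 33), (3769, 1, 151, 1248), (3779, 1, 2758, 285), (3793, 2, 803, 2298), (3797, 2, 742, 371),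
  (3803, 3, 530, 995), (3821, 1, 1998, 524), (3823, 4, 3351, 407), (3833, 2, 361, 2097),
  (3847, 6, 608, 2513), (3851, 1, 1651, 1922), (3853, 2, 1274, 2548), (3863, 4, 1169, 746),
  (3877, 2, 502, 251), (3881, 1, 561, 3037), (3889, 1, 1200, 2651), (3907, 3, 2099, 546),
  (3911, 9, 1770, 1313), (3917, 2, 835, 2376), (3919, 1, 531, 2561), (3923, 7, 839, 1191),
  (3929, 1, 1390, 701), (3931, 1, 1377, 511), (3943, 3, 1638, 735), (3947, 3, 1840, 1769),
  (3967, 4, 219, 3093), (3989, 1, 2395, 996), (4001, 1, 1170, 383), (4003, 3, 2557, 705),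
  (4007, 5, 1978, 927), (4013, 2, 1230, 615), (4019, 17, 2339, 150), (4021, 1, 350, 3010),
  (4027, 3, 115, 2673), (4049, 2, 884, 442), (4051, 1, 1405, 741), (4057, 2, 1100, 2200),
  (4073, 2, 549, 2311), (4079, 3, 1189, 239), (4091, 1, 2150, 137), (4093, 2, 1059, 2576),
  (4099, 4, 18, 3359), (4111, 1, 1661, 198), (4127, 4, 2211, 1392), (4129, 1, 677, 2342),
  (4133, 2, 733, 2433), (4139, 4, 2050, 902), (4153, 2, 1255, 2510), (4157, 2, 1198, 2396),
  (4159, 5, 2158, 1208), (4177, 2, 457, 2317), (4201, 1, 1274, 2361), (4211, 1, 196, 2793),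
  (4217, 2, 1153, 2306), (4219, 1, 2333, 689), (4229, 1, 1669, 2283), (4231, 1, 655, 239),
  (4241, 2, 1044, 522), (4243, 3, 519, 575), (4253, 2, 561, 2407), (4259, 1, 2193, 503),
  (4261, 1, 821, 1038), (4271, 1, 2110, 1340), (4273, 2, 1200, 600), (4283, 4, 3664, 64),
  (4289, 1, 1000, 935), (4297, 2, 1972, 986), (4327, 6, 2748, 153), (4337, 2, 886, 443),
  (4339, 1, 592, 3093), (4349, 1, 1613, 213), (4357, 2, 66, 33), (4363, 3, 2456, 1555), (4373, 2, 1904, 952),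
  (4391, 4, 429, 1891), (4397, 2, 505, 2451), (4409, 1, 1911, 1352), (4421, 1, 636, 570),
  (4423, 4, 1819, 2589), (4441, 1, 3225, 168), (4447, 8, 2005, 1763), (4451, 1, 2593, 1629),
  (4457, 2, 1880, 940), (4463, 3, 921, 2242), (4481, 1, 614, 3722), (4483, 3, 1445, 1878),
  (4493, 2, 1140, 2280), (4507, 3, 2597, 398), (4513, 2, 95, 2304), (4517, 2, 1474, 737),
  (4519, 3, 213, 1768), (4523, 3, 62, 2529), (4547, 3, 1156, 2992), (4549, 2, 1260, 630),
  (4561, 2, 1178, 2356), (4567, 5, 2790, 1394), (4583, 6, 323, 1076), (4591, 1, 1809, 1307),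
  (4597, 2, 1234, 2468), (4603, 3, 1460, 805), (4621, 1, 3100, 1434), (4637, 2, 2044, 1022),
  (4639, 1, 1778, 2463), (4643, 4, 1761, 2599), (4649, 1, 203, 3252), (4651, 1, 1939, 1787),
  (4657, 2, 1912, 956), (4663, 4, 4119, 105), (4673, 2, 1340, 2680), (4679, 1, 2418, 298),
  (4691, 1, 1834, 1903), (4703, 4, 1933, 1430), (4721, 1, 428, 728), (4723, 7, 2273, 911),
  (4729, 1, 398, 3018), (4733, 2, 897, 2815), (4751, 1, 2081, 121), (4759, 1, 1045, 674),
  (4783, 4, 1260, 2345), (4787, 5, 1646, 2942), (4789, 1, 1966, 190), (4793, 2, 1480, 740),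
  (4799, 1, 51, 2917), (4801, 2, 1403, 3102), (4813, 2, 1868, 934), (4817, 2, 1291, 3054),
  (4831, 1, 4001, 454), (4861, 2, 493, 2677), (4871, 3, 1147, 109), (4877, 2, 719, 2798),
  (4889, 2, 730, 365), (4903, 3, 933, 3612), (4909, 1, 2719, 1327), (4919, 1, 2353, 1963),
  (4931, 1, 607, 4208), (4933, 2, 1194, 597), (4937, 2, 849, 2893), (4943, 3, 1600, 2869),
  (4951, 1, 84, 2947), (4957, 2, 359, 2658), (4967, 6, 3310, 618), (4969, 1, 1509, 1439),
  (4973, 2, 223, 2598), (4987, 3, 2306, 297), (4993, 2, 158, 79), (4999, 1, 326, 92), (5003, 7, 1792, 138),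
  (5009, 1, 701, 393)]

set_option maxRecDepth 100000 in
theorem tableW_ok : walkW (5, 1, 3, 1) tableW = true := by
  decide +kernel

theorem sol_small_char (p : ℕ) (hp : p.Prime) (h5 : 5 ≤ p) (hlt : p < 5000) [CharP K p] : Sol K := by
  obtain ⟨t, b, c, h⟩ := walkW_spec _ _ tableW_ok p h5 hlt hp
  exact sol_of_okW p t b c h

theorem mat_of_eqs {F : Type*} [Field F] (t b c : F) (h1 : t * b * c = t^2 - 2*t - 1)
    (h2 : t^2 * (b - c + t - 2)^2 + 1 = t^2 * (b - c + t - 2) * (t^2 - 4)) :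
      let X : Matrix (Fin 2) (Fin 2) F := !![t, -1; 1, 0]
      let Y : Matrix (Fin 2) (Fin 2) F := !![1, b; c, 1 + b * c]
      X⁻¹ * Y * X⁻¹ * Y⁻¹ * X ^ 2 = Y * X⁻¹ * X⁻¹ * Y⁻¹ * X * Y⁻¹ := by
  intro X Y
  have hX : X⁻¹ = !![0, 1; -1, t] := by
    apply Matrix.inv_eq_right_inv
    simp [X, Matrix.one_fin_two]
  have hY : Y⁻¹ = !![1 + b * c, -b; -c, 1] := by
    apply Matrix.inv_eq_right_inv
    simp [Y, Matrix.one_fin_two]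
    constructor <;> ring
  rw [hX, hY]
  have h3 : (t - 2 - b * c) * t = 1 := by linear_combination -h1
  obtain ⟨i, hi⟩ : ∃ i, i = t - 2 - b * c := ⟨_, rfl⟩
  have h5 : (b - c + t - 2)^2 + i^2 = (b - c + t - 2) * (t^2 - 4) := by
    rw [← hi] at h3
    grind
  simp only [X, Y, pow_two]
  ext j k
  fin_cases j <;> fin_cases k <;> simp <;> grind

theorem sol_all (F : Type*) [Field F] [Fintype F]
    (h2 : Fintype.card F ≠ 2) (h3 : Fintype.card F ≠ 3) : Sol F := by
  obtain ⟨p, hchar⟩ := CharP.exists F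
  obtain ⟨⟨n, hn⟩, hp, hq⟩ := FiniteField.card F p
  simp only [PNat.mk_coe] at hq
  have hcast : (p : F) = 0 := CharP.cast_eq_zero F p
  have sub : ∀ d : ℕ, d ∣ n → ∃ e, Fintype.card F = (p ^ d) ^ e := by
    rintro d ⟨e, rfl⟩
    exact ⟨e, by rw [hq, pow_mul]⟩
  have hn1 : p = 2 ∨ p = 3 → 2 ≤ n := by
    intro h
    by_contra hlt
    have : n = 1 := by omega
    subst this
    rw [pow_one] at hq
    omega
  by_cases p2 : p = 2
  · subst p2
    have hn2 := hn1 (Or.inl rfl)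
    have hz : (2 : F) = 0 := by exact_mod_cast hcast
    by_cases hbig : 13 ≤ n
    · obtain ⟨c, rfl⟩ := Nat.exists_eq_add_of_le hbig
      refine char2_big (7 + c) (by omega) ?_
      rw [hq]
      congr 1
      omega
    · have H : ∀ m < 13, 2 ≤ m → 2 ∣ m ∨ 3 ∣ m ∨ 5 ∣ m ∨ 7 ∣ m ∨ 11 ∣ m := by decide
      have := H n (by omega) hn2
      rcases this with h | h | h | h | h <;> obtain ⟨e, he⟩ := sub _ h
      · exact ext_2_2 hz e he
      · exact ext_2_3 hz e he
      · exact ext_2_5 hz e he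
      · exact ext_2_7 hz e he
      · exact ext_2_11 hz e he
  have hodd : Odd (Fintype.card F) := by
    rw [hq]
    exact (hp.odd_of_ne_two p2).pow
  have hz2 : (2 : F) ≠ 0 := by
    intro h
    have : ((2 : ℕ) : F) = 0 := by exact_mod_cast h
    rw [CharP.cast_eq_zero_iff F p, Nat.prime_dvd_prime_iff_eq hp Nat.prime_two] at this
    exact p2 this
  obtain ⟨k, hk⟩ := hodd
  by_cases hbig : 5000 ≤ Fintype.card F
  · exact odd_big hz2 k hk hbig
  by_cases p3 : p = 3
  · subst p3
    have hn2 := hn1 (Or.inr rfl)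
    have hz : (3 : F) = 0 := by exact_mod_cast hcast
    have hn8 : n < 8 := by
      by_contra h8
      have : 3 ^ 8 ≤ 3 ^ n := Nat.pow_le_pow_right (by norm_num) (by omega)
      omega
    have H : ∀ m < 8, 2 ≤ m → 2 ∣ m ∨ 3 ∣ m ∨ 5 ∣ m ∨ 7 ∣ m := by decide
    have := H n hn8 hn2
    rcases this with h | h | h | h <;> obtain ⟨e, he⟩ := sub _ h
    · exact ext_3_2 hz e he
    · exact ext_3_3 hz e he
    · exact ext_3_5 hz e he
    · exact ext_3_7 hz e he
  have hp2 := hp.two_le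
  have p4 : p ≠ 4 := by rintro rfl; revert hp; norm_num
  refine sol_small_char p hp (by omega) ?_
  have : p ^ 1 ≤ p ^ n := Nat.pow_le_pow_right (by omega) hn
  rw [pow_one] at this
  omega

end Step

/-- For a finite field `F` with `#F ∉ {2,3}`, there exist `t, b, c ∈ F` such that the
matrices `X = x(t) = [[t,-1],[1,0]]` and `Y = y(b,c) = [[1,b],[c,1+bc]]` satisfy
`X⁻¹YX⁻¹Y⁻¹X² = YX⁻²Y⁻¹XY⁻¹`. -/
theorem exists_matrix_solution (F : Type*) [Field F] [Fintype F]
    (h2 : Fintype.card F ≠ 2) (h3 : Fintype.card F ≠ 3) :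
    ∃ t b c : F,
      let X : Matrix (Fin 2) (Fin 2) F := !![t, -1; 1, 0]
      let Y : Matrix (Fin 2) (Fin 2) F := !![1, b; c, 1 + b * c]
      X⁻¹ * Y * X⁻¹ * Y⁻¹ * X ^ 2 = Y * X⁻¹ * X⁻¹ * Y⁻¹ * X * Y⁻¹ := by
  obtain ⟨t, b, c, e1, e2⟩ := Step.sol_all F h2 h3
  exact ⟨t, b, c, Step.mat_of_eqs t b c e1 e2⟩
end

section
/- Let p be a prime and L an algebraically closed field of characteristic p. Then the ideal I ⊆ L[b,c,t] is a prime ideal. -/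
open MvPolynomial

noncomputable section

/-- The ideal `I ⊆ L[b,c,t]` generated by the four entries of
`X⁻¹YX⁻¹Y⁻¹X² − YX⁻²Y⁻¹XY⁻¹`, where `X = [[t,-1],[1,0]]`, `Y = [[1,b],[c,1+bc]]`,
with variables `b = X 0`, `c = X 1`, `t = X 2`. -/
def pslIdeal (L : Type*) [Field L] : Ideal (MvPolynomial (Fin 3) L) :=
  let b : MvPolynomial (Fin 3) L := X 0
  let c : MvPolynomial (Fin 3) L := X 1
  let t : MvPolynomial (Fin 3) L := X 2
  let A : Matrix (Fin 2) (Fin 2) (MvPolynomial (Fin 3) L) := !![t, -1; 1, 0]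
  let B : Matrix (Fin 2) (Fin 2) (MvPolynomial (Fin 3) L) := !![1, b; c, 1 + b * c]
  let Ai : Matrix (Fin 2) (Fin 2) (MvPolynomial (Fin 3) L) := !![0, 1; -1, t]
  let Bi : Matrix (Fin 2) (Fin 2) (MvPolynomial (Fin 3) L) := !![1 + b * c, -b; -c, 1]
  let M := Ai * B * Ai * Bi * A * A - B * Ai * Ai * Bi * A * Bi
  Ideal.span (Set.range fun p : Fin 2 × Fin 2 => M p.1 p.2)

set_option maxHeartbeats 4000000

namespace Polynomial

/-- A product `y (y + M)` has degree at least that of the monic `M`, unless it is zero. -/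
theorem no_small_product {L : Type*} [Field L] (y M S : L[X]) (m : ℕ)
    (hM : M.natDegree = m) (hS : S.natDegree < m) (hS0 : S ≠ 0) (h : y * (y + M) = S) : False := by
  have hy : y ≠ 0 := by rintro rfl; exact hS0 (by rw [← h, zero_mul])
  have hy' : y + M ≠ 0 := by intro h0; exact hS0 (by rw [← h, h0, mul_zero])
  have hd := natDegree_mul hy hy'
  rw [h] at hd
  have h1 : y.natDegree < M.natDegree := by omega
  have h2 := natDegree_add_eq_right_of_natDegree_lt h1
  omega

theorem no_root_r {L : Type*} [Field L] (r : L[X])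
    (h : r ^ 2 + (X ^ 3 - 2 * X ^ 2) * r + (-X ^ 5 + 3 * X ^ 4 - 4 * X ^ 2 + 1) = 0) : False := by
  refine no_small_product (r - (X ^ 2 - 2 * X)) (X ^ 3 - C 4 * X) (-1) 3 ?_ ?_ ?_ ?_
  · compute_degree!
  · compute_degree!
  · exact neg_ne_zero.mpr one_ne_zero
  · simp only [map_ofNat]
    linear_combination h

theorem no_root_z {L : Type*} [Field L] (z : L[X])
    (h : z ^ 2 - (-X ^ 5 + 3 * X ^ 4 - 4 * X ^ 2 + 1 + 4 * X * (X ^ 2 - 2 * X - 1)) * z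
      - ((X ^ 3 - 4 * X) ^ 2 - 4) * X * (X ^ 2 - 2 * X - 1) = 0) : False := by
  refine no_small_product (z - (X ^ 4 - 5 * X ^ 2 - X - 1))
    (X ^ 5 - C 1 * X ^ 4 - C 4 * X ^ 3 + C 2 * X ^ 2 + C 2 * X - C 3)
    (-(X ^ 4 + C 2 * X ^ 3 - C 8 * X ^ 2 - C 5 * X + C 2)) 5 ?_ ?_ ?_ ?_
  · compute_degree!
  · have : (-(X ^ 4 + C 2 * X ^ 3 - C 8 * X ^ 2 - C 5 * X + C 2) : L[X]).natDegree ≤ 4 := by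
      compute_degree!
    omega
  · intro h0
    have h4 : (X ^ 4 + C 2 * X ^ 3 - C 8 * X ^ 2 - C 5 * X + C 2 : L[X]).coeff 4 = 1 := by
      compute_degree!
    rw [neg_eq_zero.mp h0] at h4
    simp at h4
  · simp only [map_ofNat, map_one]
    linear_combination h

/-- The quadratic for `s` has no root in `L(t)`. -/
theorem no_root_s {L F : Type*} [Field L] [Field F] [Algebra L[X] F] [IsFractionRing L[X] F]
    (s t : F) (ht : t = algebraMap L[X] F X)
    (h : t ^ 2 * s ^ 2 + t ^ 2 * (t ^ 2 - 2 * t) * s + (-t ^ 5 + 3 * t ^ 4 - 4 * t ^ 2 + 1) = 0) :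
    False := by
  have hi : IsIntegral L[X] (t * s) := by
    refine ⟨X ^ 2 + C (X ^ 3 - 2 * X ^ 2) * X + C (-X ^ 5 + 3 * X ^ 4 - 4 * X ^ 2 + 1), ?_, ?_⟩
    · monicity!
    · simp only [eval₂_add, eval₂_mul, eval₂_pow, eval₂_X, eval₂_C]
      simp only [map_add, map_sub, map_mul, map_neg, map_pow, map_ofNat, map_one, ← ht]
      linear_combination h
  obtain ⟨r, hr⟩ := IsIntegrallyClosed.isIntegral_iff.mp hi
  apply no_root_r r
  apply IsFractionRing.injective L[X] F
  simp only [map_add, map_sub, map_mul, map_neg, map_pow, map_ofNat, map_one, map_zero, ← ht, hr]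
  linear_combination h

theorem no_root_w {L F : Type*} [Field L] [Field F] [Algebra L[X] F] [IsFractionRing L[X] F]
    (w t : F) (ht : t = algebraMap L[X] F X)
    (h : - ((t ^ 3 - 4 * t) ^ 2 - 4) * w ^ 2
      + (-t ^ 5 + 3 * t ^ 4 - 4 * t ^ 2 + 1 + 4 * t * (t ^ 2 - 2 * t - 1)) * w
      + t * (t ^ 2 - 2 * t - 1) = 0) :
    False := by
  have hi : IsIntegral L[X] (((t ^ 3 - 4 * t) ^ 2 - 4) * w) := by
    refine ⟨X ^ 2 + C (-(-X ^ 5 + 3 * X ^ 4 - 4 * X ^ 2 + 1 + 4 * X * (X ^ 2 - 2 * X - 1))) * X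
      + C (-(((X ^ 3 - 4 * X) ^ 2 - 4) * X * (X ^ 2 - 2 * X - 1))), ?_, ?_⟩
    · monicity!
    · simp only [eval₂_add, eval₂_mul, eval₂_pow, eval₂_X, eval₂_C]
      simp only [map_add, map_sub, map_mul, map_neg, map_pow, map_ofNat, map_one, ← ht]
      linear_combination (-((t ^ 3 - 4 * t) ^ 2 - 4)) * h
  obtain ⟨z, hz⟩ := IsIntegrallyClosed.isIntegral_iff.mp hi
  apply no_root_z z
  apply IsFractionRing.injective L[X] F
  simp only [map_add, map_sub, map_mul, map_neg, map_pow, map_ofNat, map_one, map_zero, ← ht, hz]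
  linear_combination (-((t ^ 3 - 4 * t) ^ 2 - 4)) * h

/-- No element `x + y s` of `L(t, s)` solves the quadratic for `b`. -/
theorem no_root_b {L F : Type*} [Field L] [Field F] [Algebra L[X] F] [IsFractionRing L[X] F]
    (x y t : F) (ht : t = algebraMap L[X] F X)
    (h1 : t ^ 2 * x ^ 2 - (y ^ 2 + y) * (-t ^ 5 + 3 * t ^ 4 - 4 * t ^ 2 + 1)
      - t * (t ^ 2 - 2 * t - 1) = 0)
    (h2 : (2 * y + 1) * x - (y ^ 2 + y) * (t ^ 2 - 2 * t) = 0) : False := by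
  apply no_root_w (y ^ 2 + y) t ht
  linear_combination (-(4 * (y ^ 2 + y) + 1)) * h1 +
    t ^ 2 * ((2 * y + 1) * x + (y ^ 2 + y) * (t ^ 2 - 2 * t)) * h2

/-- Linear independence of `1, s, b, s b` over `F = L(t)`. -/
theorem indep {L F K : Type*} [Field L] [Field F] [Algebra L[X] F] [IsFractionRing L[X] F]
    [Field K] [Algebra F K] (t : F) (ht : t = algebraMap L[X] F X) (ht0 : t ≠ 0) (s b : K)
    (hs : (algebraMap F K t) ^ 2 * s ^ 2
      + (algebraMap F K t) ^ 2 * ((algebraMap F K t) ^ 2 - 2 * (algebraMap F K t)) * s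
      + (-(algebraMap F K t) ^ 5 + 3 * (algebraMap F K t) ^ 4 - 4 * (algebraMap F K t) ^ 2 + 1) = 0)
    (hb : (algebraMap F K t) * b ^ 2 + (algebraMap F K t) * s * b
      - ((algebraMap F K t) ^ 2 - 2 * (algebraMap F K t) - 1) = 0)
    (p0 p1 p2 p3 : F)
    (h : algebraMap F K p0 + algebraMap F K p1 * s + algebraMap F K p2 * b
      + algebraMap F K p3 * (s * b) = 0) : p0 = 0 ∧ p1 = 0 ∧ p2 = 0 ∧ p3 = 0 := by
  have inj := (algebraMap F K).injective
  -- `1, s` are independent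
  have ind2 : ∀ x y : F, algebraMap F K x + algebraMap F K y * s = 0 → x = 0 ∧ y = 0 := by
    intro x y hxy
    have hy : y = 0 := by
      by_contra hy
      have hy' : algebraMap F K y ≠ 0 := fun h0 => hy (inj (by rw [h0, map_zero]))
      have hs' : s = algebraMap F K (-x / y) := by
        rw [map_div₀, map_neg, eq_div_iff hy']
        linear_combination hxy
      apply no_root_s (-x / y) t ht
      apply inj
      rw [hs'] at hs
      simpa only [map_add, map_sub, map_mul, map_neg, map_pow, map_ofNat, map_one, map_zero]
        using hs
    subst hy
    refine ⟨inj ?_, rfl⟩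
    simpa using hxy
  have ht0' : algebraMap F K t ≠ 0 := fun h0 => ht0 (inj (by rw [h0, map_zero]))
  by_cases hd : algebraMap F K p2 + algebraMap F K p3 * s = 0
  · obtain ⟨h2, h3⟩ := ind2 _ _ hd
    obtain ⟨h0, h1⟩ := ind2 p0 p1 (by linear_combination h - b * hd)
    exact ⟨h0, h1, h2, h3⟩
  · exfalso
    -- the conjugate of `p2 + p3 s` and the norm, scaled by `t ^ 2`
    set n : F := t ^ 2 * p2 ^ 2 - t ^ 2 * (t ^ 2 - 2 * t) * p2 * p3
      + (-t ^ 5 + 3 * t ^ 4 - 4 * t ^ 2 + 1) * p3 ^ 2 with hn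
    have hnorm : algebraMap F K n = (algebraMap F K t) ^ 2
        * (algebraMap F K p2 + algebraMap F K p3 * s)
        * (algebraMap F K (p2 - (t ^ 2 - 2 * t) * p3) + algebraMap F K (-p3) * s) := by
      rw [hn]
      simp only [map_add, map_sub, map_mul, map_neg, map_pow, map_ofNat, map_one]
      linear_combination (algebraMap F K p3) ^ 2 * hs
    have hn0 : algebraMap F K n ≠ 0 := by
      rw [hnorm]
      refine mul_ne_zero (mul_ne_zero (pow_ne_zero 2 ht0') hd) ?_
      intro h0
      obtain ⟨h1, h2⟩ := ind2 _ _ h0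
      have h3 : p3 = 0 := neg_eq_zero.mp h2
      have h4 : p2 = 0 := by simpa [h3] using h1
      exact hd (by simp [h3, h4])
    have hn0' : n ≠ 0 := fun h0 => hn0 (by rw [h0, map_zero])
    obtain ⟨x, y, hxy⟩ : ∃ x y : F, b = algebraMap F K x + algebraMap F K y * s := by
      refine ⟨-(t ^ 2 * p0 * (p2 - (t ^ 2 - 2 * t) * p3)
          + p1 * p3 * (-t ^ 5 + 3 * t ^ 4 - 4 * t ^ 2 + 1)) / n,
        -(t ^ 2 * (p1 * p2 - p0 * p3)) / n, ?_⟩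
      rw [map_div₀, map_div₀, div_mul_eq_mul_div, ← add_div, eq_div_iff hn0, hnorm]
      simp only [map_add, map_sub, map_mul, map_neg, map_pow, map_ofNat, map_one]
      linear_combination (algebraMap F K t) ^ 2 * (algebraMap F K p2
        - ((algebraMap F K t) ^ 2 - 2 * algebraMap F K t) * algebraMap F K p3
        - algebraMap F K p3 * s) * h + algebraMap F K p1 * algebraMap F K p3 * hs
    have key := ind2 (t ^ 2 * x ^ 2 - (y ^ 2 + y) * (-t ^ 5 + 3 * t ^ 4 - 4 * t ^ 2 + 1)
      - t * (t ^ 2 - 2 * t - 1)) (t ^ 2 * ((2 * y + 1) * x - (y ^ 2 + y) * (t ^ 2 - 2 * t))) (by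
        simp only [map_add, map_sub, map_mul, map_neg, map_pow, map_ofNat, map_one]
        rw [hxy] at hb
        linear_combination algebraMap F K t * hb
          - ((algebraMap F K y) ^ 2 + algebraMap F K y) * hs)
    exact no_root_b x y t ht key.1 ((mul_eq_zero.mp key.2).resolve_left (pow_ne_zero 2 ht0))

theorem rel_one {A : Type*} [CommRing A] (b c t : A)
    (h00 : 1*b^3*c^2*t^2+1*b^2*c^2*t^3-1*b^2*c^2*t^2-1*b*c^2*t^3-1*b^3*c*t+1*b^2*c^2*t+1*b^2*c*t^2+2*b*c^2*t^2+1*b*c*t^3+1*b^2*c^2+1*b^2*c*t+1*b*c^2*t-1*b*c*t^2-1*c^2*t^2-1*c*t^3-1*b^2*t+1*b*c*t+1*c^2*t+1*c*t^2+2*b*c+1*b*t+1*c^2+2*c*t+1*c+1 = 0)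
    (h01 : -1*b^3*c*t^2-1*b^2*c*t^3+1*b^2*c^2*t+1*b*c^2*t^2+1*b^3*t-1*b^2*c*t-2*b*c*t^2-1*b^2*c+1*b*c*t+1*c^2*t+1*c*t^2-1*b*t-1*c*t-1*b-1*c-1 = 0)
    (h10 : 1*b^3*c^3*t^2+1*b^2*c^3*t^3-1*b^2*c^2*t^3-1*b*c^2*t^4-1*b^3*c^2*t+1*b^2*c^3*t+2*b^2*c^2*t^2+2*b*c^3*t^2+2*b*c^2*t^3+1*b^2*c^2*t+2*b^2*c*t^2+1*b*c^2*t^2-1*c^2*t^3-1*c*t^4-2*b^2*c*t+1*b*c^2*t+1*b*c*t^2+1*c^3*t+2*c^2*t^2+1*c*t^3-1*b^2*c-1*b^2*t+1*b*c*t+1*b*t^2+1*c^2*t+3*c*t^2+1*b*c-1*b*t-1*b-1*c+1 = 0)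
    (h11 : -1*b^3*c^2*t^2-1*b^2*c^2*t^3+1*b^2*c^2*t^2+1*b*c^2*t^3+1*b^3*c*t-1*b^2*c^2*t-1*b^2*c*t^2-2*b*c^2*t^2-1*b*c*t^3-2*b^2*c*t+1*c^2*t^2+1*c*t^3+1*b^2*t-1*b*c*t-1*c^2*t-1*c*t^2+1*b^2-1*b*t-2*c*t-1*b-1*t+1 = 0) : b*c*t-t^2+2*t+1 = 0 := by
  grind

theorem rel_two {A : Type*} [CommRing A] (b c t : A)
    (h00 : 1*b^3*c^2*t^2+1*b^2*c^2*t^3-1*b^2*c^2*t^2-1*b*c^2*t^3-1*b^3*c*t+1*b^2*c^2*t+1*b^2*c*t^2+2*b*c^2*t^2+1*b*c*t^3+1*b^2*c^2+1*b^2*c*t+1*b*c^2*t-1*b*c*t^2-1*c^2*t^2-1*c*t^3-1*b^2*t+1*b*c*t+1*c^2*t+1*c*t^2+2*b*c+1*b*t+1*c^2+2*c*t+1*c+1 = 0)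
    (h01 : -1*b^3*c*t^2-1*b^2*c*t^3+1*b^2*c^2*t+1*b*c^2*t^2+1*b^3*t-1*b^2*c*t-2*b*c*t^2-1*b^2*c+1*b*c*t+1*c^2*t+1*c*t^2-1*b*t-1*c*t-1*b-1*c-1 = 0)
    (h10 : 1*b^3*c^3*t^2+1*b^2*c^3*t^3-1*b^2*c^2*t^3-1*b*c^2*t^4-1*b^3*c^2*t+1*b^2*c^3*t+2*b^2*c^2*t^2+2*b*c^3*t^2+2*b*c^2*t^3+1*b^2*c^2*t+2*b^2*c*t^2+1*b*c^2*t^2-1*c^2*t^3-1*c*t^4-2*b^2*c*t+1*b*c^2*t+1*b*c*t^2+1*c^3*t+2*c^2*t^2+1*c*t^3-1*b^2*c-1*b^2*t+1*b*c*t+1*b*t^2+1*c^2*t+3*c*t^2+1*b*c-1*b*t-1*b-1*c+1 = 0)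
    (h11 : -1*b^3*c^2*t^2-1*b^2*c^2*t^3+1*b^2*c^2*t^2+1*b*c^2*t^3+1*b^3*c*t-1*b^2*c^2*t-1*b^2*c*t^2-2*b*c^2*t^2-1*b*c*t^3-2*b^2*c*t+1*c^2*t^2+1*c*t^3+1*b^2*t-1*b*c*t-1*c^2*t-1*c*t^2+1*b^2-1*b*t-2*c*t-1*b-1*t+1 = 0) :
    t^2*(c-b)^2+t^2*(t^2-2*t)*(c-b)+(-t^5+3*t^4-4*t^2+1) = 0 := by
  have := rel_one b c t h00 h01 h10 h11
  grind

theorem entries_zero {A : Type*} [CommRing A] (b c t w : A) (hw : t * w = 1)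
    (h1 : b*c*t-t^2+2*t+1 = 0)
    (h2 : t^2*(c-b)^2+t^2*(t^2-2*t)*(c-b)+(-t^5+3*t^4-4*t^2+1) = 0) :
    1*b^3*c^2*t^2+1*b^2*c^2*t^3-1*b^2*c^2*t^2-1*b*c^2*t^3-1*b^3*c*t+1*b^2*c^2*t+1*b^2*c*t^2+2*b*c^2*t^2+1*b*c*t^3+1*b^2*c^2+1*b^2*c*t+1*b*c^2*t-1*b*c*t^2-1*c^2*t^2-1*c*t^3-1*b^2*t+1*b*c*t+1*c^2*t+1*c*t^2+2*b*c+1*b*t+1*c^2+2*c*t+1*c+1 = 0 ∧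
    -1*b^3*c*t^2-1*b^2*c*t^3+1*b^2*c^2*t+1*b*c^2*t^2+1*b^3*t-1*b^2*c*t-2*b*c*t^2-1*b^2*c+1*b*c*t+1*c^2*t+1*c*t^2-1*b*t-1*c*t-1*b-1*c-1 = 0 ∧
    1*b^3*c^3*t^2+1*b^2*c^3*t^3-1*b^2*c^2*t^3-1*b*c^2*t^4-1*b^3*c^2*t+1*b^2*c^3*t+2*b^2*c^2*t^2+2*b*c^3*t^2+2*b*c^2*t^3+1*b^2*c^2*t+2*b^2*c*t^2+1*b*c^2*t^2-1*c^2*t^3-1*c*t^4-2*b^2*c*t+1*b*c^2*t+1*b*c*t^2+1*c^3*t+2*c^2*t^2+1*c*t^3-1*b^2*c-1*b^2*t+1*b*c*t+1*b*t^2+1*c^2*t+3*c*t^2+1*b*c-1*b*t-1*b-1*c+1 = 0 ∧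
    -1*b^3*c^2*t^2-1*b^2*c^2*t^3+1*b^2*c^2*t^2+1*b*c^2*t^3+1*b^3*c*t-1*b^2*c^2*t-1*b^2*c*t^2-2*b*c^2*t^2-1*b*c*t^3-2*b^2*c*t+1*c^2*t^2+1*c*t^3+1*b^2*t-1*b*c*t-1*c^2*t-1*c*t^2+1*b^2-1*b*t-2*c*t-1*b-1*t+1 = 0 := by
  have h3 : b * c = t-2-w := by linear_combination w * h1 + (t - 2 - b*c)*hw
  have h4 : c^2 = -b^2+2*b*c -(t^2-2*t)*(c-b)-w^2*(-t^5+3*t^4-4*t^2+1) := by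
    linear_combination w^2 * h2 - (t*w+1)*((c-b)^2+(t^2-2*t)*(c-b))*hw
  refine ⟨?_,?_,?_,?_⟩ <;> grind

theorem matrix_entries {A : Type*} [CommRing A] (b c t : A) :
    (!![0, 1; -1, t] * !![1, b; c, 1 + b * c] * !![0, 1; -1, t] * !![1 + b * c, -b; -c, 1]
      * !![t, -1; 1, 0] * !![t, -1; 1, 0]
    - !![1, b; c, 1 + b * c] * !![0, 1; -1, t] * !![0, 1; -1, t] * !![1 + b * c, -b; -c, 1]
      * !![t, -1; 1, 0] * !![1 + b * c, -b; -c, 1] : Matrix (Fin 2) (Fin 2) A) =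
    !![1*b^3*c^2*t^2+1*b^2*c^2*t^3-1*b^2*c^2*t^2-1*b*c^2*t^3-1*b^3*c*t+1*b^2*c^2*t+1*b^2*c*t^2+2*b*c^2*t^2+1*b*c*t^3+1*b^2*c^2+1*b^2*c*t+1*b*c^2*t-1*b*c*t^2-1*c^2*t^2-1*c*t^3-1*b^2*t+1*b*c*t+1*c^2*t+1*c*t^2+2*b*c+1*b*t+1*c^2+2*c*t+1*c+1,
      -1*b^3*c*t^2-1*b^2*c*t^3+1*b^2*c^2*t+1*b*c^2*t^2+1*b^3*t-1*b^2*c*t-2*b*c*t^2-1*b^2*c+1*b*c*t+1*c^2*t+1*c*t^2-1*b*t-1*c*t-1*b-1*c-1;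
      1*b^3*c^3*t^2+1*b^2*c^3*t^3-1*b^2*c^2*t^3-1*b*c^2*t^4-1*b^3*c^2*t+1*b^2*c^3*t+2*b^2*c^2*t^2+2*b*c^3*t^2+2*b*c^2*t^3+1*b^2*c^2*t+2*b^2*c*t^2+1*b*c^2*t^2-1*c^2*t^3-1*c*t^4-2*b^2*c*t+1*b*c^2*t+1*b*c*t^2+1*c^3*t+2*c^2*t^2+1*c*t^3-1*b^2*c-1*b^2*t+1*b*c*t+1*b*t^2+1*c^2*t+3*c*t^2+1*b*c-1*b*t-1*b-1*c+1,
      -1*b^3*c^2*t^2-1*b^2*c^2*t^3+1*b^2*c^2*t^2+1*b*c^2*t^3+1*b^3*c*t-1*b^2*c^2*t-1*b^2*c*t^2-2*b*c^2*t^2-1*b*c*t^3-2*b^2*c*t+1*c^2*t^2+1*c*t^3+1*b^2*t-1*b*c*t-1*c^2*t-1*c*t^2+1*b^2-1*b*t-2*c*t-1*b-1*t+1] := by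
  ext i j
  fin_cases i <;> fin_cases j <;>
    simp <;> ring

/-- Normal forms: up to a power of `t`, everything is an `L[t]`-combination of `1, s, b, s b`. -/
theorem normal_form {L A : Type*} [Field L] [CommRing A] [Algebra L A] (b c t : A)
    (h1 : b*c*t-t^2+2*t+1 = 0)
    (h2 : t^2*(c-b)^2+t^2*(t^2-2*t)*(c-b)+(-t^5+3*t^4-4*t^2+1) = 0)
    (g : MvPolynomial (Fin 3) L) :
    ∃ (n : ℕ) (p0 p1 p2 p3 : L[X]), t ^ n * MvPolynomial.aeval ![b, c, t] g =
      aeval t p0 + aeval t p1 * (c - b) + aeval t p2 * b + aeval t p3 * ((c - b) * b) := by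
  induction g using MvPolynomial.induction_on with
  | C a => exact ⟨0, C a, 0, 0, 0, by simp⟩
  | add p q hp hq =>
    obtain ⟨n, p0, p1, p2, p3, hp⟩ := hp
    obtain ⟨m, q0, q1, q2, q3, hq⟩ := hq
    refine ⟨n + m, X ^ m * p0 + X ^ n * q0, X ^ m * p1 + X ^ n * q1, X ^ m * p2 + X ^ n * q2,
      X ^ m * p3 + X ^ n * q3, ?_⟩
    simp only [map_add, map_mul, map_pow, aeval_X]
    linear_combination t ^ m * hp + t ^ n * hq
  | mul_X p i hp =>
    obtain ⟨n, p0, p1, p2, p3, hp⟩ := hp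
    rw [map_mul, MvPolynomial.aeval_X]
    have hb : ∃ q0 q1 q2 q3 : L[X], t ^ (n + 2) * (MvPolynomial.aeval ![b, c, t] p * b) =
        aeval t q0 + aeval t q1 * (c - b) + aeval t q2 * b + aeval t q3 * ((c - b) * b) := by
      refine ⟨p2 * (X * (X ^ 2 - 2 * X - 1)), p3 * (X * (X ^ 2 - 2 * X - 1)),
        X ^ 2 * p0 + p3 * (-X ^ 5 + 3 * X ^ 4 - 4 * X ^ 2 + 1),
        X ^ 2 * p1 - X ^ 2 * p2 + p3 * (X ^ 2 * (X ^ 2 - 2 * X)), ?_⟩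
      simp only [map_add, map_sub, map_neg, map_mul, map_pow, aeval_X, map_ofNat, map_one]
      linear_combination t ^ 2 * b * hp + (t * aeval t p2 + t * aeval t p3 * (c - b)) * h1
        - aeval t p3 * b * h2
    have hs : ∃ q0 q1 q2 q3 : L[X], t ^ (n + 2) * (MvPolynomial.aeval ![b, c, t] p * (c - b)) =
        aeval t q0 + aeval t q1 * (c - b) + aeval t q2 * b + aeval t q3 * ((c - b) * b) := by
      refine ⟨-p1 * (-X ^ 5 + 3 * X ^ 4 - 4 * X ^ 2 + 1),
        X ^ 2 * p0 - p1 * (X ^ 2 * (X ^ 2 - 2 * X)),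
        -p3 * (-X ^ 5 + 3 * X ^ 4 - 4 * X ^ 2 + 1),
        X ^ 2 * p2 - p3 * (X ^ 2 * (X ^ 2 - 2 * X)), ?_⟩
      simp only [map_add, map_sub, map_neg, map_mul, map_pow, aeval_X, map_ofNat, map_one]
      linear_combination t ^ 2 * (c - b) * hp + (aeval t p1 + aeval t p3 * b) * h2
    obtain ⟨q0, q1, q2, q3, hb⟩ := hb
    obtain ⟨r0, r1, r2, r3, hs⟩ := hs
    fin_cases i
    · exact ⟨n + 2, q0, q1, q2, q3, hb⟩
    · refine ⟨n + 2, q0 + r0, q1 + r1, q2 + r2, q3 + r3, ?_⟩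
      simp only [map_add]
      change t ^ (n + 2) * (MvPolynomial.aeval ![b, c, t] p * c) = _
      linear_combination hb + hs
    · refine ⟨n, X * p0, X * p1, X * p2, X * p3, ?_⟩
      simp only [map_mul, aeval_X]
      change t ^ n * (MvPolynomial.aeval ![b, c, t] p * t) = _
      linear_combination t * hp

end Polynomial

/-- Existence of the generic point of the curve. -/
theorem exists_point {K : Type*} [Field K] [IsAlgClosed K] (t : K) (ht : t ≠ 0) :
    ∃ s b : K, t ^ 2 * s ^ 2 + t ^ 2 * (t ^ 2 - 2 * t) * s
      + (-t ^ 5 + 3 * t ^ 4 - 4 * t ^ 2 + 1) = 0 ∧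
      t * b ^ 2 + t * s * b - (t ^ 2 - 2 * t - 1) = 0 := by
  have hq : ∀ u v w : K, u ≠ 0 → ∃ x, u * x ^ 2 + v * x + w = 0 := by
    intro u v w hu
    obtain ⟨x, hx⟩ := IsAlgClosed.exists_root
      (Polynomial.C u * Polynomial.X ^ 2 + Polynomial.C v * Polynomial.X + Polynomial.C w)
      (by rw [Polynomial.degree_quadratic hu]; decide)
    exact ⟨x, by simpa [Polynomial.IsRoot] using hx⟩
  obtain ⟨s, hs⟩ := hq (t ^ 2) (t ^ 2 * (t ^ 2 - 2 * t))
    (-t ^ 5 + 3 * t ^ 4 - 4 * t ^ 2 + 1) (pow_ne_zero 2 ht)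
  obtain ⟨b, hb⟩ := hq t (t * s) (-(t ^ 2 - 2 * t - 1)) ht
  exact ⟨s, b, hs, by linear_combination hb⟩

/-- The relations hold modulo `pslIdeal L`. -/
theorem quotient_relations (L : Type*) [Field L] :
    let q := Ideal.Quotient.mk (pslIdeal L)
    q (X 0) * q (X 1) * q (X 2) - q (X 2) ^ 2 + 2 * q (X 2) + 1 = 0 ∧
    q (X 2) ^ 2 * (q (X 1) - q (X 0)) ^ 2
      + q (X 2) ^ 2 * (q (X 2) ^ 2 - 2 * q (X 2)) * (q (X 1) - q (X 0))
      + (-q (X 2) ^ 5 + 3 * q (X 2) ^ 4 - 4 * q (X 2) ^ 2 + 1) = 0 := by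
  intro q
  have hz : ∀ i j : Fin 2, q ((!![0, 1; -1, X 2] * !![1, X 0; X 1, 1 + X 0 * X 1]
      * !![0, 1; -1, X 2] * !![1 + X 0 * X 1, -X 0; -X 1, 1] * !![X 2, -1; 1, 0]
      * !![X 2, -1; 1, 0]
    - !![1, X 0; X 1, 1 + X 0 * X 1] * !![0, 1; -1, X 2] * !![0, 1; -1, X 2]
      * !![1 + X 0 * X 1, -X 0; -X 1, 1] * !![X 2, -1; 1, 0]
      * !![1 + X 0 * X 1, -X 0; -X 1, 1] :
      Matrix (Fin 2) (Fin 2) (MvPolynomial (Fin 3) L)) i j) = 0 := by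
    intro i j
    rw [Ideal.Quotient.eq_zero_iff_mem]
    exact Ideal.subset_span ⟨(i, j), rfl⟩
  rw [Polynomial.matrix_entries] at hz
  have h00 := hz 0 0
  have h01 := hz 0 1
  have h10 := hz 1 0
  have h11 := hz 1 1
  simp only [Matrix.of_apply, Matrix.cons_val', Matrix.cons_val_zero, Matrix.cons_val_one,
    Matrix.cons_val_fin_one, map_add, map_sub, map_neg, map_mul, map_pow, map_ofNat, map_one]
    at h00 h01 h10 h11
  exact ⟨Polynomial.rel_one _ _ _ h00 h01 h10 h11, Polynomial.rel_two _ _ _ h00 h01 h10 h11⟩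

/-- `pslIdeal L` vanishes at every point satisfying the relations. -/
theorem pslIdeal_le_ker (L : Type*) [Field L] {K : Type*} [CommRing K]
    (φ : MvPolynomial (Fin 3) L →+* K) (w : K) (hw : φ (X 2) * w = 1)
    (h1 : φ (X 0) * φ (X 1) * φ (X 2) - φ (X 2) ^ 2 + 2 * φ (X 2) + 1 = 0)
    (h2 : φ (X 2) ^ 2 * (φ (X 1) - φ (X 0)) ^ 2
      + φ (X 2) ^ 2 * (φ (X 2) ^ 2 - 2 * φ (X 2)) * (φ (X 1) - φ (X 0))
      + (-φ (X 2) ^ 5 + 3 * φ (X 2) ^ 4 - 4 * φ (X 2) ^ 2 + 1) = 0) :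
    pslIdeal L ≤ RingHom.ker φ := by
  obtain ⟨h00, h01, h10, h11⟩ := Polynomial.entries_zero _ _ _ w hw h1 h2
  refine Ideal.span_le.mpr ?_
  rintro _ ⟨⟨i, j⟩, rfl⟩
  simp only [SetLike.mem_coe, RingHom.mem_ker]
  rw [Polynomial.matrix_entries]
  fin_cases i <;> fin_cases j <;>
    simp only [Fin.zero_eta, Fin.mk_one, Matrix.of_apply, Matrix.cons_val', Matrix.cons_val_zero,
      Matrix.cons_val_one, Matrix.cons_val_fin_one, map_add, map_sub, map_neg, map_mul, map_pow,
      map_ofNat, map_one]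
  · exact h00
  · exact h01
  · exact h10
  · exact h11

/-- Over an algebraically closed field of prime characteristic, the ideal `I` is prime. -/
theorem pslIdeal_isPrime (p : ℕ) (hp : p.Prime)
    (L : Type*) [Field L] [IsAlgClosed L] [CharP L p] :
    (pslIdeal L).IsPrime := by
  let F := FractionRing (Polynomial L)
  let K := AlgebraicClosure F
  let t : F := algebraMap (Polynomial L) F Polynomial.X
  have ht0 : t ≠ 0 := fun h0 => Polynomial.X_ne_zero
    (IsFractionRing.injective (Polynomial L) F (by rw [map_zero]; exact h0))
  let τ : K := algebraMap F K t
  have hτ0 : τ ≠ 0 := fun h0 => ht0 ((algebraMap F K).injective (by rw [map_zero]; exact h0))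
  obtain ⟨s, b, hs, hb⟩ := exists_point τ hτ0
  let φ : MvPolynomial (Fin 3) L →ₐ[L] K := aeval ![b, b + s, τ]
  have e0 : φ (X 0) = b := by simp [φ]
  have e1 : φ (X 1) = b + s := by simp [φ]
  have e2 : φ (X 2) = τ := by simp [φ]
  have hk1 : b * (b + s) * τ - τ ^ 2 + 2 * τ + 1 = 0 := by linear_combination hb
  have hk2 : τ ^ 2 * ((b + s) - b) ^ 2 + τ ^ 2 * (τ ^ 2 - 2 * τ) * ((b + s) - b)
      + (-τ ^ 5 + 3 * τ ^ 4 - 4 * τ ^ 2 + 1) = 0 := by linear_combination hs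
  have hle : pslIdeal L ≤ RingHom.ker (φ : MvPolynomial (Fin 3) L →+* K) := by
    refine pslIdeal_le_ker L _ τ⁻¹ ?_ ?_ ?_ <;>
      simp only [RingHom.coe_coe, e0, e1, e2]
    · exact mul_inv_cancel₀ hτ0
    · exact hk1
    · exact hk2
  suffices hker : RingHom.ker (φ : MvPolynomial (Fin 3) L →+* K) ≤ pslIdeal L by
    rw [le_antisymm hle hker]
    exact RingHom.ker_isPrime _
  intro g hg
  rw [RingHom.mem_ker, RingHom.coe_coe] at hg
  obtain ⟨r1, r2⟩ := quotient_relations L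
  set q := Ideal.Quotient.mk (pslIdeal L) with hq
  obtain ⟨n, p0, p1, p2, p3, hn⟩ := Polynomial.normal_form (L := L) _ _ _ r1 r2 g
  have hqg : aeval ![q (X 0), q (X 1), q (X 2)] g = q g := by
    have : (aeval ![q (X 0), q (X 1), q (X 2)] : MvPolynomial (Fin 3) L →ₐ[L] _)
        = Ideal.Quotient.mkₐ L (pslIdeal L) := by
      ext i
      fin_cases i <;> simp [hq]
    rw [this]
    rfl
  rw [hqg] at hn
  -- the same identity holds in `K`, where the left side is zero
  let ψ : (MvPolynomial (Fin 3) L ⧸ pslIdeal L) →ₐ[L] K :=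
    Ideal.Quotient.liftₐ (pslIdeal L) φ (fun a ha => hle ha)
  have hψ : ∀ a, ψ (q a) = φ a := fun a => rfl
  have hK := congrArg ψ hn
  simp only [map_mul, map_add, map_sub, map_pow, hψ, hg, e0, e1, e2, mul_zero,
    ← Polynomial.aeval_algHom_apply] at hK
  have hτ : ∀ f : Polynomial L,
      Polynomial.aeval τ f = algebraMap F K (algebraMap (Polynomial L) F f) := by
    intro f
    have : τ = algebraMap (Polynomial L) K Polynomial.X :=
      (IsScalarTower.algebraMap_apply (Polynomial L) F K _).symm
    rw [← IsScalarTower.algebraMap_apply (Polynomial L) F K, this,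
      Polynomial.aeval_algebraMap_apply, Polynomial.aeval_X_left_apply]
  simp only [hτ] at hK
  obtain ⟨h0, h1, h2, h3⟩ := Polynomial.indep (L := L) t rfl ht0 s b hs hb
    (algebraMap _ F p0) (algebraMap _ F p1) (algebraMap _ F p2) (algebraMap _ F p3)
    (by linear_combination -hK)
  have hz : ∀ f : Polynomial L, algebraMap (Polynomial L) F f = 0 → f = 0 := fun f hf =>
    IsFractionRing.injective (Polynomial L) F (by rw [hf, map_zero])
  rw [hz _ h0, hz _ h1, hz _ h2, hz _ h3] at hn
  simp only [map_zero, zero_mul, add_zero] at hn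
  -- `t` is a unit modulo the ideal
  have hu : IsUnit (q (X 2)) := IsUnit.of_mul_eq_one (q (X 2) - 2 - q (X 0) * q (X 1))
    (by linear_combination -r1)
  have := (hu.pow n).mul_right_eq_zero.mp hn
  exact Ideal.Quotient.eq_zero_iff_mem.mp this

end
end

section
/- Let p be a prime and L an algebraically closed field of characteristic p, and set h = t(t² − 2t − 1) ∈ L[b,c,t]. Then the ideal quotient I : h equals I, i.e. every g ∈ L[b,c,t] with h·g ∈ I already lies in I. -/
open MvPolynomial

noncomputable section

/-- The polynomial `bct - (t² - 2t - 1)`. -/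
def pslU (L : Type*) [Field L] : MvPolynomial (Fin 3) L :=
  X 0 * X 1 * X 2 - (X 2 ^ 2 - 2 * X 2 - 1)

/-- The second generator of the ideal. -/
def pslQ (L : Type*) [Field L] : MvPolynomial (Fin 3) L :=
  X 0 ^ 2 * X 1 ^ 2 - X 0 * X 2 ^ 2 + X 1 * X 2 ^ 2 - X 2 ^ 3 + X 0 ^ 2 + 2 * X 0 * X 1
    + 2 * X 0 * X 2 + X 1 ^ 2 - 2 * X 1 * X 2 + 2 * X 2 ^ 2 + 2

/-- The ideal is a complete intersection. -/
lemma pslIdeal_eq (L : Type*) [Field L] : pslIdeal L = Ideal.span {pslU L, pslQ L} := by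
  apply le_antisymm
  · unfold pslIdeal
    rw [Ideal.span_le]
    rintro _ ⟨⟨i, j⟩, rfl⟩
    rw [SetLike.mem_coe, Ideal.mem_span_pair]
    generalize hb : (X 0 : MvPolynomial (Fin 3) L) = b
    generalize hc : (X 1 : MvPolynomial (Fin 3) L) = c
    generalize ht : (X 2 : MvPolynomial (Fin 3) L) = t
    unfold pslU pslQ
    rw [hb, hc, ht]
    fin_cases i <;> fin_cases j <;> simp
    · exact ⟨b^2*c*t+b*c*t^2+b*t^2-c*t^2+t^3-b^2-b*t+2*c*t-t^2+c-1, -t^2+t+1, by ring⟩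
    · exact ⟨-b^2*c-b^2*t-b*t^2-b*t+c*t-t^2-b-c-1, b*t+t, by ring⟩
    · exact ⟨b*c^2*t^2+b*t^3-c*t^3+t^4-b^2*c-b^2*t-2*b*c*t-2*b*t^2+c^2*t+2*c*t^2-2*t^3+b*c+b*t
        +t^2-b-c-2*t+1, b*c*t^2-t^3+c*t+2*t^2, by ring⟩
    · exact ⟨-b^2*c*t-b*c*t^2-b*t^2+c*t^2-t^3+b^2+b*t-2*c*t+t^2-b-t+1, t^2-t, by ring⟩
  · have key : ∀ i j : Fin 2, _ ∈ pslIdeal L := fun i j =>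
      Ideal.subset_span (Set.mem_range_self (i, j))
    have h00 := key 0 0
    have h01 := key 0 1
    have h10 := key 1 0
    have h11 := key 1 1
    clear key
    simp at h00 h01 h10 h11
    have hu : pslU L ∈ pslIdeal L := by
      unfold pslU
      generalize pslIdeal L = I at *
      generalize (X 0 : MvPolynomial (Fin 3) L) = b at *
      generalize (X 1 : MvPolynomial (Fin 3) L) = c at *
      generalize (X 2 : MvPolynomial (Fin 3) L) = t at *
      have := I.add_mem (I.add_mem (I.mul_mem_left (-1) h00)
        (I.mul_mem_left (-b*c*t-c-t-1) h01)) (I.add_mem h10 (I.mul_mem_left (b*t+t) h11))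
      convert this using 1
      ring
    have hq : pslQ L ∈ pslIdeal L := by
      unfold pslQ
      unfold pslU at hu
      generalize pslIdeal L = I at *
      generalize (X 0 : MvPolynomial (Fin 3) L) = b at *
      generalize (X 1 : MvPolynomial (Fin 3) L) = c at *
      generalize (X 2 : MvPolynomial (Fin 3) L) = t at *
      have := I.add_mem (I.add_mem h00 h11) (I.mul_mem_left (b-c+t) hu)
      convert this using 1
      ring
    rw [Ideal.span_le]
    rintro x (rfl | rfl)
    · exact hu
    · exact hq

/-- The polynomial `t² - 2t - 1` in one variable. -/
def pslH (L : Type*) [Field L] : Polynomial L :=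
  Polynomial.X ^ 2 - 2 * Polynomial.X - 1

lemma pslH_root (L : Type*) [Field L] :
    (AdjoinRoot.root (pslH L)) ^ 2 - 2 * AdjoinRoot.root (pslH L) - 1 = 0 := by
  have := AdjoinRoot.mk_self (f := pslH L)
  conv at this =>
    lhs
    arg 2
    unfold pslH
  simpa [map_ofNat] using this

/-- Reduction modulo `X i` and `t² - 2t - 1`. -/
def pslPhi (L : Type*) [Field L] (i : Fin 3) :
    MvPolynomial (Fin 3) L →ₐ[L] Polynomial (AdjoinRoot (pslH L)) :=
  aeval fun k => if k = 2 then Polynomial.C (AdjoinRoot.root (pslH L)) else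
    if k = i then 0 else Polynomial.X

lemma pslPhi_ker (L : Type*) [Field L] (i j : Fin 3) (hi : i ≠ 2) (hj : j ≠ 2) (hij : i ≠ j)
    (x : MvPolynomial (Fin 3) L) (hx : pslPhi L i x = 0) :
    x ∈ Ideal.span {(X i : MvPolynomial (Fin 3) L), X 2 ^ 2 - 2 * X 2 - 1} := by
  set J := Ideal.span {(X i : MvPolynomial (Fin 3) L), X 2 ^ 2 - 2 * X 2 - 1} with hJ
  have h1 : Ideal.Quotient.mk J (X i) = 0 :=
    Ideal.Quotient.eq_zero_iff_mem.2 (Ideal.subset_span (by simp))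
  have h2 : Ideal.Quotient.mk J (X 2 ^ 2 - 2 * X 2 - 1) = 0 :=
    Ideal.Quotient.eq_zero_iff_mem.2 (Ideal.subset_span (by simp))
  let ψ0 : AdjoinRoot (pslH L) →+* (MvPolynomial (Fin 3) L ⧸ J) :=
    AdjoinRoot.lift ((Ideal.Quotient.mk J).comp MvPolynomial.C) (Ideal.Quotient.mk J (X 2)) (by
      unfold pslH
      simpa [Polynomial.eval₂_sub, Polynomial.eval₂_mul, map_ofNat] using h2)
  let ψ : Polynomial (AdjoinRoot (pslH L)) →+* (MvPolynomial (Fin 3) L ⧸ J) :=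
    Polynomial.eval₂RingHom ψ0 (Ideal.Quotient.mk J (X j))
  have hcomp : ψ.comp (pslPhi L i).toRingHom = Ideal.Quotient.mk J := by
    apply MvPolynomial.ringHom_ext
    · intro r
      have : pslPhi L i (MvPolynomial.C r) = Polynomial.C (AdjoinRoot.of (pslH L) r) := by
        unfold pslPhi
        rw [MvPolynomial.aeval_C]
        rfl
      simp [this, ψ, ψ0]
    · intro k
      by_cases hk2 : k = 2
      · subst hk2
        simp [pslPhi, ψ, ψ0]
      · by_cases hki : k = i
        · subst hki
          simp [pslPhi, hk2, h1]
        · have : k = j := by omega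
          subst this
          simp [pslPhi, hk2, hki, ψ]
  have : Ideal.Quotient.mk J x = 0 := by
    rw [← hcomp]
    simp [hx]
  exact Ideal.Quotient.eq_zero_iff_mem.1 this

lemma pslPhi_U (L : Type*) [Field L] (i : Fin 3) (hi : i = 0 ∨ i = 1) :
    pslPhi L i (pslU L) = 0 := by
  have h := congrArg Polynomial.C (pslH_root L)
  simp only [map_sub, map_mul, map_pow, map_one, map_zero, map_ofNat] at h
  rcases hi with rfl | rfl <;> simp [pslPhi, pslU, h]

lemma pslPhi_Q (L : Type*) [Field L] (i : Fin 3) (hi : i = 0 ∨ i = 1) :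
    (pslPhi L i (pslQ L)).Monic := by
  set r := AdjoinRoot.root (pslH L) with hr
  rcases hi with rfl | rfl
  · have : pslPhi L 0 (pslQ L) = Polynomial.X ^ 2 + (Polynomial.C (r ^ 2 - 2 * r) * Polynomial.X
        + Polynomial.C (-r ^ 3 + 2 * r ^ 2 + 2)) := by
      simp [pslPhi, pslQ, ← hr, map_ofNat]
      ring
    rw [this]
    exact Polynomial.monic_X_pow_add (lt_of_le_of_lt Polynomial.degree_linear_le (by norm_num))
  · have : pslPhi L 1 (pslQ L) = Polynomial.X ^ 2 + (Polynomial.C (-r ^ 2 + 2 * r) * Polynomial.X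
        + Polynomial.C (-r ^ 3 + 2 * r ^ 2 + 2)) := by
      simp [pslPhi, pslQ, ← hr, map_ofNat]
      ring
    rw [this]
    exact Polynomial.monic_X_pow_add (lt_of_le_of_lt Polynomial.degree_linear_le (by norm_num))

/-- `b` and `c` are regular modulo the ideal. -/
lemma pslIdeal_regular (L : Type*) [Field L] (i : Fin 3) (hi : i = 0 ∨ i = 1)
    (g : MvPolynomial (Fin 3) L) (hg : X i * g ∈ pslIdeal L) : g ∈ pslIdeal L := by
  rw [pslIdeal_eq, Ideal.mem_span_pair] at hg ⊢
  obtain ⟨A, B, hAB⟩ := hg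
  have hB : pslPhi L i B = 0 := by
    have h := congrArg (pslPhi L i) hAB
    have hX : pslPhi L i (X i) = 0 := by
      rcases hi with rfl | rfl <;> simp [pslPhi]
    rw [map_add, map_mul, map_mul, map_mul, pslPhi_U L i hi, hX, mul_zero, zero_add,
      zero_mul] at h
    exact (pslPhi_Q L i hi).mul_left_eq_zero_iff.1 h
  have hB' : B ∈ Ideal.span {(X i : MvPolynomial (Fin 3) L), X 2 ^ 2 - 2 * X 2 - 1} := by
    rcases hi with rfl | rfl
    · exact pslPhi_ker L 0 1 (by decide) (by decide) (by decide) B hB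
    · exact pslPhi_ker L 1 0 (by decide) (by decide) (by decide) B hB
  obtain ⟨B1, D, hD⟩ := Ideal.mem_span_pair.1 hB'
  obtain ⟨w, hw⟩ : ∃ w : MvPolynomial (Fin 3) L,
      (X 2 ^ 2 - 2 * X 2 - 1 : MvPolynomial (Fin 3) L) = X i * w - pslU L := by
    rcases hi with rfl | rfl
    · exact ⟨X 1 * X 2, by unfold pslU; ring⟩
    · exact ⟨X 0 * X 2, by unfold pslU; ring⟩
  rw [hw] at hD
  have hndvd : ¬ (X i : MvPolynomial (Fin 3) L) ∣ pslU L := by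
    rintro ⟨v, hv⟩
    have := congrArg (MvPolynomial.eval (fun _ => (0 : L))) hv
    simp [pslU] at this
  have heq : X i * (g - (B1 + D * w) * pslQ L) = pslU L * (A - D * pslQ L) := by
    rw [← hD] at hAB
    linear_combination -hAB
  have hp : Prime (X i : MvPolynomial (Fin 3) L) := MvPolynomial.X_prime
  obtain ⟨E, hE⟩ := (hp.dvd_or_dvd ⟨_, heq.symm⟩).resolve_left hndvd
  refine ⟨E, B1 + D * w, ?_⟩
  apply mul_left_cancel₀ hp.ne_zero
  rw [hE] at heq
  linear_combination -heq

/-- Over an algebraically closed field of prime characteristic, with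
`h = t(t² − 2t − 1)`, the ideal quotient `I : h` equals `I`: every `g` with `h·g ∈ I`
already lies in `I`. -/
theorem pslIdeal_colon (p : ℕ) (hp : p.Prime)
    (L : Type*) [Field L] [IsAlgClosed L] [CharP L p] :
    ∀ g : MvPolynomial (Fin 3) L,
      (X 2 : MvPolynomial (Fin 3) L) * ((X 2) ^ 2 - 2 * X 2 - 1) * g ∈ pslIdeal L →
        g ∈ pslIdeal L := by
  intro g hg
  have hu : pslU L ∈ pslIdeal L := by
    rw [pslIdeal_eq]
    exact Ideal.subset_span (by simp)
  apply pslIdeal_regular L 0 (Or.inl rfl)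
  apply pslIdeal_regular L 1 (Or.inr rfl)
  -- `t` has inverse `s = t - 2 - bc` modulo `u`
  have key : (X 1 * (X 0 * g) : MvPolynomial (Fin 3) L) =
      (X 2 - 2 - X 0 * X 1) ^ 2 * (X 2 * (X 2 ^ 2 - 2 * X 2 - 1) * g) +
      ((X 2 - 2 - X 0 * X 1) ^ 2 * X 2 * g
        + (2 - pslU L) * (X 1 * X 0 * g)) * pslU L := by
    unfold pslU
    ring
  rw [key]
  exact Ideal.add_mem _ (Ideal.mul_mem_left _ _ hg) (Ideal.mul_mem_left _ _ hu)

end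
end
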